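/- **Data schemas and catalogs.** Fix types, each with a domain containing an object $\mathtt{undef}$ and a finite set of objects usable as constants (including $\mathtt{undef}$, and all objects if the domain is finite); identifier types have infinite domains. A data schema $\mathcal D=\langle Cat,CType,Repo,X\rangle$ consists of a finite read-only catalog $Cat$ of relation schemas with single-column primary keys of pairwise different identifier types and foreign keys into the catalog, an identifier type $CType$ of cases, a finite set $Repo$ of read-write relation schemas whose identifier attributes refer to the catalog or to cases, and a finite set $X$ of typed case variables including a never-modified $self:CType$. A catalog instance is a finite database over $Cat$ without $\mathtt{undef}$ that satisfies the keys and contains the catalog identifiers used as constants. A guard is a disjunction of conjunctions of equalities and inequalities between variables and constants, and of atoms and negated atoms over $Cat\cup Repo$; its variables are case variables or normal variables, the latter ranging over objects that, for a catalog identifier type, are $\mathtt{undef}$ or occur in the catalog. **DABs.** A DAB $M=\langle\mathcal D,P\rangle$ is a data schema with a block-structured process $P$: a root process block built from tasks (atomic or nonatomic), events, (sub)processes, sequences, deferred, exclusive, inclusive and event-driven choices, parallel blocks, loops, possible completions, and blocks with (non-)interrupting boundary events, whose choices carry Boolean combinations of equalities between case variables and constants, and whose tasks and events carry update specifications, i.e.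 a guard (precondition) and an effect: assign values to case variables, insert a tuple into, or delete one from, a repository relation together with such an assignment, or update every tuple of a repository relation conditionally (if-then-else with repository-free filters). The assigned, inserted and deleted values are normal variables of the precondition or constants. $M$ is case-identifier-agnostic if no update specification mentions $self$. **Executions.** For a catalog instance, a snapshot assigns to finitely many case identifiers the values of the case variables and the lifecycle states (idle, enabled, active, completed, error) of all blocks, and to each repository relation a finite multiset of tuples. Executions start without cases and with an empty repository; a step creates a new case with a fresh identifier, or advances one case by one lifecycle rule of a block, performing the attached test or update for a binding of the normal variables satisfying the precondition; all snapshots must satisfy the foreign keys. Under the multiset insertion semantics an inserted tuple is added to the relation; under the set insertion semantics it replaces the tuples agreeing with it on a given set of key attributes (by default all). A property $\upsilon$ over $n$ cases is a conjunction $\bigwedge_{i=1}^n G_i[i]$ of guards, which may also compare lifecycle states, such that each normal variable of $G_i$ occurs in a repository atom of $G_i$; a snapshot satisfies $\upsilon$ if $n$ distinct cases and some values of the normal variables satisfy the guards. **BackReach.** $M$ and $\upsilon$ are translated into a relational artifact system over the database theory $T$ that has a unary function symbol for every non-key catalog attribute and the axioms $\forall x\,(x=\mathtt{undef}\leftrightarrow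 f(x)=\mathtt{undef})$, distinctness of constants, and exhaustiveness of the constants of types with finite domain: one array per case variable and per block lifecycle, indexed by process instances (the array for $self$ having pairwise distinct defined values), and arrays for the attributes and the occupation of the entries of each repository relation; a catalog atom $R(t_0,\dots,t_m)$ becomes $t_0\neq\mathtt{undef}\wedge\bigwedge_k t_k=f_k(t_0)$, a repository atom an existentially quantified entry, a negated repository atom a condition on all entries, and every lifecycle rule a transition formula. $\mathsf{BackReach}$ then computes backward: starting from a state formula $\varphi$ (existentially quantified over indexes) obtained from the translated property by eliminating the data quantifiers in the model completion $T^*$, and from $B=\bot$, it answers 'no' if $\varphi\wedge\neg B$ is $T$-unsatisfiable; otherwise it answers 'yes' if $\varphi$ is $T$-satisfiable together with the initial formula; otherwise it replaces $B$ by $\varphi\vee B$ and $\varphi$ by a state formula equivalent in $T^*$ to the preimage of $\varphi$, and repeats. **Theorem.** Let $M$ be a case-identifier-agnostic DAB with the multiset or the set insertion semantics, and $\upsilon$ a property of $M$ (with no bound on the number of concurrent cases or of repository tuples). Whenever $\mathsf{BackReach}$ terminates on $M$ and $\upsilon$, it answers 'yes' if and only if, for some catalog instance, some execution of $M$ reaches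 a snapshot satisfying $\upsilon$. -/

import Mathlib

namespace DABVerif

/-! ## Sorted contexts -/

/-- A finite family of sorted variables. -/
structure Ctx (K : Type) where
  ι : Type
  fin : Finite ι
  ty : ι → K

/-- The variables of sort `S` of a context. -/
inductive Ctx.Var {K : Type} (Γ : Ctx K) : K → Type
  | mk (k : Γ.ι) : Ctx.Var Γ (Γ.ty k)

def Ctx.Var.pos {K : Type} {Γ : Ctx K} {S : K} : Γ.Var S → Γ.ι
  | .mk k => k

/-- A family of variables extended by one variable `new` of sort `σ`. -/
inductive Snoc {K : Type} (σ : K) (V : K → Type) : K → Type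
  | new : Snoc σ V σ
  | old {τ : K} (v : V τ) : Snoc σ V τ

def Snoc.elim {K : Type} {σ : K} {V : K → Type} {X : K → Type} (y : X σ)
    (e : (τ : K) → V τ → X τ) : (τ : K) → Snoc σ V τ → X τ
  | _, Snoc.new => y
  | _, Snoc.old v => e _ v

/-! ## Read-only databases: DB signatures, the DB theory `T` and its models -/

/-- A DB signature: sorts, unary function symbols and constants, with a constant `undef` for
every sort.  `enum S` marks the sorts with a finite, explicitly enumerated domain. -/
structure DBSig where
  Srt : Type
  Fn : Type
  src : Fn → Srt
  tgt : Fn → Srt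
  Const : Srt → Type
  undef : (S : Srt) → Const S
  enum : Srt → Prop

/-- Models of the DB theory `T`, which consists of the universal axioms
`∀ x, x = undef ↔ f x = undef` for every function symbol `f`, the distinctness of different
constants, and, for every enumerated sort, the axiom that each element is one of its constants. -/
structure DBModel (Sg : DBSig) where
  carrier : Sg.Srt → Type
  const : (S : Sg.Srt) → Sg.Const S → carrier S
  fn : (f : Sg.Fn) → carrier (Sg.src f) → carrier (Sg.tgt f)
  null : ∀ f x, x = const _ (Sg.undef _) ↔ fn f x = const _ (Sg.undef _)
  distinct : ∀ S, Function.Injective (const S)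
  closed : ∀ S, Sg.enum S → Function.Surjective (const S)

/-- Embeddings of models of `T`. -/
structure DBModel.Emb {Sg : DBSig} (M N : DBModel Sg) where
  map : (S : Sg.Srt) → M.carrier S → N.carrier S
  inj : ∀ S, Function.Injective (map S)
  map_const : ∀ S c, map S (M.const S c) = N.const S c
  map_fn : ∀ f x, map _ (M.fn f x) = N.fn f (map _ x)

/-- Terms over the signature with variables in `V`. -/
inductive STerm (Sg : DBSig) (V : Sg.Srt → Type) : Sg.Srt → Type
  | var {S : Sg.Srt} (v : V S) : STerm Sg V S
  | const {S : Sg.Srt} (c : Sg.Const S) : STerm Sg V S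
  | app (f : Sg.Fn) (t : STerm Sg V (Sg.src f)) : STerm Sg V (Sg.tgt f)

def STerm.eval {Sg : DBSig} {V : Sg.Srt → Type} (M : DBModel Sg)
    (ν : (S : Sg.Srt) → V S → M.carrier S) : {S : Sg.Srt} → STerm Sg V S → M.carrier S
  | _, .var v => ν _ v
  | _, .const c => M.const _ c
  | _, .app f t => M.fn f (STerm.eval M ν t)

/-- Quantifier-free formulae: equalities between terms, further atoms taken from `At`, and
Boolean combinations. -/
inductive QF (Sg : DBSig) (V : Sg.Srt → Type) (At : Type) : Type
  | eq {S : Sg.Srt} (t u : STerm Sg V S) : QF Sg V At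
  | atom (a : At) : QF Sg V At
  | neg (φ : QF Sg V At) : QF Sg V At
  | all {n : ℕ} (φ : Fin n → QF Sg V At) : QF Sg V At
  | any {n : ℕ} (φ : Fin n → QF Sg V At) : QF Sg V At

def QF.Holds {Sg : DBSig} {V : Sg.Srt → Type} {At : Type} (M : DBModel Sg)
    (ν : (S : Sg.Srt) → V S → M.carrier S) (h : At → Prop) : QF Sg V At → Prop
  | .eq t u => t.eval M ν = u.eval M ν
  | .atom a => h a
  | .neg φ => ¬ QF.Holds M ν h φ
  | .all φ => ∀ i, QF.Holds M ν h (φ i)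
  | .any φ => ∃ i, QF.Holds M ν h (φ i)

def QF.top {Sg : DBSig} {V : Sg.Srt → Type} {At : Type} : QF Sg V At :=
  .all (n := 0) Fin.elim0

def QF.and {Sg : DBSig} {V : Sg.Srt → Type} {At : Type} (φ ψ : QF Sg V At) : QF Sg V At :=
  .all ![φ, ψ]

/-- Existentially closed models of `T`: an existential formula with parameters in `M` that holds
in some extension of `M` to a model of `T` holds in `M`.  These are the models of the model
completion of `T`. -/
def DBModel.IsTStar {Sg : DBSig} (M : DBModel Sg) : Prop :=
  ∀ (N : DBModel Sg) (ε : M.Emb N) (Γ Δ : Ctx Sg.Srt)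
    (φ : QF Sg (fun S => Γ.Var S ⊕ Δ.Var S) Empty) (p : (S : Sg.Srt) → Γ.Var S → M.carrier S),
    (∃ d : (S : Sg.Srt) → Δ.Var S → N.carrier S,
      φ.Holds N (fun S => Sum.elim (fun v => ε.map S (p S v)) (d S)) Empty.elim) →
    ∃ d : (S : Sg.Srt) → Δ.Var S → M.carrier S,
      φ.Holds M (fun S => Sum.elim (p S) (d S)) Empty.elim

/-! ## Relational artifact systems (RAS) -/

/-- Artifact sorts, and artifact components (arrays) from an artifact sort to a basic sort. -/
structure ArtExt (Sg : DBSig) where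
  ASrt : Type
  Arr : Type
  asrc : Arr → ASrt
  atgt : Arr → Sg.Srt

/-- The atomic data terms: data variables and reads `a[e]` at index variables. -/
inductive AVar {Sg : DBSig} (A : ArtExt Sg) (IV : A.ASrt → Type) (DV : Sg.Srt → Type) :
    Sg.Srt → Type
  | data {S : Sg.Srt} (v : DV S) : AVar A IV DV S
  | read (a : A.Arr) (e : IV (A.asrc a)) : AVar A IV DV (A.atgt a)

abbrev ATerm {Sg : DBSig} (A : ArtExt Sg) (IV : A.ASrt → Type) (DV : Sg.Srt → Type) :
    Sg.Srt → Type :=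
  STerm Sg (AVar A IV DV)

/-- The same term in the context with one more index variable. -/
def ATerm.shift {Sg : DBSig} {A : ArtExt Sg} {IV : A.ASrt → Type} {DV : Sg.Srt → Type}
    (σ : A.ASrt) : {S : Sg.Srt} → ATerm A IV DV S → ATerm A (Snoc σ IV) DV S
  | _, .var (.data v) => .var (.data v)
  | _, .var (.read a e) => .var (.read a (.old e))
  | _, .const c => .const c
  | _, .app f t => .app f (ATerm.shift σ t)

/-- Quantifier-free formulae over arrays, with equalities between index variables as atoms. -/
abbrev AForm {Sg : DBSig} (A : ArtExt Sg) (IV : A.ASrt → Type) (DV : Sg.Srt → Type) : Type :=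
  QF Sg (AVar A IV DV) (Σ σ : A.ASrt, IV σ × IV σ)

/-- An assignment to the artifact components, over a model of `T` and index sets `Idx`. -/
abbrev AState {Sg : DBSig} (A : ArtExt Sg) (M : DBModel Sg) (Idx : A.ASrt → Type) : Type :=
  (a : A.Arr) → Idx (A.asrc a) → M.carrier (A.atgt a)

def AVar.eval {Sg : DBSig} {A : ArtExt Sg} {IV : A.ASrt → Type} {DV : Sg.Srt → Type}
    {M : DBModel Sg} {Idx : A.ASrt → Type} (s : AState A M Idx)
    (e : (σ : A.ASrt) → IV σ → Idx σ) (d : (S : Sg.Srt) → DV S → M.carrier S) :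
    (S : Sg.Srt) → AVar A IV DV S → M.carrier S
  | _, .data v => d _ v
  | _, .read a i => s a (e _ i)

def AForm.Holds {Sg : DBSig} {A : ArtExt Sg} {IV : A.ASrt → Type} {DV : Sg.Srt → Type}
    {M : DBModel Sg} {Idx : A.ASrt → Type} (s : AState A M Idx)
    (e : (σ : A.ASrt) → IV σ → Idx σ) (d : (S : Sg.Srt) → DV S → M.carrier S)
    (φ : AForm A IV DV) : Prop :=
  QF.Holds M (AVar.eval s e d) (fun p => e p.1 p.2.1 = e p.1 p.2.2) φ

/-- The atoms of guards besides equalities of data terms: equalities between index variables, and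
formulae `∀ j, ψ(j, e, d, a)` with a universally quantified index variable.  The latter serve to
express that a repository relation does not contain a tuple. -/
inductive GAtom {Sg : DBSig} (A : ArtExt Sg) (IV : A.ASrt → Type) (DV : Sg.Srt → Type) : Type
  | idx (σ : A.ASrt) (e e' : IV σ) : GAtom A IV DV
  | univ (σ : A.ASrt) (ψ : AForm A (Snoc σ IV) DV) : GAtom A IV DV

/-- Guards. -/
abbrev GForm {Sg : DBSig} (A : ArtExt Sg) (IV : A.ASrt → Type) (DV : Sg.Srt → Type) : Type :=
  QF Sg (AVar A IV DV) (GAtom A IV DV)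

def GAtom.Holds {Sg : DBSig} {A : ArtExt Sg} {IV : A.ASrt → Type} {DV : Sg.Srt → Type}
    {M : DBModel Sg} {Idx : A.ASrt → Type} (s : AState A M Idx)
    (e : (σ : A.ASrt) → IV σ → Idx σ) (d : (S : Sg.Srt) → DV S → M.carrier S) :
    GAtom A IV DV → Prop
  | .idx σ i j => e σ i = e σ j
  | .univ _ ψ => ∀ j, AForm.Holds s (Snoc.elim j e) d ψ

def GForm.Holds {Sg : DBSig} {A : ArtExt Sg} {IV : A.ASrt → Type} {DV : Sg.Srt → Type}
    {M : DBModel Sg} {Idx : A.ASrt → Type} (s : AState A M Idx)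
    (e : (σ : A.ASrt) → IV σ → Idx σ) (d : (S : Sg.Srt) → DV S → M.carrier S)
    (φ : GForm A IV DV) : Prop :=
  QF.Holds M (AVar.eval s e d) (GAtom.Holds s e d) φ

/-- Formulae `∃ e ∃ d, φ(e, d, a)` with index variables `e` and data variables `d`. -/
structure ExForm {Sg : DBSig} (A : ArtExt Sg) where
  E : Ctx A.ASrt
  Γ : Ctx Sg.Srt
  body : GForm A E.Var Γ.Var

def ExForm.Holds {Sg : DBSig} {A : ArtExt Sg} (φ : ExForm A) {M : DBModel Sg}
    {Idx : A.ASrt → Type} (s : AState A M Idx) : Prop :=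
  ∃ (e : (σ : A.ASrt) → φ.E.Var σ → Idx σ) (d : (S : Sg.Srt) → φ.Γ.Var S → M.carrier S),
    GForm.Holds s e d φ.body

/-- State formulae `∃ e, φ(e, a)`: only index variables are quantified. -/
structure StateFormula {Sg : DBSig} (A : ArtExt Sg) where
  E : Ctx A.ASrt
  body : AForm A E.Var (fun _ => Empty)

def StateFormula.Holds {Sg : DBSig} {A : ArtExt Sg} (φ : StateFormula A) {M : DBModel Sg}
    {Idx : A.ASrt → Type} (s : AState A M Idx) : Prop :=
  ∃ e : (σ : A.ASrt) → φ.E.Var σ → Idx σ, AForm.Holds s e (fun _ v => v.elim) φ.body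

/-- Case-defined functions, written as nested if-then-else. -/
inductive CaseTerm {Sg : DBSig} (A : ArtExt Sg) (IV : A.ASrt → Type) (DV : Sg.Srt → Type)
    (S : Sg.Srt) : Type
  | term (t : ATerm A IV DV S) : CaseTerm A IV DV S
  | ite (κ : AForm A IV DV) (t u : CaseTerm A IV DV S) : CaseTerm A IV DV S

open Classical in
noncomputable def CaseTerm.eval {Sg : DBSig} {A : ArtExt Sg} {IV : A.ASrt → Type}
    {DV : Sg.Srt → Type} {S : Sg.Srt} {M : DBModel Sg} {Idx : A.ASrt → Type}
    (s : AState A M Idx) (e : (σ : A.ASrt) → IV σ → Idx σ)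
    (d : (S : Sg.Srt) → DV S → M.carrier S) : CaseTerm A IV DV S → M.carrier S
  | .term t => t.eval M (AVar.eval s e d)
  | .ite κ t u =>
      if AForm.Holds s e d κ then CaseTerm.eval s e d t else CaseTerm.eval s e d u

/-- Transition formulae `∃ e ∃ d, (γ(e, d, a) ∧ ⋀ₐ a' = λ y. Gₐ(y, e, d, a))`. -/
structure Transition {Sg : DBSig} (A : ArtExt Sg) where
  E : Ctx A.ASrt
  Γ : Ctx Sg.Srt
  guard : GForm A E.Var Γ.Var
  upd : (a : A.Arr) → CaseTerm A (Snoc (A.asrc a) E.Var) Γ.Var (A.atgt a)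

def Transition.Rel {Sg : DBSig} {A : ArtExt Sg} (τ : Transition A) {M : DBModel Sg}
    {Idx : A.ASrt → Type} (s s' : AState A M Idx) : Prop :=
  ∃ (e : (σ : A.ASrt) → τ.E.Var σ → Idx σ) (d : (S : Sg.Srt) → τ.Γ.Var S → M.carrier S),
    GForm.Holds s e d τ.guard ∧ ∀ a y, s' a y = (τ.upd a).eval s (Snoc.elim y e) d

/-- Initial value of an array: constantly `c`, or (used for the array of case identifiers only)
a fixed array of pairwise distinct defined values. -/
inductive InitVal (Sg : DBSig) (S : Sg.Srt) : Type
  | const (c : Sg.Const S) : InitVal Sg S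
  | ids : InitVal Sg S

def InitVal.Holds {Sg : DBSig} {S : Sg.Srt} (M : DBModel Sg) {I : Type} (a : I → M.carrier S) :
    InitVal Sg S → Prop
  | .const c => ∀ y, a y = M.const S c
  | .ids => Function.Injective a ∧ ∀ y, a y ≠ M.const S (Sg.undef S)

/-- An array-based relational artifact system: artifact components, initial formula, and the
list of the disjuncts of the transition formula. -/
structure RAS (Sg : DBSig) where
  A : ArtExt Sg
  init : (a : A.Arr) → InitVal Sg (A.atgt a)
  trans : List (Transition A)

def RAS.Init {Sg : DBSig} (𝒮 : RAS Sg) {M : DBModel Sg} {Idx : 𝒮.A.ASrt → Type}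
    (s : AState 𝒮.A M Idx) : Prop :=
  ∀ a, (𝒮.init a).Holds M (s a)

def RAS.Next {Sg : DBSig} (𝒮 : RAS Sg) {M : DBModel Sg} {Idx : 𝒮.A.ASrt → Type}
    (s s' : AState 𝒮.A M Idx) : Prop :=
  ∃ τ ∈ 𝒮.trans, τ.Rel s s'

/-! ## Backward reachability -/

/-- `T`-satisfiability of a (semantically given) formula in the array variables. -/
def TSat {Sg : DBSig} (A : ArtExt Sg)
    (P : {M : DBModel Sg} → {Idx : A.ASrt → Type} → AState A M Idx → Prop) : Prop :=
  ∃ (M : DBModel Sg) (Idx : A.ASrt → Type) (_ : ∀ σ, Nonempty (Idx σ)) (s : AState A M Idx), P s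

/-- `ψ` is a result of `QE(T*, P)`: a state formula equivalent to `P` in the models of the model
completion `T*` of `T`. -/
def IsQE {Sg : DBSig} {A : ArtExt Sg}
    (P : {M : DBModel Sg} → {Idx : A.ASrt → Type} → AState A M Idx → Prop)
    (ψ : StateFormula A) : Prop :=
  ∀ (M : DBModel Sg) (Idx : A.ASrt → Type), M.IsTStar → (∀ σ, Nonempty (Idx σ)) →
    ∀ s : AState A M Idx, ψ.Holds s ↔ P s

/-- The preimage `Pre(τ, φ) = ∃ a', τ(a, a') ∧ φ(a')`. -/
def RAS.Pre {Sg : DBSig} (𝒮 : RAS Sg) (φ : StateFormula 𝒮.A) {M : DBModel Sg}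
    {Idx : 𝒮.A.ASrt → Type} (s : AState 𝒮.A M Idx) : Prop :=
  ∃ s' : AState 𝒮.A M Idx, 𝒮.Next s s' ∧ φ.Holds s'

/-- Terminating executions of the loop of the backward reachability algorithm: with current
formula `φ` and the disjunction `B` of the formulae visited so far, it stops with `false` (safe)
when `φ ∧ ¬ B` is `T`-unsatisfiable; otherwise with `true` (unsafe) when `ι ∧ φ` is
`T`-satisfiable; otherwise it goes on with `φ ∨ B` and with a result of eliminating the data
quantifiers from the preimage of `φ`. -/
inductive RAS.BReach {Sg : DBSig} (𝒮 : RAS Sg) :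
    List (StateFormula 𝒮.A) → StateFormula 𝒮.A → Bool → Prop
  | answerNo (B : List (StateFormula 𝒮.A)) (φ : StateFormula 𝒮.A)
      (fix : ¬ TSat 𝒮.A (fun s => φ.Holds s ∧ ∀ χ ∈ B, ¬ χ.Holds s)) : RAS.BReach 𝒮 B φ false
  | answerYes (B : List (StateFormula 𝒮.A)) (φ : StateFormula 𝒮.A)
      (nofix : TSat 𝒮.A (fun s => φ.Holds s ∧ ∀ χ ∈ B, ¬ χ.Holds s))
      (hit : TSat 𝒮.A (fun s => 𝒮.Init s ∧ φ.Holds s)) : RAS.BReach 𝒮 B φ true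
  | step (B : List (StateFormula 𝒮.A)) (φ ψ : StateFormula 𝒮.A) (b : Bool)
      (nofix : TSat 𝒮.A (fun s => φ.Holds s ∧ ∀ χ ∈ B, ¬ χ.Holds s))
      (nohit : ¬ TSat 𝒮.A (fun s => 𝒮.Init s ∧ φ.Holds s))
      (qe : IsQE (fun s => 𝒮.Pre φ s) ψ)
      (rest : RAS.BReach 𝒮 (φ :: B) ψ b) : RAS.BReach 𝒮 B φ b

/-! ## Data schemas -/

/-- A data schema `⟨Cat, CType, Repo, X⟩` over types `Ty` with domains `dom`.  The primary key of
the catalog relation `R` has type `idTy R`; its other attributes have the types `catTy R k`.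
The case variables other than `self : ctype` are the elements of `CVar`.

`named S` is the finite set of objects of type `S` that formulae may mention as constants; it
contains `undef`, and all objects of a type with finite domain.  -/
structure DataSchema where
  Ty : Type
  IsId : Ty → Prop
  dom : Ty → Type
  undef : (S : Ty) → dom S
  named : (S : Ty) → Finset (dom S)
  undef_named : ∀ S, undef S ∈ named S
  finite_named : ∀ S, Finite (dom S) → ∀ c, c ∈ named S
  /-- the supply of identifiers is unlimited -/
  id_infinite : ∀ S, IsId S → Infinite (dom S)
  Cat : Type
  catFin : Finite Cat
  idTy : Cat → Ty
  catArity : Cat → ℕ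
  catTy : (R : Cat) → Fin (catArity R) → Ty
  /-- single-column primary keys of identifier type -/
  pk_id : ∀ R, IsId (idTy R)
  /-- non-ambiguity of primary keys -/
  pk_inj : Function.Injective idTy
  /-- foreign keys -/
  cat_fk : ∀ R k, IsId (catTy R k) → ∃ R', idTy R' = catTy R k
  ctype : Ty
  ctype_id : IsId ctype
  ctype_cat : ∀ R, idTy R ≠ ctype
  Repo : Type
  repoFin : Finite Repo
  repoArity : Repo → ℕ
  repo_pos : ∀ R, 0 < repoArity R
  repoTy : (R : Repo) → Fin (repoArity R) → Ty
  repo_fk : ∀ R k, IsId (repoTy R k) → (∃ R', idTy R' = repoTy R k) ∨ repoTy R k = ctype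
  CVar : Type
  cvFin : Finite CVar
  cvTy : CVar → Ty
  cv_fk : ∀ x, IsId (cvTy x) → (∃ R', idTy R' = cvTy x) ∨ cvTy x = ctype

/-- A catalog instance: a finite set of tuples (primary key, other attributes) for each relation,
without undefined values, satisfying primary and foreign keys, and containing the identifiers
that are mentioned as constants. -/
structure CatInst (D : DataSchema) where
  rel : (R : D.Cat) → Set (D.dom (D.idTy R) × ((k : Fin (D.catArity R)) → D.dom (D.catTy R k)))
  finite : ∀ R, (rel R).Finite
  pk : ∀ R, ∀ t ∈ rel R, ∀ t' ∈ rel R, t.1 = t'.1 → t = t'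
  pk_def : ∀ R, ∀ t ∈ rel R, t.1 ≠ D.undef _
  attr_def : ∀ R, ∀ t ∈ rel R, ∀ k, t.2 k ≠ D.undef _
  fk : ∀ R, ∀ t ∈ rel R, ∀ k R' (h : D.idTy R' = D.catTy R k), ∃ t' ∈ rel R', h ▸ t'.1 = t.2 k
  named : ∀ R, ∀ c ∈ D.named (D.idTy R), c ≠ D.undef _ → ∃ t ∈ rel R, t.1 = c

/-- `v` is a legal value of type `S` over the catalog instance: a value of the identifier type of
a catalog relation is undefined or refers to a tuple of that relation. -/
def CatInst.Ref {D : DataSchema} (I : CatInst D) (S : D.Ty) (v : D.dom S) : Prop :=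
  v = D.undef S ∨ ∀ R (h : D.idTy R = S), ∃ t ∈ I.rel R, h ▸ t.1 = v

/-! ## Conditions, queries and guards -/

/-- The case variables of type `S`, including `self`. -/
inductive CV (D : DataSchema) : D.Ty → Type
  | self : CV D D.ctype
  | usr (x : D.CVar) : CV D (D.cvTy x)

def CV.IsSelf {D : DataSchema} {S : D.Ty} : CV D S → Prop
  | .self => True
  | .usr _ => False

/-- Variables and constant objects. -/
inductive Tm (D : DataSchema) (V : D.Ty → Type) (S : D.Ty) : Type
  | var (v : V S) : Tm D V S
  | const (c : D.dom S) (h : c ∈ D.named S) : Tm D V S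

def Tm.eval {D : DataSchema} {V : D.Ty → Type} (ν : (S : D.Ty) → V S → D.dom S) {S : D.Ty} :
    Tm D V S → D.dom S
  | .var v => ν S v
  | .const c _ => c

/-- Some variable with property `p` occurs in the term. -/
def Tm.Occ {D : DataSchema} {V : D.Ty → Type} (p : (S : D.Ty) → V S → Prop) {S : D.Ty} :
    Tm D V S → Prop
  | .var v => p S v
  | .const _ _ => False

/-- Conditions over case variables, attached to choice points. -/
inductive Cond (D : DataSchema) : Type
  | eq {S : D.Ty} (t u : Tm D (CV D) S) : Cond D
  | not (φ : Cond D) : Cond D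
  | and (φ ψ : Cond D) : Cond D

def Cond.Holds {D : DataSchema} (ν : (S : D.Ty) → CV D S → D.dom S) : Cond D → Prop
  | .eq t u => t.eval ν = u.eval ν
  | .not φ => ¬ Cond.Holds ν φ
  | .and φ ψ => Cond.Holds ν φ ∧ Cond.Holds ν ψ

/-- Repository-free literals: (in)equalities and (negated) catalog atoms. -/
inductive CLit (D : DataSchema) (V : D.Ty → Type) : Type
  | eq {S : D.Ty} (t u : Tm D V S) : CLit D V
  | ne {S : D.Ty} (t u : Tm D V S) : CLit D V
  | cat (R : D.Cat) (t : Tm D V (D.idTy R)) (u : (k : Fin (D.catArity R)) → Tm D V (D.catTy R k)) :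
      CLit D V
  | ncat (R : D.Cat) (t : Tm D V (D.idTy R))
      (u : (k : Fin (D.catArity R)) → Tm D V (D.catTy R k)) : CLit D V

def CLit.Holds {D : DataSchema} {V : D.Ty → Type} (I : CatInst D)
    (ν : (S : D.Ty) → V S → D.dom S) : CLit D V → Prop
  | .eq t u => t.eval ν = u.eval ν
  | .ne t u => t.eval ν ≠ u.eval ν
  | .cat R t u => (t.eval ν, fun k => (u k).eval ν) ∈ I.rel R
  | .ncat R t u => (t.eval ν, fun k => (u k).eval ν) ∉ I.rel R

def CLit.Occ {D : DataSchema} {V : D.Ty → Type} (p : (S : D.Ty) → V S → Prop) : CLit D V → Prop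
  | .eq t u => t.Occ p ∨ u.Occ p
  | .ne t u => t.Occ p ∨ u.Occ p
  | .cat _ t u => t.Occ p ∨ ∃ k, (u k).Occ p
  | .ncat _ t u => t.Occ p ∨ ∃ k, (u k).Occ p

/-- Tuples of a repository relation. -/
abbrev RTuple (D : DataSchema) (R : D.Repo) : Type :=
  (k : Fin (D.repoArity R)) → D.dom (D.repoTy R k)

/-- Tuples of terms for a repository relation. -/
abbrev RTerms (D : DataSchema) (V : D.Ty → Type) (R : D.Repo) : Type :=
  (k : Fin (D.repoArity R)) → Tm D V (D.repoTy R k)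

/-- Repository instances.  Each tuple has a hidden primary key, so that a relation holds a finite
multiset of tuples. -/
abbrev RepoInst (D : DataSchema) : Type := (R : D.Repo) → Multiset (RTuple D R)

/-- Literals: repository-free ones and (negated) repository atoms. -/
inductive Lit (D : DataSchema) (V : D.Ty → Type) : Type
  | base (l : CLit D V) : Lit D V
  | repo (R : D.Repo) (u : RTerms D V R) : Lit D V
  | nrepo (R : D.Repo) (u : RTerms D V R) : Lit D V

def Lit.Holds {D : DataSchema} {V : D.Ty → Type} (I : CatInst D) (r : RepoInst D)
    (ν : (S : D.Ty) → V S → D.dom S) : Lit D V → Prop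
  | .base l => l.Holds I ν
  | .repo R u => (fun k => (u k).eval ν) ∈ r R
  | .nrepo R u => (fun k => (u k).eval ν) ∉ r R

def Lit.Occ {D : DataSchema} {V : D.Ty → Type} (p : (S : D.Ty) → V S → Prop) : Lit D V → Prop
  | .base l => l.Occ p
  | .repo _ u | .nrepo _ u => ∃ k, (u k).Occ p

/-- A variable with property `p` occurs in a repository atom. -/
def Lit.RepoOcc {D : DataSchema} {V : D.Ty → Type} (p : (S : D.Ty) → V S → Prop) :
    Lit D V → Prop
  | .base _ => False
  | .repo _ u | .nrepo _ u => ∃ k, (u k).Occ p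

/-- Disjunctions of conjunctions of literals. -/
structure DNF (L : Type) where
  n : ℕ
  len : Fin n → ℕ
  lit : (i : Fin n) → Fin (len i) → L

def DNF.Holds {L : Type} (h : L → Prop) (g : DNF L) : Prop := ∃ i, ∀ j, h (g.lit i j)

/-- Some literal satisfies `p`. -/
def DNF.Has {L : Type} (p : L → Prop) (g : DNF L) : Prop := ∃ i j, p (g.lit i j)

/-- The variables of a guard with normal variables `Γ`: normal variables and case variables. -/
abbrev GVar (D : DataSchema) (Γ : Ctx D.Ty) (S : D.Ty) : Type := Γ.Var S ⊕ CV D S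

/-- Guards: unions of conjunctive queries with filters. -/
abbrev Guard (D : DataSchema) (Γ : Ctx D.Ty) : Type := DNF (Lit D (GVar D Γ))

/-! ## Update specifications -/

/-- `SET x = v, ...` for distinct case variables different from `self`; `none` means that the
variable keeps its value. -/
abbrev SetRule (D : DataSchema) (Γ : Ctx D.Ty) : Type :=
  (x : D.CVar) → Option (Tm D Γ.Var (D.cvTy x))

/-- The new variables `v` standing for the components of a tuple of `R`. -/
inductive TVar (D : DataSchema) (R : D.Repo) : D.Ty → Type
  | mk (k : Fin (D.repoArity R)) : TVar D R (D.repoTy R k)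

/-- The (nested) `IF ψ THEN η₁ ELSE η₂` of a conditional update of `R`.  The filters `ψ` are
repository-free and use answer variables, case variables and the components of the tuple. -/
inductive CUpd (D : DataSchema) (Γ : Ctx D.Ty) (R : D.Repo) : Type
  | leaf (u : RTerms D (fun S => Γ.Var S ⊕ TVar D R S) R) : CUpd D Γ R
  | ite (ψ : DNF (CLit D (fun S => GVar D Γ S ⊕ TVar D R S))) (η₁ η₂ : CUpd D Γ R) : CUpd D Γ R

/-- Effect rules. -/
inductive Effect (D : DataSchema) (Γ : Ctx D.Ty) : Type
  | set (σ : SetRule D Γ) : Effect D Γ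
  | insertSet (R : D.Repo) (u : RTerms D Γ.Var R) (σ : SetRule D Γ) : Effect D Γ
  | deleteSet (R : D.Repo) (u : RTerms D Γ.Var R) (σ : SetRule D Γ) : Effect D Γ
  | update (R : D.Repo) (η : CUpd D Γ R) : Effect D Γ

/-- Update specifications: a precondition and an effect rule.  `Γ` lists the normal variables. -/
structure UpdateSpec (D : DataSchema) where
  Γ : Ctx D.Ty
  pre : Guard D Γ
  eff : Effect D Γ

/-- Update specifications that only set case variables (for nonatomic tasks). -/
structure SetSpec (D : DataSchema) where
  Γ : Ctx D.Ty
  pre : Guard D Γ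
  set : SetRule D Γ

def SetSpec.toUpdateSpec {D : DataSchema} (α : SetSpec D) : UpdateSpec D :=
  ⟨α.Γ, α.pre, .set α.set⟩

def CUpd.MentionsSelf {D : DataSchema} {Γ : Ctx D.Ty} {R : D.Repo} : CUpd D Γ R → Prop
  | .leaf _ => False
  | .ite ψ η₁ η₂ =>
      ψ.Has (CLit.Occ (fun _ => Sum.elim (Sum.elim (fun _ => False) CV.IsSelf) (fun _ => False))) ∨
        CUpd.MentionsSelf η₁ ∨ CUpd.MentionsSelf η₂

/-- The case variable `self` occurs in the update specification.  (The terms of `INSERT`, `DEL`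
and `SET` are answer variables and constants.) -/
def UpdateSpec.MentionsSelf {D : DataSchema} (α : UpdateSpec D) : Prop :=
  α.pre.Has (Lit.Occ (fun _ => Sum.elim (fun _ => False) CV.IsSelf)) ∨
    match α.eff with
    | .update _ η => η.MentionsSelf
    | _ => False

/-! ## Blocks and their lifecycle rules -/

/-- Lifecycle states.  `active2` is a second active state: two branches of an inclusive choice
are running, respectively a non-interrupting boundary event has occurred. -/
inductive LState : Type
  | idle | enabled | active | active2 | compl | error

/-- A block is addressed by the path leading to it from the root block. -/
abbrev Addr : Type := List ℕ

/-- Boundary events: errors (with a label), and messages or timers, which occur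
nondeterministically. -/
inductive Boundary : Type
  | error (l : ℕ) | spontaneous

/-- End events: errors (with a label), and plain or message end events. -/
inductive EndEvent : Type
  | error (l : ℕ) | plain

/-- Blocks. -/
inductive Block (D : DataSchema) : Type 1
  | empty : Block D
  /-- atomic task -/
  | task (α : UpdateSpec D) : Block D
  /-- nonatomic task -/
  | ntask (α : SetSpec D) : Block D
  /-- catch event -/
  | event (α : UpdateSpec D) : Block D
  /-- process block with start event, nested block and end event -/
  | proc (start : UpdateSpec D) (B : Block D) (ending : UpdateSpec D) : Block D
  /-- subprocess with its inner process block -/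
  | sub (B : Block D) : Block D
  | seq (B₁ B₂ : Block D) : Block D
  /-- possible completion: continue if `φ₁`, end event `e` if `φ₂` -/
  | complete (φ₁ φ₂ : Cond D) (e : EndEvent) : Block D
  /-- deferred choice -/
  | defer (B₁ B₂ : Block D) : Block D
  | par (B₁ B₂ : Block D) : Block D
  /-- exclusive choice -/
  | xor (φ₁ φ₂ : Cond D) (B₁ B₂ : Block D) : Block D
  /-- inclusive choice -/
  | ior (φ₁ φ₂ : Cond D) (B₁ B₂ : Block D) : Block D
  /-- loop: after `B₁`, exit if `φ₁`, and run `B₂` and then `B₁` again if `φ₂` -/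
  | loop (φ₁ φ₂ : Cond D) (B₁ B₂ : Block D) : Block D
  /-- event-driven choice between catch events -/
  | evChoice (α₁ α₂ : UpdateSpec D) (B₁ B₂ : Block D) : Block D
  /-- backward exception: boundary event `e` on `A`, with handler `B`, then back to `A` -/
  | back (e : Boundary) (A B : Block D) : Block D
  /-- forward exception: `A` then `B₁`, or handler `B₂` if `e` interrupts `A` -/
  | fwd (e : Boundary) (A B₁ B₂ : Block D) : Block D
  /-- forward non-interrupting exception: the boundary event starts `B₂` besides `A`, `B₁` -/
  | nonInt (A B₁ B₂ : Block D) : Block D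

/-- The addresses of the blocks strictly inside a block with address `a`. -/
def Block.inner {D : DataSchema} : Block D → Addr → List Addr
  | .empty, _ | .task _, _ | .ntask _, _ | .event _, _ | .complete _ _ _, _ => []
  | .proc _ B _, a | .sub B, a => (a ++ [0]) :: B.inner (a ++ [0])
  | .seq B₁ B₂, a | .defer B₁ B₂, a | .par B₁ B₂, a | .xor _ _ B₁ B₂, a | .ior _ _ B₁ B₂, a
  | .loop _ _ B₁ B₂, a | .back _ B₁ B₂, a =>
      (a ++ [0]) :: (a ++ [1]) :: (B₁.inner (a ++ [0]) ++ B₂.inner (a ++ [1]))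
  | .evChoice _ _ B₁ B₂, a =>
      (a ++ [0]) :: (a ++ [1]) :: (a ++ [2]) :: (a ++ [3]) ::
        (B₁.inner (a ++ [2]) ++ B₂.inner (a ++ [3]))
  | .fwd _ A B₁ B₂, a | .nonInt A B₁ B₂, a =>
      (a ++ [0]) :: (a ++ [1]) :: (a ++ [2]) ::
        (A.inner (a ++ [0]) ++ B₁.inner (a ++ [1]) ++ B₂.inner (a ++ [2]))

/-- The update specifications attached to a block and its descendants. -/
def Block.specs {D : DataSchema} : Block D → List (UpdateSpec D)
  | .empty | .complete _ _ _ => []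
  | .task α | .event α => [α]
  | .ntask α => [α.toUpdateSpec]
  | .proc s B t => s :: t :: B.specs
  | .sub B => B.specs
  | .seq B₁ B₂ | .defer B₁ B₂ | .par B₁ B₂ | .xor _ _ B₁ B₂ | .ior _ _ B₁ B₂
  | .loop _ _ B₁ B₂ | .back _ B₁ B₂ => B₁.specs ++ B₂.specs
  | .evChoice α₁ α₂ B₁ B₂ => α₁ :: α₂ :: (B₁.specs ++ B₂.specs)
  | .fwd _ A B₁ B₂ | .nonInt A B₁ B₂ => A.specs ++ B₁.specs ++ B₂.specs

/-- What a progression rule does on data: nothing, test conditions, execute an update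
specification atomically, start a nonatomic task (check and bind its precondition, and store the
values to be set), or finish it (set the case variables to the stored values). -/
inductive Action (D : DataSchema) : Type 1
  | skip : Action D
  | test (φ : Cond D) : Action D
  | exec (α : UpdateSpec D) : Action D
  | start (a : Addr) (α : SetSpec D) : Action D
  | finish (a : Addr) (α : SetSpec D) : Action D

/-- Progression rules of a case: applicable if the blocks in `pre` are in the given states;
moves the blocks in `post` to the given states. -/
structure Rule (D : DataSchema) where
  pre : List (Addr × LState)
  act : Action D
  post : List (Addr × LState)

/-- The new states of a block and of all the blocks inside it when the block is left
prematurely. -/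
def reset (b : Addr × List Addr) (st : LState) : List (Addr × LState) :=
  (b.1, st) :: b.2.map (fun c => (c, LState.idle))

/-- Context of a block: the enclosing process block, and the blocks with an error handler
attached, innermost first (each with the addresses of the blocks inside). -/
structure BlockEnv where
  encl : Addr × List Addr
  handlers : List (ℕ × (Addr × List Addr))

def BlockEnv.catching (ρ : BlockEnv) (e : Boundary) (b : Addr × List Addr) : BlockEnv :=
  match e with
  | .error l => ⟨ρ.encl, (l, b) :: ρ.handlers⟩
  | .spontaneous => ρ

/-- An interrupting message or timer event may occur whenever the block `b` is running. -/
def interrupt {D : DataSchema} (e : Boundary) (b : Addr × List Addr) : List (Rule D) :=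
  match e with
  | .error _ => []
  | .spontaneous => [LState.enabled, LState.active, LState.active2].map
      (fun st => ⟨[(b.1, st)], .skip, reset b .error⟩)

open LState in
/-- The progression rules of a block with address `a`. -/
def Block.rules {D : DataSchema} : Block D → Addr → BlockEnv → List (Rule D)
  | .empty, a, _ => [⟨[(a, enabled)], .skip, [(a, compl)]⟩]
  | .task α, a, _ => [⟨[(a, enabled)], .exec α, [(a, compl)]⟩]
  | .event α, a, _ => [⟨[(a, enabled)], .exec α, [(a, compl)]⟩]
  | .ntask α, a, _ =>
      [⟨[(a, enabled)], .start a α, [(a, active)]⟩,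
       ⟨[(a, active)], .finish a α, [(a, compl)]⟩]
  | .proc s B t, a, ρ =>
      let b := a ++ [0]
      [⟨[(a, enabled)], .exec s, [(b, enabled), (a, active)]⟩,
       ⟨[(b, compl)], .exec t, [(b, idle), (a, compl)]⟩] ++
      B.rules b ⟨(a, (Block.proc s B t).inner a), ρ.handlers⟩
  | .sub B, a, ρ =>
      let b := a ++ [0]
      [⟨[(a, enabled)], .skip, [(b, enabled), (a, active)]⟩,
       ⟨[(b, compl)], .skip, [(b, idle), (a, compl)]⟩] ++ B.rules b ρ
  | .seq B₁ B₂, a, ρ =>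
      let b₁ := a ++ [0]
      let b₂ := a ++ [1]
      [⟨[(a, enabled)], .skip, [(b₁, enabled), (a, active)]⟩,
       ⟨[(b₁, compl)], .skip, [(b₁, idle), (b₂, enabled)]⟩,
       ⟨[(b₂, compl)], .skip, [(b₂, idle), (a, compl)]⟩] ++ B₁.rules b₁ ρ ++ B₂.rules b₂ ρ
  | .complete φ₁ φ₂ e, a, ρ =>
      ⟨[(a, enabled)], .test φ₁, [(a, compl)]⟩ ::
      match e with
      | .plain => [⟨[(a, enabled)], .test φ₂, reset ρ.encl compl⟩]
      | .error l => (ρ.handlers.lookup l).toList.map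
          (fun b => ⟨[(a, enabled)], .test φ₂, reset b error⟩)
  | .defer B₁ B₂, a, ρ =>
      let b₁ := a ++ [0]
      let b₂ := a ++ [1]
      [⟨[(a, enabled)], .skip, [(b₁, enabled), (a, active)]⟩,
       ⟨[(a, enabled)], .skip, [(b₂, enabled), (a, active)]⟩,
       ⟨[(b₁, compl)], .skip, [(b₁, idle), (a, compl)]⟩,
       ⟨[(b₂, compl)], .skip, [(b₂, idle), (a, compl)]⟩] ++ B₁.rules b₁ ρ ++ B₂.rules b₂ ρ
  | .par B₁ B₂, a, ρ =>
      let b₁ := a ++ [0]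
      let b₂ := a ++ [1]
      [⟨[(a, enabled)], .skip, [(b₁, enabled), (b₂, enabled), (a, active)]⟩,
       ⟨[(b₁, compl), (b₂, compl)], .skip, [(b₁, idle), (b₂, idle), (a, compl)]⟩] ++
      B₁.rules b₁ ρ ++ B₂.rules b₂ ρ
  | .xor φ₁ φ₂ B₁ B₂, a, ρ =>
      let b₁ := a ++ [0]
      let b₂ := a ++ [1]
      [⟨[(a, enabled)], .test φ₁, [(b₁, enabled), (a, active)]⟩,
       ⟨[(a, enabled)], .test φ₂, [(b₂, enabled), (a, active)]⟩,
       ⟨[(b₁, compl)], .skip, [(b₁, idle), (a, compl)]⟩,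
       ⟨[(b₂, compl)], .skip, [(b₂, idle), (a, compl)]⟩] ++ B₁.rules b₁ ρ ++ B₂.rules b₂ ρ
  | .ior φ₁ φ₂ B₁ B₂, a, ρ =>
      let b₁ := a ++ [0]
      let b₂ := a ++ [1]
      [⟨[(a, enabled)], .test (.and φ₁ (.not φ₂)), [(b₁, enabled), (a, active)]⟩,
       ⟨[(a, enabled)], .test (.and φ₂ (.not φ₁)), [(b₂, enabled), (a, active)]⟩,
       ⟨[(a, enabled)], .test (.and φ₁ φ₂), [(b₁, enabled), (b₂, enabled), (a, active2)]⟩,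
       ⟨[(b₁, compl), (a, active)], .skip, [(b₁, idle), (a, compl)]⟩,
       ⟨[(b₂, compl), (a, active)], .skip, [(b₂, idle), (a, compl)]⟩,
       ⟨[(b₁, compl), (b₂, compl)], .skip, [(b₁, idle), (b₂, idle), (a, compl)]⟩] ++
      B₁.rules b₁ ρ ++ B₂.rules b₂ ρ
  | .loop φ₁ φ₂ B₁ B₂, a, ρ =>
      let b₁ := a ++ [0]
      let b₂ := a ++ [1]
      [⟨[(a, enabled)], .skip, [(b₁, enabled), (a, active)]⟩,
       ⟨[(b₁, compl)], .test φ₂, [(b₁, idle), (b₂, enabled)]⟩,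
       ⟨[(b₂, compl)], .skip, [(b₂, idle), (b₁, enabled)]⟩,
       ⟨[(b₁, compl)], .test φ₁, [(b₁, idle), (a, compl)]⟩] ++ B₁.rules b₁ ρ ++ B₂.rules b₂ ρ
  | .evChoice α₁ α₂ B₁ B₂, a, ρ =>
      let e₁ := a ++ [0]
      let e₂ := a ++ [1]
      let b₁ := a ++ [2]
      let b₂ := a ++ [3]
      [⟨[(a, enabled)], .skip, [(e₁, enabled), (e₂, enabled), (a, active)]⟩,
       ⟨[(e₁, enabled)], .exec α₁, [(e₁, compl), (e₂, idle)]⟩,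
       ⟨[(e₂, enabled)], .exec α₂, [(e₂, compl), (e₁, idle)]⟩,
       ⟨[(e₁, compl)], .skip, [(e₁, idle), (b₁, enabled)]⟩,
       ⟨[(e₂, compl)], .skip, [(e₂, idle), (b₂, enabled)]⟩,
       ⟨[(b₁, compl)], .skip, [(b₁, idle), (a, compl)]⟩,
       ⟨[(b₂, compl)], .skip, [(b₂, idle), (a, compl)]⟩] ++ B₁.rules b₁ ρ ++ B₂.rules b₂ ρ
  | .back e A B, a, ρ =>
      let c := a ++ [0]
      let b := a ++ [1]
      [⟨[(a, enabled)], .skip, [(c, enabled), (a, active)]⟩,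
       ⟨[(c, compl)], .skip, [(c, idle), (a, compl)]⟩,
       ⟨[(c, error)], .skip, [(c, idle), (b, enabled)]⟩,
       ⟨[(b, compl)], .skip, [(b, idle), (c, enabled)]⟩] ++
      interrupt e (c, A.inner c) ++ A.rules c (ρ.catching e (c, A.inner c)) ++ B.rules b ρ
  | .fwd e A B₁ B₂, a, ρ =>
      let c := a ++ [0]
      let b₁ := a ++ [1]
      let b₂ := a ++ [2]
      [⟨[(a, enabled)], .skip, [(c, enabled), (a, active)]⟩,
       ⟨[(c, compl)], .skip, [(c, idle), (b₁, enabled)]⟩,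
       ⟨[(b₁, compl)], .skip, [(b₁, idle), (a, compl)]⟩,
       ⟨[(c, error)], .skip, [(c, idle), (b₂, enabled)]⟩,
       ⟨[(b₂, compl)], .skip, [(b₂, idle), (a, compl)]⟩] ++
      interrupt e (c, A.inner c) ++ A.rules c (ρ.catching e (c, A.inner c)) ++
      B₁.rules b₁ ρ ++ B₂.rules b₂ ρ
  | .nonInt A B₁ B₂, a, ρ =>
      let c := a ++ [0]
      let b₁ := a ++ [1]
      let b₂ := a ++ [2]
      [⟨[(a, enabled)], .skip, [(c, enabled), (a, active)]⟩,
       ⟨[(c, compl)], .skip, [(c, idle), (b₁, enabled)]⟩,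
       ⟨[(b₁, compl), (a, active)], .skip, [(b₁, idle), (a, compl)]⟩,
       ⟨[(b₁, compl), (b₂, compl)], .skip, [(b₁, idle), (b₂, idle), (a, compl)]⟩] ++
      [enabled, active, active2].map
        (fun st => ⟨[(c, st), (a, active)], .skip, [(b₂, enabled), (a, active2)]⟩) ++
      A.rules c ρ ++ B₁.rules b₁ ρ ++ B₂.rules b₂ ρ

/-- A data-aware BPMN model: a data schema and a root process block. -/
structure DAB where
  D : DataSchema
  start : UpdateSpec D
  body : Block D
  ending : UpdateSpec D

/-- The root process block, with the empty path as address. -/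
def DAB.root (M : DAB) : Block M.D := .proc M.start M.body M.ending

/-- All progression rules; the root block of a freshly created case gets enabled. -/
def DAB.rules (M : DAB) : List (Rule M.D) :=
  ⟨[([], .idle)], .skip, [([], .enabled)]⟩ :: M.root.rules [] ⟨([], M.root.inner []), []⟩

def DAB.CaseIdentifierAgnostic (M : DAB) : Prop :=
  ∀ α ∈ M.root.specs, ¬ α.MentionsSelf

/-! ## Execution semantics -/

/-- The insertion semantics: multiset insertion, or set insertion with a key for every
repository relation (the default key being the set of all attributes). -/
inductive InsertionSemantics (D : DataSchema) : Type
  | multiset : InsertionSemantics D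
  | set (key : (R : D.Repo) → Finset (Fin (D.repoArity R))) : InsertionSemantics D

/-- The entry of a case in the case map and the control map, with the values stored by running
nonatomic tasks. -/
structure CaseState (D : DataSchema) where
  cv : (x : D.CVar) → D.dom (D.cvTy x)
  life : Addr → LState
  pend : Addr → (x : D.CVar) → D.dom (D.cvTy x)

/-- The entry of a new case. -/
def CaseState.fresh (D : DataSchema) : CaseState D :=
  ⟨fun _ => D.undef _, fun _ => .idle, fun _ _ => D.undef _⟩

/-- Snapshots (over a fixed catalog instance): case and control map, and repository instance. -/
structure Snapshot (D : DataSchema) where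
  cases : D.dom D.ctype → Option (CaseState D)
  repo : RepoInst D

def Snapshot.initial (D : DataSchema) : Snapshot D := ⟨fun _ => none, fun _ => 0⟩

/-- The foreign keys are satisfied: those of case variables and repository tuples pointing to the
catalog, and those of repository tuples pointing to the case identifiers. -/
def Snapshot.Valid {D : DataSchema} (I : CatInst D) (s : Snapshot D) : Prop :=
  (∀ id c, s.cases id = some c → ∀ x, I.Ref _ (c.cv x)) ∧
  (∀ R, ∀ t ∈ s.repo R, ∀ k, I.Ref _ (t k)) ∧
  (∀ R, ∀ t ∈ s.repo R, ∀ k (h : D.repoTy R k = D.ctype),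
    h ▸ t k = D.undef D.ctype ∨ (s.cases (h ▸ t k)).isSome)

/-- The values of the case variables of the case `id`. -/
def CaseState.val {D : DataSchema} (id : D.dom D.ctype) (c : CaseState D) :
    (S : D.Ty) → CV D S → D.dom S
  | _, .self => id
  | _, .usr x => c.cv x

/-- The case variables after `SET`. -/
def SetRule.apply {D : DataSchema} {Γ : Ctx D.Ty} (σ : SetRule D Γ)
    (ν : (S : D.Ty) → Γ.Var S → D.dom S) (old : (x : D.CVar) → D.dom (D.cvTy x)) (x : D.CVar) :
    D.dom (D.cvTy x) :=
  match σ x with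
  | none => old x
  | some t => t.eval ν

def TVar.val {D : DataSchema} {R : D.Repo} (t : RTuple D R) : (S : D.Ty) → TVar D R S → D.dom S
  | _, .mk k => t k

open Classical in
/-- The tuple that replaces the tuple `t` under a conditional update. -/
noncomputable def CUpd.apply {D : DataSchema} {Γ : Ctx D.Ty} {R : D.Repo} (I : CatInst D)
    (ν : (S : D.Ty) → Γ.Var S → D.dom S) (κ : (S : D.Ty) → CV D S → D.dom S) (t : RTuple D R) :
    CUpd D Γ R → RTuple D R
  | .leaf u => fun k => (u k).eval (fun S => Sum.elim (ν S) (TVar.val t S))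
  | .ite ψ η₁ η₂ =>
      if ψ.Holds (CLit.Holds I (fun S => Sum.elim (Sum.elim (ν S) (κ S)) (TVar.val t S)))
      then CUpd.apply I ν κ t η₁ else CUpd.apply I ν κ t η₂

open Classical in
/-- Insertion of a tuple into a relation: genuine addition, or replacement of the tuples that
agree with it on the key. -/
noncomputable def InsertionSemantics.insert {D : DataSchema} (sem : InsertionSemantics D)
    (R : D.Repo) (u : RTuple D R) (r : Multiset (RTuple D R)) : Multiset (RTuple D R) :=
  match sem with
  | .multiset => u ::ₘ r
  | .set key => u ::ₘ r.filter (fun t => ¬ ∀ k ∈ key R, t k = u k)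

open Classical in
/-- Applying an effect rule under the binding `ν` turns the case variables `v` and the repository
`r` into `v'` and `r'`. -/
def Effect.Apply {D : DataSchema} {Γ : Ctx D.Ty} (sem : InsertionSemantics D) (I : CatInst D)
    (ν : (S : D.Ty) → Γ.Var S → D.dom S) (κ : (S : D.Ty) → CV D S → D.dom S)
    (v : (x : D.CVar) → D.dom (D.cvTy x)) (r : RepoInst D)
    (v' : (x : D.CVar) → D.dom (D.cvTy x)) (r' : RepoInst D) : Effect D Γ → Prop
  | .set σ => v' = σ.apply ν v ∧ r' = r
  | .insertSet R u σ => v' = σ.apply ν v ∧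
      r' = Function.update r R (sem.insert R (fun k => (u k).eval ν) (r R))
  | .deleteSet R u σ => (fun k => (u k).eval ν) ∈ r R ∧ v' = σ.apply ν v ∧
      r' = Function.update r R ((r R).erase (fun k => (u k).eval ν))
  | .update R η => v' = v ∧
      r' = Function.update r R ((r R).map (fun t => η.apply I ν κ t))

/-- `ν` is a binding of the normal variables that satisfies the precondition. -/
def Guard.Answer {D : DataSchema} {Γ : Ctx D.Ty} (g : Guard D Γ) (I : CatInst D) (r : RepoInst D)
    (κ : (S : D.Ty) → CV D S → D.dom S) (ν : (S : D.Ty) → Γ.Var S → D.dom S) : Prop :=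
  (∀ S v, I.Ref S (ν S v)) ∧ g.Holds (Lit.Holds I r (fun S => Sum.elim (ν S) (κ S)))

/-- The data part of a progression step of the case `id`, changing its case variables, its stored
values and the repository. -/
def Action.Apply {D : DataSchema} (sem : InsertionSemantics D) (I : CatInst D)
    (id : D.dom D.ctype) (c : CaseState D) (r : RepoInst D) (c' : CaseState D) (r' : RepoInst D) :
    Action D → Prop
  | .skip => c'.cv = c.cv ∧ c'.pend = c.pend ∧ r' = r
  | .test φ => φ.Holds (c.val id) ∧ c'.cv = c.cv ∧ c'.pend = c.pend ∧ r' = r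
  | .exec α => ∃ ν, α.pre.Answer I r (c.val id) ν ∧
      α.eff.Apply sem I ν (c.val id) c.cv r c'.cv r' ∧ c'.pend = c.pend
  | .start a α => ∃ ν, α.pre.Answer I r (c.val id) ν ∧
      c'.pend = Function.update c.pend a (α.set.apply ν (c.pend a)) ∧ c'.cv = c.cv ∧ r' = r
  | .finish a α => (∀ x, c'.cv x = if (α.set x).isSome then c.pend a x else c.cv x) ∧
      c'.pend = c.pend ∧ r' = r

open Classical in
/-- The two kinds of steps of a DAB: creation of a new case with a fresh identifier, and
progression of a case by one rule. -/
inductive DAB.Step (M : DAB) (sem : InsertionSemantics M.D) (I : CatInst M.D) :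
    Snapshot M.D → Snapshot M.D → Prop
  | newCase (s : Snapshot M.D) (id : M.D.dom M.D.ctype) (hid : id ≠ M.D.undef M.D.ctype)
      (hfresh : s.cases id = none) :
      DAB.Step M sem I s
        ⟨Function.update s.cases id (some (CaseState.fresh M.D)), s.repo⟩
  | progress (s : Snapshot M.D) (id : M.D.dom M.D.ctype) (c c' : CaseState M.D)
      (r' : RepoInst M.D) (ρ : Rule M.D) (hρ : ρ ∈ M.rules) (hc : s.cases id = some c)
      (hpre : ∀ p ∈ ρ.pre, c.life p.1 = p.2)
      (hact : ρ.act.Apply sem I id c s.repo c' r')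
      (hpost : ∀ b, c'.life b = (ρ.post.lookup b).getD (c.life b)) :
      DAB.Step M sem I s ⟨Function.update s.cases id (some c'), r'⟩

/-- Snapshots reached by executions from the initial snapshot, all of whose snapshots satisfy the
foreign keys. -/
inductive DAB.Reachable (M : DAB) (sem : InsertionSemantics M.D) (I : CatInst M.D) :
    Snapshot M.D → Prop
  | initial : DAB.Reachable M sem I (Snapshot.initial M.D)
  | step (s s' : Snapshot M.D) (h : DAB.Reachable M sem I s) (hs : M.Step sem I s s')
      (hv : s'.Valid I) : DAB.Reachable M sem I s'

/-! ## Properties -/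

/-- A lifecycle variable or a lifecycle state. -/
inductive LTm : Type
  | life (b : Addr) | const (st : LState)

def LTm.eval (f : Addr → LState) : LTm → LState
  | .life b => f b
  | .const st => st

/-- Literals of properties: those of guards, and (in)equalities for the case control variables. -/
inductive PLit (D : DataSchema) (V : D.Ty → Type) : Type
  | lit (l : Lit D V) : PLit D V
  | lifeEq (t u : LTm) : PLit D V
  | lifeNe (t u : LTm) : PLit D V

def PLit.Occ {D : DataSchema} {V : D.Ty → Type} (p : (S : D.Ty) → V S → Prop) : PLit D V → Prop
  | .lit l => l.Occ p
  | _ => False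

def PLit.RepoOcc {D : DataSchema} {V : D.Ty → Type} (p : (S : D.Ty) → V S → Prop) :
    PLit D V → Prop
  | .lit l => l.RepoOcc p
  | _ => False

def PLit.Holds {D : DataSchema} {V : D.Ty → Type} (I : CatInst D) (r : RepoInst D)
    (f : Addr → LState) (ν : (S : D.Ty) → V S → D.dom S) : PLit D V → Prop
  | .lit l => l.Holds I r ν
  | .lifeEq t u => t.eval f = u.eval f
  | .lifeNe t u => t.eval f ≠ u.eval f

/-- A property `⋀ᵢ Gᵢ[i]` over `n` cases.  `Γ` lists the normal variables of all guards; every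
normal variable of `Gᵢ` occurs in a repository atom of `Gᵢ`. -/
structure Property (M : DAB) where
  n : ℕ
  Γ : Ctx M.D.Ty
  guard : Fin n → DNF (PLit M.D (GVar M.D Γ))
  repo_bound : ∀ i (k : Γ.ι),
    (guard i).Has (PLit.Occ (fun _ => Sum.elim (fun v => v.pos = k) (fun _ => False))) →
    (guard i).Has (PLit.RepoOcc (fun _ => Sum.elim (fun v => v.pos = k) (fun _ => False)))

/-- A snapshot satisfies the property: there are `n` different cases and values of the normal
variables satisfying the guards. -/
def Property.Sat {M : DAB} (υ : Property M) (I : CatInst M.D) (s : Snapshot M.D) : Prop :=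
  ∃ (id : Fin υ.n → M.D.dom M.D.ctype) (c : Fin υ.n → CaseState M.D)
    (ν : (S : M.D.Ty) → υ.Γ.Var S → M.D.dom S),
    Function.Injective id ∧ (∀ i, s.cases (id i) = some (c i)) ∧ (∀ S v, I.Ref S (ν S v)) ∧
    ∀ i, (υ.guard i).Holds
      (PLit.Holds I s.repo (c i).life (fun S => Sum.elim (ν S) ((c i).val (id i) S)))

/-! ## Translation of DABs into RAS -/

/-- Basic sorts: the types of the data schema, lifecycle states, and Boolean flags. -/
inductive RSrt (D : DataSchema) : Type
  | data (S : D.Ty) | life | flag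

/-- The DB signature of a data schema: a catalog relation `R` gives one function from its
identifier sort for each of its further attributes. -/
def DataSchema.sig (D : DataSchema) : DBSig where
  Srt := RSrt D
  Fn := Σ R : D.Cat, Fin (D.catArity R)
  src f := .data (D.idTy f.1)
  tgt f := .data (D.catTy f.1 f.2)
  Const
    | .data S => {c : D.dom S // c ∈ D.named S}
    | .life => LState
    | .flag => Bool
  undef
    | .data S => ⟨D.undef S, D.undef_named S⟩
    | .life => LState.idle
    | .flag => false
  enum
    | .data S => Finite (D.dom S)
    | .life => True
    | .flag => True

/-- Artifact sorts: process instances, and the entries (hidden primary keys) of each repository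
relation. -/
inductive TSort (D : DataSchema) : Type
  | pi | slot (R : D.Repo)

/-- Artifact components.  `flag R` tells which entries of `R` currently hold a tuple. -/
inductive TArr (D : DataSchema) : Type
  | self | cv (x : D.CVar) | pend (a : Addr) (x : D.CVar) | life (a : Addr)
  | attr (R : D.Repo) (k : Fin (D.repoArity R)) | flag (R : D.Repo)

def DataSchema.art (D : DataSchema) : ArtExt D.sig where
  ASrt := TSort D
  Arr := TArr D
  asrc
    | .self | .cv _ | .pend _ _ | .life _ => .pi
    | .attr R _ | .flag R => .slot R
  atgt
    | .self => .data D.ctype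
    | .cv x | .pend _ x => .data (D.cvTy x)
    | .life _ => .life
    | .attr R k => .data (D.repoTy R k)
    | .flag _ => .flag

section Translation

variable {D : DataSchema} {IV : TSort D → Type} {DV : RSrt D → Type} {At : Type}

/-- The data variables of a context, as variables of the corresponding basic sorts. -/
def dataCtx (Γ : Ctx D.Ty) : Ctx (RSrt D) := ⟨Γ.ι, Γ.fin, fun k => .data (Γ.ty k)⟩

abbrev DTerm (D : DataSchema) (IV : TSort D → Type) (DV : RSrt D → Type) (S : D.Ty) : Type :=
  ATerm D.art IV DV (RSrt.data S)

abbrev DForm (D : DataSchema) (IV : TSort D → Type) (DV : RSrt D → Type) : Type :=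
  AForm D.art IV DV

abbrev DGuard (D : DataSchema) (IV : TSort D → Type) (DV : RSrt D → Type) : Type :=
  GForm D.art IV DV

/-- Formulae with unspecified further atoms. -/
abbrev QForm (D : DataSchema) (IV : TSort D → Type) (DV : RSrt D → Type) (At : Type) : Type :=
  QF D.sig (AVar D.art IV DV) At

/-- The normal variable `v` as a data variable. -/
def trNorm {Γ : Ctx D.Ty} : (S : D.Ty) → Γ.Var S → DTerm D IV (dataCtx Γ).Var S
  | _, .mk k => .var (.data (Ctx.Var.mk (Γ := dataCtx Γ) k))

/-- The case variable `x` of the process instance `i` as the array read `x[i]`. -/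
def trCV (i : IV .pi) : (S : D.Ty) → CV D S → DTerm D IV DV S
  | _, .self => .var (.read (A := D.art) TArr.self i)
  | _, .usr x => .var (.read (A := D.art) (TArr.cv x) i)

/-- The component `k` of the tuple in the entry `e`. -/
def rdAttr {R : D.Repo} (e : IV (.slot R)) (k : Fin (D.repoArity R)) :
    DTerm D IV DV (D.repoTy R k) :=
  .var (.read (A := D.art) (TArr.attr R k) e)

def trTVar {R : D.Repo} (e : IV (.slot R)) : (S : D.Ty) → TVar D R S → DTerm D IV DV S
  | _, .mk k => rdAttr e k

def undefTm (S : D.Ty) : DTerm D IV DV S :=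
  .const (Sg := D.sig) (S := RSrt.data S) ⟨D.undef S, D.undef_named S⟩

/-- The block `a` of the process instance `i` is in state `st`. -/
def lifeIs (i : IV .pi) (a : Addr) (st : LState) : QForm D IV DV At :=
  .eq (Sg := D.sig) (S := RSrt.life) (.var (.read (A := D.art) (TArr.life a) i))
    (.const (Sg := D.sig) (S := RSrt.life) st)

/-- The entry `e` holds a tuple (`b = true`), respectively is empty (`b = false`). -/
def flagIs {R : D.Repo} (e : IV (.slot R)) (b : Bool) : QForm D IV DV At :=
  .eq (Sg := D.sig) (S := RSrt.flag) (.var (.read (A := D.art) (TArr.flag R) e))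
    (.const (Sg := D.sig) (S := RSrt.flag) b)

def Tm.tr {V : D.Ty → Type} (θ : (S : D.Ty) → V S → DTerm D IV DV S) {S : D.Ty} :
    Tm D V S → DTerm D IV DV S
  | .var v => θ S v
  | .const c h => .const (Sg := D.sig) (S := RSrt.data S) ⟨c, h⟩

def Cond.tr (θ : (S : D.Ty) → CV D S → DTerm D IV DV S) : Cond D → QForm D IV DV At
  | .eq t u => .eq (t.tr θ) (u.tr θ)
  | .not φ => .neg (Cond.tr θ φ)
  | .and φ ψ => .and (Cond.tr θ φ) (Cond.tr θ ψ)

/-- `R(t, u₁, ..., uₙ)` becomes `t ≠ undef ∧ u₁ = f₁(t) ∧ ... ∧ uₙ = fₙ(t)`. -/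
def trCat (R : D.Cat) (t : DTerm D IV DV (D.idTy R))
    (u : (k : Fin (D.catArity R)) → DTerm D IV DV (D.catTy R k)) : QForm D IV DV At :=
  .and (.neg (.eq t (undefTm _)))
    (.all fun k => .eq (u k) (STerm.app (Sg := D.sig) ⟨R, k⟩ t))

def CLit.tr {V : D.Ty → Type} (θ : (S : D.Ty) → V S → DTerm D IV DV S) :
    CLit D V → QForm D IV DV At
  | .eq t u => .eq (t.tr θ) (u.tr θ)
  | .ne t u => .neg (.eq (t.tr θ) (u.tr θ))
  | .cat R t u => trCat R (t.tr θ) (fun k => (u k).tr θ)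
  | .ncat R t u => .neg (trCat R (t.tr θ) (fun k => (u k).tr θ))

/-- The entry `e` holds the tuple `u`. -/
def holdsAt {R : D.Repo} (e : IV (.slot R))
    (u : (k : Fin (D.repoArity R)) → DTerm D IV DV (D.repoTy R k)) : QForm D IV DV At :=
  .and (flagIs e true) (.all fun k => .eq (rdAttr e k) (u k))

/-- A repository atom is translated through an index variable `e R` of its own, and a negated one
through a universally quantified index variable. -/
def Lit.tr {V : D.Ty → Type} (θ : (S : D.Ty) → V S → DTerm D IV DV S)
    (e : (R : D.Repo) → IV (.slot R)) : Lit D V → DGuard D IV DV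
  | .base l => l.tr θ
  | .repo R u => holdsAt (e R) (fun k => (u k).tr θ)
  | .nrepo R u => .atom (.univ (A := D.art) (TSort.slot R)
      (.neg (holdsAt .new (fun k => ATerm.shift (A := D.art) (TSort.slot R) ((u k).tr θ)))))

def DNF.tr {L : Type} (g : DNF L) (f : (i : Fin g.n) → Fin (g.len i) → L → QForm D IV DV At) :
    QForm D IV DV At :=
  .any fun i => .all fun j => f i j (g.lit i j)

/-- The positions of literals in a disjunction of conjunctions. -/
abbrev DNF.Pos {L : Type} (g : DNF L) : Type := Σ i : Fin g.n, Fin (g.len i)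

/-- Names of the index variables of a translated rule: the process instance, the entry affected
by an insertion or deletion, and the entries used by the repository atoms at positions `P`. -/
inductive TIdx (D : DataSchema) (P : Type) : Type
  | pi | eff (R : D.Repo) | lit (R : D.Repo) (p : P)

def TIdx.sort {P : Type} : TIdx D P → TSort D
  | .pi => .pi
  | .eff R => .slot R
  | .lit R _ => .slot R

theorem TIdx.finite (D : DataSchema) (P : Type) [Finite P] : Finite (TIdx D P) := by
  have := D.repoFin
  let f : Unit ⊕ D.Repo ⊕ (D.Repo × P) → TIdx D P :=
    Sum.elim (fun _ => .pi) (Sum.elim .eff (fun q => .lit q.1 q.2))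
  refine Finite.of_surjective f ?_
  rintro (_ | R | ⟨R, p⟩)
  exacts [⟨.inl (), rfl⟩, ⟨.inr (.inl R), rfl⟩, ⟨.inr (.inr (R, p)), rfl⟩]

def idxCtx (D : DataSchema) (P : Type) [Finite P] : Ctx (TSort D) :=
  ⟨TIdx D P, TIdx.finite D P, TIdx.sort⟩

/-- The variables of a translated rule. -/
abbrev TIV (D : DataSchema) (P : Type) [Finite P] : TSort D → Type := (idxCtx D P).Var

def vPi (D : DataSchema) (P : Type) [Finite P] : TIV D P .pi :=
  Ctx.Var.mk (Γ := idxCtx D P) TIdx.pi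

def vEff (D : DataSchema) (P : Type) [Finite P] (R : D.Repo) : TIV D P (.slot R) :=
  Ctx.Var.mk (Γ := idxCtx D P) (TIdx.eff R)

def vLit (D : DataSchema) {P : Type} [Finite P] (p : P) (R : D.Repo) : TIV D P (.slot R) :=
  Ctx.Var.mk (Γ := idxCtx D P) (TIdx.lit R p)

/-- A case-defined value for the entry `new` of an array. -/
abbrev TCase (D : DataSchema) (P : Type) [Finite P] (Γ : Ctx D.Ty) (a : TArr D) : Type :=
  CaseTerm D.art (Snoc (D.art.asrc a) (TIV D P)) (dataCtx Γ).Var (D.art.atgt a)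

/-- The array keeps its value at the entry. -/
def keep (D : DataSchema) (P : Type) [Finite P] (Γ : Ctx D.Ty) (a : TArr D) : TCase D P Γ a :=
  .term (.var (.read (A := D.art) a .new))

/-- Equality of index variables. -/
def idxEq {σ : TSort D} (e e' : IV σ) : DForm D IV DV := .atom ⟨σ, e, e'⟩

/-- The translation of the precondition. -/
def Guard.tr {Γ : Ctx D.Ty} (g : Guard D Γ) : DGuard D (TIV D g.Pos) (dataCtx Γ).Var :=
  DNF.tr g fun i j l =>
    l.tr (fun S => Sum.elim (trNorm S) (trCV (vPi D g.Pos) S)) (fun R => vLit D ⟨i, j⟩ R)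

/-- The case-defined function of a conditional update, for the component `k`. -/
def CUpd.tr {P : Type} [Finite P] {Γ : Ctx D.Ty} {R : D.Repo} (k : Fin (D.repoArity R)) :
    CUpd D Γ R → TCase D P Γ (.attr R k)
  | .leaf u => .term ((u k).tr (fun S => Sum.elim (trNorm S) (trTVar .new S)))
  | .ite ψ η₁ η₂ =>
      .ite (DNF.tr (IV := Snoc (.slot R) (TIV D P)) ψ fun _ _ l =>
          l.tr (fun S => Sum.elim (Sum.elim (trNorm S) (trCV (.old (vPi D P)) S)) (trTVar .new S)))
        (CUpd.tr k η₁) (CUpd.tr k η₂)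

/-- The entry `new` of a case variable (or of a stored value) after `SET`. -/
def SetRule.tr {P : Type} [Finite P] {Γ : Ctx D.Ty} (σ : SetRule D Γ) (x : D.CVar) :
    Option (DTerm D (Snoc .pi (TIV D P)) (dataCtx Γ).Var (D.cvTy x)) :=
  (σ x).map (fun t => t.tr trNorm)

/-- The value of the case variable `x` at the entry `new`. -/
def setCV {P : Type} [Finite P] {Γ : Ctx D.Ty} (σ : SetRule D Γ) (x : D.CVar) :
    TCase D P Γ (.cv x) :=
  match σ.tr (P := P) x with
  | none => keep D P Γ (.cv x)
  | some t => .ite (idxEq (σ := TSort.pi) .new (.old (vPi D P))) (.term t) (keep D P Γ (.cv x))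

/-- The tuple in the entry `new` agrees with `u` on the key. -/
def agrees {P : Type} [Finite P] {Γ : Ctx D.Ty} {R : D.Repo}
    (K : Finset (Fin (D.repoArity R))) (u : RTerms D Γ.Var R) :
    DForm D (Snoc (.slot R) (TIV D P)) (dataCtx Γ).Var :=
  .and (flagIs .new true)
    (.all fun k => if k ∈ K then .eq (rdAttr .new k) ((u k).tr trNorm) else .top)

/-- The new tuples after an insertion of `u` into the entry `vEff R`. -/
def insAttr {P : Type} [Finite P] {Γ : Ctx D.Ty} (sem : InsertionSemantics D) {R : D.Repo}
    (u : RTerms D Γ.Var R) (k : Fin (D.repoArity R)) : TCase D P Γ (.attr R k) :=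
  .ite (idxEq (σ := TSort.slot R) .new (.old (vEff D P R))) (.term ((u k).tr trNorm))
    (match sem with
      | .multiset => keep D P Γ (.attr R k)
      | .set key => .ite (agrees (key R) u) (.term (undefTm _)) (keep D P Γ (.attr R k)))

def flagTm {P : Type} [Finite P] {Γ : Ctx D.Ty} {R : D.Repo} (b : Bool) : TCase D P Γ (.flag R) :=
  .term (.const (Sg := D.sig) (S := RSrt.flag) b)

def insFlag {P : Type} [Finite P] {Γ : Ctx D.Ty} (sem : InsertionSemantics D) {R : D.Repo}
    (u : RTerms D Γ.Var R) : TCase D P Γ (.flag R) :=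
  .ite (idxEq (σ := TSort.slot R) .new (.old (vEff D P R))) (flagTm true)
    (match sem with
      | .multiset => keep D P Γ (.flag R)
      | .set key => .ite (agrees (key R) u) (flagTm false) (keep D P Γ (.flag R)))

/-- The additional guard of an effect rule: an insertion needs an empty entry, and a deletion an
entry holding the tuple. -/
def Effect.trGuard {P : Type} [Finite P] {Γ : Ctx D.Ty} :
    Effect D Γ → DGuard D (TIV D P) (dataCtx Γ).Var
  | .insertSet R _ _ => flagIs (vEff D P R) false
  | .deleteSet R u _ => holdsAt (vEff D P R) (fun k => (u k).tr trNorm)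
  | .set _ | .update _ _ => .top

open Classical in
/-- The update of the arrays by an effect rule. -/
noncomputable def Effect.tr {P : Type} [Finite P] {Γ : Ctx D.Ty} (sem : InsertionSemantics D)
    (η : Effect D Γ) : (a : TArr D) → TCase D P Γ a
  | .self => keep D P Γ .self
  | .pend a x => keep D P Γ (.pend a x)
  | .life a => keep D P Γ (.life a)
  | .cv x =>
      match η with
      | .set σ | .insertSet _ _ σ | .deleteSet _ _ σ => setCV σ x
      | .update _ _ => keep D P Γ (.cv x)
  | .attr R k =>
      match η with
      | .set _ => keep D P Γ (.attr R k)
      | .insertSet R' u _ =>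
          if h : R = R' then insAttr (R := R) sem (h ▸ u) k else keep D P Γ (.attr R k)
      | .deleteSet R' _ _ =>
          if R = R' then .ite (idxEq (σ := TSort.slot R) .new (.old (vEff D P R)))
            (.term (undefTm _)) (keep D P Γ (.attr R k))
          else keep D P Γ (.attr R k)
      | .update R' η =>
          if h : R = R' then .ite (flagIs .new true) (CUpd.tr (R := R) k (h ▸ η))
            (keep D P Γ (.attr R k))
          else keep D P Γ (.attr R k)
  | .flag R =>
      match η with
      | .insertSet R' u _ =>
          if h : R = R' then insFlag (R := R) sem (h ▸ u) else keep D P Γ (.flag R)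
      | .deleteSet R' _ _ =>
          if R = R' then .ite (idxEq (σ := TSort.slot R) .new (.old (vEff D P R)))
            (flagTm false) (keep D P Γ (.flag R))
          else keep D P Γ (.flag R)
      | .set _ | .update _ _ => keep D P Γ (.flag R)

/-- A transition with the control part of a rule added to a data guard and a data update: the
blocks in `pre` are tested, and those in `post` set, for the process instance `vPi`. -/
def mkTrans {P : Type} [Finite P] {Γ : Ctx D.Ty} (ρ : Rule D)
    (g : DGuard D (TIV D P) (dataCtx Γ).Var) (u : (a : TArr D) → TCase D P Γ a) :
    Transition D.art where
  E := idxCtx D P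
  Γ := dataCtx Γ
  guard := .and (.all fun k : Fin ρ.pre.length =>
    lifeIs (vPi D P) (ρ.pre.get k).1 (ρ.pre.get k).2) g
  upd
    | .life b =>
        match ρ.post.lookup b with
        | none => keep D P Γ (.life b)
        | some st => .ite (idxEq (σ := TSort.pi) .new (.old (vPi D P)))
            (.term (.const (Sg := D.sig) (S := RSrt.life) st)) (keep D P Γ (.life b))
    | a => u a

def emptyCtx (D : DataSchema) : Ctx D.Ty := ⟨Empty, inferInstance, Empty.elim⟩

/-- The transition of a progression rule. -/
noncomputable def Rule.tr (sem : InsertionSemantics D) (ρ : Rule D) : Transition D.art :=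
  match ρ.act with
  | .skip => mkTrans (P := Empty) (Γ := emptyCtx D) ρ .top (keep D Empty _)
  | .test φ => mkTrans (P := Empty) (Γ := emptyCtx D) ρ (φ.tr (trCV (vPi D Empty)))
      (keep D Empty _)
  | .exec α => mkTrans (P := α.pre.Pos) (Γ := α.Γ) ρ (.and (Guard.tr α.pre) α.eff.trGuard)
      (α.eff.tr sem)
  | .start a α => mkTrans (P := α.pre.Pos) (Γ := α.Γ) ρ (Guard.tr α.pre) fun
      | .pend b x =>
          match if b = a then α.set.tr (P := α.pre.Pos) x else none with
          | none => keep D _ _ (.pend b x)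
          | some t => .ite (idxEq (σ := TSort.pi) .new (.old (vPi D α.pre.Pos))) (.term t)
              (keep D _ _ (.pend b x))
      | b => keep D _ _ b
  | .finish a α => mkTrans (P := Empty) (Γ := emptyCtx D) ρ .top fun
      | .cv x =>
          if (α.set x).isSome then
            .ite (idxEq (σ := TSort.pi) .new (.old (vPi D Empty)))
              (.term (.var (.read (A := D.art) (TArr.pend a x) .new)))
              (keep D Empty _ (.cv x))
          else keep D Empty _ (.cv x)
      | b => keep D Empty _ b

/-- Initially, all case variables are undefined, all blocks idle and all repository entries empty;
the array `self` holds the case identifiers, which are pairwise distinct. -/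
def initOf (D : DataSchema) (a : TArr D) : InitVal D.sig (D.art.atgt a) :=
  match a with
  | .self => .ids
  | a => .const (D.sig.undef (D.art.atgt a))

end Translation

/-- The RAS of a DAB, for unboundedly many cases and repository tuples. -/
noncomputable def DAB.ras (M : DAB) (sem : InsertionSemantics M.D) : RAS M.D.sig where
  A := M.D.art
  init := initOf M.D
  trans := M.rules.map (Rule.tr sem)

/-! ### Translation of properties -/

/-- Names of the index variables of a translated property: the process instances `1, ..., n`, and
the entries used by the repository atoms. -/
inductive PIdx {M : DAB} (υ : Property M) : Type
  | pi (i : Fin υ.n) | lit (R : M.D.Repo) (i : Fin υ.n) (p : (υ.guard i).Pos)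

def PIdx.sort {M : DAB} {υ : Property M} : PIdx υ → TSort M.D
  | .pi _ => .pi
  | .lit R _ _ => .slot R

theorem PIdx.finite {M : DAB} (υ : Property M) : Finite (PIdx υ) := by
  have := M.D.repoFin
  let f : Fin υ.n ⊕ (M.D.Repo × Σ i : Fin υ.n, (υ.guard i).Pos) → PIdx υ :=
    Sum.elim .pi (fun q => .lit q.1 q.2.1 q.2.2)
  refine Finite.of_surjective f ?_
  rintro (i | ⟨R, i, p⟩)
  exacts [⟨.inl i, rfl⟩, ⟨.inr (R, ⟨i, p⟩), rfl⟩]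

def Property.idxCtx {M : DAB} (υ : Property M) : Ctx (TSort M.D) :=
  ⟨PIdx υ, PIdx.finite υ, PIdx.sort⟩

def Property.vPi {M : DAB} (υ : Property M) (i : Fin υ.n) : υ.idxCtx.Var .pi :=
  Ctx.Var.mk (Γ := υ.idxCtx) (PIdx.pi i)

def Property.vLit {M : DAB} (υ : Property M) (i : Fin υ.n) (p : (υ.guard i).Pos) (R : M.D.Repo) :
    υ.idxCtx.Var (.slot R) :=
  Ctx.Var.mk (Γ := υ.idxCtx) (PIdx.lit R i p)

def LTm.tr {D : DataSchema} {IV : TSort D → Type} {DV : RSrt D → Type} (i : IV .pi) :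
    LTm → ATerm D.art IV DV RSrt.life
  | .life b => .var (.read (A := D.art) (TArr.life b) i)
  | .const st => .const (Sg := D.sig) (S := RSrt.life) st

def PLit.tr {D : DataSchema} {IV : TSort D → Type} {DV : RSrt D → Type} {V : D.Ty → Type}
    (θ : (S : D.Ty) → V S → DTerm D IV DV S) (i : IV .pi) (e : (R : D.Repo) → IV (.slot R)) :
    PLit D V → DGuard D IV DV
  | .lit l => l.tr θ e
  | .lifeEq t u => .eq (t.tr i) (u.tr i)
  | .lifeNe t u => .neg (.eq (t.tr i) (u.tr i))

/-- The translation of a property: different indexes denote different process instances. -/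
def Property.tr {M : DAB} (υ : Property M) : ExForm M.D.art where
  E := υ.idxCtx
  Γ := dataCtx υ.Γ
  body := .and
    (.all fun i => .all fun j => if i = j then .top else
      .neg (.atom (.idx (A := M.D.art) TSort.pi (υ.vPi i) (υ.vPi j))))
    (.all fun i => DNF.tr (υ.guard i) fun k l p =>
      p.tr (fun S => Sum.elim (trNorm S) (trCV (υ.vPi i) S)) (υ.vPi i)
        (fun R => υ.vLit i ⟨k, l⟩ R))

/-- `BackReach` terminates on the DAB `M`, the insertion semantics `sem` and the property `υ` with
answer `b` (`true` for yes): the DAB and the property are translated into a RAS and a state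
formula (the data quantifiers of the translated property being eliminated), and backward
reachability returns `b`. -/
def BackReach (M : DAB) (sem : InsertionSemantics M.D) (υ : Property M) (b : Bool) : Prop :=
  ∃ φ : StateFormula M.D.art, IsQE (fun s => υ.tr.Holds s) φ ∧ (M.ras sem).BReach [] φ b

end DABVerif

namespace DABVerif

theorem Ctx.Var.pos_injective {K : Type} {Γ : Ctx K} {S : K} :
    Function.Injective (Ctx.Var.pos : Γ.Var S → Γ.ι) := by
  have key : ∀ {S S' : K} (v : Γ.Var S) (w : Γ.Var S'), v.pos = w.pos → HEq v w := by
    rintro _ _ ⟨k⟩ ⟨l⟩ h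
    cases (h : k = l)
    rfl
  exact fun v w h => eq_of_heq (key v w h)

/-! ## Embeddings and quantifier-free formulae -/

def DBModel.Emb.refl {Sg : DBSig} (M : DBModel Sg) : M.Emb M :=
  ⟨fun _ => id, fun _ => Function.injective_id, fun _ _ => rfl, fun _ _ => rfl⟩

def DBModel.Emb.comp {Sg : DBSig} {M N K : DBModel Sg} (ε : N.Emb K) (δ : M.Emb N) : M.Emb K where
  map S := ε.map S ∘ δ.map S
  inj S := (ε.inj S).comp (δ.inj S)
  map_const S c := by simp [δ.map_const, ε.map_const]
  map_fn f x := by simp [δ.map_fn, ε.map_fn]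

theorem STerm.eval_emb {Sg : DBSig} {V : Sg.Srt → Type} {M N : DBModel Sg} (ε : M.Emb N)
    (ν : (S : Sg.Srt) → V S → M.carrier S) {S : Sg.Srt} (t : STerm Sg V S) :
    t.eval N (fun S v => ε.map S (ν S v)) = ε.map S (t.eval M ν) := by
  induction t with
  | var v => rfl
  | const c => exact (ε.map_const _ c).symm
  | app f t ih => simp only [STerm.eval, ih, ε.map_fn]

theorem QF.holds_emb {Sg : DBSig} {V : Sg.Srt → Type} {At : Type} {M N : DBModel Sg}
    (ε : M.Emb N) (ν : (S : Sg.Srt) → V S → M.carrier S) {h h' : At → Prop}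
    (hh : ∀ a, h' a ↔ h a) (φ : QF Sg V At) :
    φ.Holds N (fun S v => ε.map S (ν S v)) h' ↔ φ.Holds M ν h := by
  induction φ with
  | eq t u => simp only [QF.Holds, STerm.eval_emb, (ε.inj _).eq_iff]
  | atom a => exact hh a
  | neg φ ih => simp only [QF.Holds, ih]
  | all φ ih => simp only [QF.Holds, ih]
  | any φ ih => simp only [QF.Holds, ih]

def STerm.rename {Sg : DBSig} {V W : Sg.Srt → Type} (ρ : (S : Sg.Srt) → V S → W S) :
    {S : Sg.Srt} → STerm Sg V S → STerm Sg W S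
  | _, .var v => .var (ρ _ v)
  | _, .const c => .const c
  | _, .app f t => .app f (STerm.rename ρ t)

theorem STerm.eval_rename {Sg : DBSig} {V W : Sg.Srt → Type} (ρ : (S : Sg.Srt) → V S → W S)
    (M : DBModel Sg) (ν : (S : Sg.Srt) → W S → M.carrier S) {S : Sg.Srt} (t : STerm Sg V S) :
    (t.rename ρ).eval M ν = t.eval M (fun S v => ν S (ρ S v)) := by
  induction t with
  | var v => rfl
  | const c => rfl
  | app f t ih => simp only [STerm.eval, STerm.rename, ih]

def QF.rename {Sg : DBSig} {V W : Sg.Srt → Type} {At : Type} (ρ : (S : Sg.Srt) → V S → W S) :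
    QF Sg V At → QF Sg W At
  | .eq t u => .eq (t.rename ρ) (u.rename ρ)
  | .atom a => .atom a
  | .neg φ => .neg (QF.rename ρ φ)
  | .all φ => .all fun i => QF.rename ρ (φ i)
  | .any φ => .any fun i => QF.rename ρ (φ i)

theorem QF.holds_rename {Sg : DBSig} {V W : Sg.Srt → Type} {At : Type}
    (ρ : (S : Sg.Srt) → V S → W S) (M : DBModel Sg) (ν : (S : Sg.Srt) → W S → M.carrier S)
    (h : At → Prop) (φ : QF Sg V At) :
    (φ.rename ρ).Holds M ν h ↔ φ.Holds M (fun S v => ν S (ρ S v)) h := by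
  induction φ with
  | eq t u => simp only [QF.Holds, QF.rename, STerm.eval_rename]
  | atom a => rfl
  | neg φ ih => simp only [QF.Holds, QF.rename, ih]
  | all φ ih => simp only [QF.Holds, QF.rename, ih]
  | any φ ih => simp only [QF.Holds, QF.rename, ih]

/-! ## Amalgamation of extensions of a model -/

section Amalgam

variable {Sg : DBSig} (M : DBModel Sg) {ι : Type} (N : ι → DBModel Sg) (ε : ∀ i, M.Emb (N i))

/-- The elements of the disjoint union over `M` of a family of extensions of `M`. -/
abbrev AmalgamCarrier (S : Sg.Srt) : Type :=
  M.carrier S ⊕ Σ i, {x : (N i).carrier S // x ∉ Set.range ((ε i).map S)}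

variable {M} {N}

open Classical in
noncomputable def amalgamIn (i : ι) (S : Sg.Srt) (x : (N i).carrier S) : AmalgamCarrier M N ε S :=
  if h : x ∈ Set.range ((ε i).map S) then .inl h.choose else .inr ⟨i, x, h⟩

theorem amalgamIn_map (i : ι) (S : Sg.Srt) (x : M.carrier S) :
    amalgamIn ε i S ((ε i).map S x) = .inl x := by
  have h : (ε i).map S x ∈ Set.range ((ε i).map S) := ⟨x, rfl⟩
  rw [amalgamIn, dif_pos h]
  exact congrArg _ ((ε i).inj S h.choose_spec)

theorem amalgamIn_of_notMem (i : ι) (S : Sg.Srt) (x : (N i).carrier S)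
    (h : x ∉ Set.range ((ε i).map S)) : amalgamIn ε i S x = .inr ⟨i, x, h⟩ := by
  rw [amalgamIn, dif_neg h]

theorem amalgamIn_injective (i : ι) (S : Sg.Srt) : Function.Injective (amalgamIn ε i S) := by
  intro x y hxy
  by_cases hx : x ∈ Set.range ((ε i).map S) <;> by_cases hy : y ∈ Set.range ((ε i).map S)
  · obtain ⟨x, rfl⟩ := hx
    obtain ⟨y, rfl⟩ := hy
    rw [amalgamIn_map, amalgamIn_map] at hxy
    rw [Sum.inl.inj hxy]
  · obtain ⟨x, rfl⟩ := hx
    rw [amalgamIn_map, amalgamIn_of_notMem _ _ _ _ hy] at hxy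
    cases hxy
  · obtain ⟨y, rfl⟩ := hy
    rw [amalgamIn_map, amalgamIn_of_notMem _ _ _ _ hx] at hxy
    cases hxy
  · rw [amalgamIn_of_notMem _ _ _ _ hx, amalgamIn_of_notMem _ _ _ _ hy] at hxy
    cases hxy
    rfl

theorem amalgamIn_const (i : ι) (S : Sg.Srt) (c : Sg.Const S) :
    amalgamIn ε i S ((N i).const S c) = .inl (M.const S c) := by
  rw [← (ε i).map_const, amalgamIn_map]

noncomputable def DBModel.amalgam : DBModel Sg where
  carrier := AmalgamCarrier M N ε
  const S c := .inl (M.const S c)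
  fn f := Sum.elim (fun x => .inl (M.fn f x)) (fun p => amalgamIn ε p.1 _ ((N p.1).fn f p.2.1))
  null f x := by
    rcases x with x | ⟨i, x, hx⟩
    · simpa using M.null f x
    · rw [Sum.elim_inr, ← amalgamIn_const ε i, ← amalgamIn_of_notMem ε i _ x hx,
        ← amalgamIn_const ε i, (amalgamIn_injective ε i _).eq_iff,
        (amalgamIn_injective ε i _).eq_iff]
      exact (N i).null f x
  distinct S := Sum.inl_injective.comp (M.distinct S)
  closed S hS x := by
    rcases x with x | ⟨i, x, hx⟩
    · obtain ⟨c, rfl⟩ := M.closed S hS x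
      exact ⟨c, rfl⟩
    · obtain ⟨c, rfl⟩ := (N i).closed S hS x
      exact absurd ⟨_, (ε i).map_const S c⟩ hx

def DBModel.amalgamBase : M.Emb (DBModel.amalgam ε) :=
  ⟨fun _ => .inl, fun _ => Sum.inl_injective, fun _ _ => rfl, fun _ _ => rfl⟩

noncomputable def DBModel.amalgamEmb (i : ι) : (N i).Emb (DBModel.amalgam ε) where
  map := amalgamIn ε i
  inj := amalgamIn_injective ε i
  map_const := amalgamIn_const ε i
  map_fn f x := by
    by_cases hx : x ∈ Set.range ((ε i).map _)
    · obtain ⟨x, rfl⟩ := hx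
      rw [← (ε i).map_fn, amalgamIn_map, amalgamIn_map]
      rfl
    · rw [amalgamIn_of_notMem _ _ _ _ hx]
      rfl

end Amalgam

/-! ## Existentially closed extensions -/

section ExistentiallyClosed

variable {Sg : DBSig}

/-- Formulae with parameters in `M` and countably many variables of every sort. -/
abbrev DBModel.ParamForm (M : DBModel Sg) : Type := QF Sg (fun S => M.carrier S ⊕ ℕ) Empty

/-- The extension `N` of `M` satisfies the existential closure of the formula. -/
def DBModel.ParamForm.HoldsIn {M : DBModel Sg} (φ : M.ParamForm) {N : DBModel Sg} (ε : M.Emb N) :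
    Prop :=
  ∃ d : (S : Sg.Srt) → ℕ → N.carrier S,
    φ.Holds N (fun S => Sum.elim (ε.map S) (d S)) Empty.elim

theorem DBModel.ParamForm.HoldsIn.comp {M N K : DBModel Sg} {φ : M.ParamForm} {ε : M.Emb N}
    (h : φ.HoldsIn ε) (δ : N.Emb K) (η : M.Emb K) (hη : ∀ S x, η.map S x = δ.map S (ε.map S x)) :
    φ.HoldsIn η := by
  obtain ⟨d, hd⟩ := h
  refine ⟨fun S n => δ.map S (d S n), ?_⟩
  rw [← QF.holds_emb δ _ (h' := Empty.elim) (fun a => a.elim)] at hd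
  convert hd using 3 with S v
  rcases v with v | v
  · exact hη S v
  · rfl

theorem DBModel.exists_witness (M : DBModel Sg) (φ : M.ParamForm) :
    ∃ (N : DBModel Sg) (ε : M.Emb N),
      ∀ (K : DBModel Sg) (δ : M.Emb K), φ.HoldsIn δ → φ.HoldsIn ε := by
  by_cases h : ∃ (K : DBModel Sg) (δ : M.Emb K), φ.HoldsIn δ
  · obtain ⟨K, δ, h⟩ := h
    exact ⟨K, δ, fun _ _ _ => h⟩
  · exact ⟨M, .refl M, fun K δ h' => absurd ⟨K, δ, h'⟩ h⟩

/-- Every existential formula with parameters in `M` that holds in some extension of `M` holds in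
a common extension. -/
theorem DBModel.exists_extension (M : DBModel Sg) :
    ∃ (N : DBModel Sg) (ε : M.Emb N), ∀ (φ : M.ParamForm) (K : DBModel Sg) (δ : M.Emb K),
      φ.HoldsIn δ → φ.HoldsIn ε := by
  choose N ε h using M.exists_witness
  refine ⟨DBModel.amalgam ε, DBModel.amalgamBase ε, fun φ K δ hφ => ?_⟩
  exact (h φ K δ hφ).comp (DBModel.amalgamEmb ε φ) _ (fun S x => (amalgamIn_map ε φ S x).symm)

section Chain

variable (C : ℕ → DBModel Sg) (step : ∀ n, (C n).Emb (C (n + 1)))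

variable {C} in
def chainUp {i j : ℕ} (h : i ≤ j) : (C i).Emb (C j) :=
  Nat.leRecOn (C := fun j => (C i).Emb (C j)) h (fun {k} ε => (step k).comp ε) (.refl _)

variable {C} in
theorem chainUp_refl (i : ℕ) : chainUp step (le_refl i) = .refl (C i) := Nat.leRecOn_self _

variable {C} in
theorem chainUp_succ {i j : ℕ} (h : i ≤ j) (h' : i ≤ j + 1) :
    chainUp step h' = (step j).comp (chainUp step h) := Nat.leRecOn_succ h _

variable {C} in
theorem chainUp_trans {i j k : ℕ} (hij : i ≤ j) (hjk : j ≤ k) (S : Sg.Srt) (x : (C i).carrier S) :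
    (chainUp step hjk).map S ((chainUp step hij).map S x) =
      (chainUp step (hij.trans hjk)).map S x := by
  induction k, hjk using Nat.le_induction with
  | base => rw [chainUp_refl]; rfl
  | succ k hjk ih =>
    rw [chainUp_succ step hjk, chainUp_succ step (hij.trans hjk)]
    exact congrArg ((step k).map S) ih

def chainSetoid (S : Sg.Srt) : Setoid (Σ i, (C i).carrier S) where
  r x y := ∃ (k : ℕ) (hx : x.1 ≤ k) (hy : y.1 ≤ k),
    (chainUp step hx).map S x.2 = (chainUp step hy).map S y.2
  iseqv := by
    refine ⟨fun x => ⟨x.1, le_rfl, le_rfl, rfl⟩, fun ⟨k, hx, hy, h⟩ => ⟨k, hy, hx, h.symm⟩, ?_⟩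
    rintro x y z ⟨k, hx, hy, h⟩ ⟨l, hy', hz, h'⟩
    refine ⟨max k l, hx.trans (le_max_left _ _), hz.trans (le_max_right _ _), ?_⟩
    rw [← chainUp_trans step hx (le_max_left _ _), h, chainUp_trans,
      ← chainUp_trans step hz (le_max_right _ _), ← h', chainUp_trans]

def chainIn (i : ℕ) (S : Sg.Srt) (x : (C i).carrier S) : Quotient (chainSetoid C step S) :=
  Quotient.mk _ ⟨i, x⟩

variable {C}

theorem chainIn_up {i j : ℕ} (h : i ≤ j) (S : Sg.Srt) (x : (C i).carrier S) :
    chainIn C step j S ((chainUp step h).map S x) = chainIn C step i S x :=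
  Quotient.sound ⟨j, le_rfl, h, by rw [chainUp_refl]; rfl⟩

theorem chainIn_injective (i : ℕ) (S : Sg.Srt) : Function.Injective (chainIn C step i S) := by
  intro x y h
  obtain ⟨k, hx, hy, h⟩ := Quotient.exact h
  exact (chainUp step hx).inj S h

theorem chainIn_const (i j : ℕ) (S : Sg.Srt) (c : Sg.Const S) :
    chainIn C step i S ((C i).const S c) = chainIn C step j S ((C j).const S c) := by
  rw [← chainIn_up step (le_max_left i j), ← chainIn_up step (le_max_right i j),
    (chainUp _ _).map_const, (chainUp _ _).map_const]

theorem exists_chainIn {S : Sg.Srt} (x : Quotient (chainSetoid C step S)) :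
    ∃ i y, chainIn C step i S y = x := by
  obtain ⟨⟨i, y⟩, rfl⟩ := Quotient.exists_rep x
  exact ⟨i, y, rfl⟩

def chainFn (f : Sg.Fn) : Quotient (chainSetoid C step (Sg.src f)) →
    Quotient (chainSetoid C step (Sg.tgt f)) :=
  Quotient.lift (fun x => chainIn C step x.1 _ ((C x.1).fn f x.2)) (by
    rintro x y ⟨k, hx, hy, h⟩
    rw [← chainIn_up step hx, ← chainIn_up step hy, (chainUp _ _).map_fn, (chainUp _ _).map_fn, h])

theorem chainFn_in (f : Sg.Fn) (i : ℕ) (x : (C i).carrier (Sg.src f)) :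
    chainFn step f (chainIn C step i _ x) = chainIn C step i _ ((C i).fn f x) := rfl

/-- The union of a chain of models. -/
def DBModel.union : DBModel Sg where
  carrier S := Quotient (chainSetoid C step S)
  const S c := chainIn C step 0 S ((C 0).const S c)
  fn := chainFn step
  null f x := by
    obtain ⟨i, x, rfl⟩ := exists_chainIn step x
    rw [chainFn_in, chainIn_const step 0 i, chainIn_const step 0 i,
      (chainIn_injective step i _).eq_iff, (chainIn_injective step i _).eq_iff]
    exact (C i).null f x
  distinct S := (chainIn_injective step 0 S).comp ((C 0).distinct S)
  closed S hS x := by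
    obtain ⟨i, x, rfl⟩ := exists_chainIn step x
    obtain ⟨c, rfl⟩ := (C i).closed S hS x
    exact ⟨c, chainIn_const step 0 i S c⟩

def DBModel.unionEmb (i : ℕ) : (C i).Emb (DBModel.union step) where
  map := chainIn C step i
  inj := chainIn_injective step i
  map_const S c := chainIn_const step i 0 S c
  map_fn _ _ := rfl

end Chain

/-- Every model of `T` embeds into an existentially closed one. -/
theorem DBModel.exists_isTStar (M : DBModel Sg) : ∃ N : DBModel Sg, N.IsTStar ∧ Nonempty (M.Emb N) := by
  choose nx emb hnx using DBModel.exists_extension (Sg := Sg)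
  let C : ℕ → DBModel Sg := fun n => Nat.rec M (fun _ K => nx K) n
  let step : ∀ n, (C n).Emb (C (n + 1)) := fun n => emb (C n)
  refine ⟨DBModel.union step, ?_, ⟨DBModel.unionEmb step 0⟩⟩
  intro N ε Γ Δ φ p ⟨d, hd⟩
  have := Γ.fin
  have := Δ.fin
  obtain ⟨num, hnum⟩ := Countable.exists_injective_nat Δ.ι
  -- all parameters lie in one member of the chain
  have hp : ∀ k : Γ.ι, ∃ i y, chainIn C step i _ y = p _ (.mk k) := fun k => exists_chainIn step _
  choose i y hy using hp
  obtain ⟨m, hm⟩ : ∃ m, ∀ k, i k ≤ m := by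
    obtain ⟨m, hm⟩ := (Set.finite_range i).bddAbove
    exact ⟨m, fun k => hm ⟨k, rfl⟩⟩
  let q : (S : Sg.Srt) → Γ.Var S → (C m).carrier S := fun S v =>
    match v with
    | .mk k => (chainUp step (hm k)).map _ (y k)
  have hq : ∀ S v, chainIn C step m S (q S v) = p S v := by
    rintro S ⟨k⟩
    exact (chainIn_up step (hm k) _ _).trans (hy k)
  let ψ : (C m).ParamForm :=
    φ.rename (fun S => Sum.elim (fun v => .inl (q S v)) (fun v => .inr (num v.pos)))
  have hψ : ψ.HoldsIn (ε.comp (DBModel.unionEmb step m)) := by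
    classical
    refine ⟨fun S n => if h : ∃ v : Δ.Var S, num v.pos = n then d S h.choose
      else N.const S (Sg.undef S), ?_⟩
    rw [QF.holds_rename]
    convert hd using 3 with S v
    rcases v with v | v
    · exact congrArg (ε.map S) (hq S v)
    · have h : ∃ w : Δ.Var S, num w.pos = num v.pos := ⟨v, rfl⟩
      have hw : h.choose = v :=
        Ctx.Var.pos_injective (hnum h.choose_spec)
      simp only [Sum.elim_inr, dif_pos h, hw]
  obtain ⟨d', hd'⟩ := (hnx (C m) ψ N _ hψ).comp (K := DBModel.union step)
    (DBModel.unionEmb step (m + 1)) (DBModel.unionEmb step m) (fun S x => by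
      have := chainIn_up step (Nat.le_succ m) S x
      rw [chainUp_succ step le_rfl, chainUp_refl] at this
      exact this.symm)
  refine ⟨fun S v => d' S (num v.pos), ?_⟩
  rw [QF.holds_rename] at hd'
  convert hd' using 3 with S v
  rcases v with v | v
  · exact (hq S v).symm
  · rfl

end ExistentiallyClosed

/-! ## Correctness of backward reachability -/

section Backward

variable {Sg : DBSig}

def AState.lift {A : ArtExt Sg} {M N : DBModel Sg} {Idx : A.ASrt → Type} (ε : M.Emb N)
    (s : AState A M Idx) : AState A N Idx :=
  fun a y => ε.map _ (s a y)

theorem StateFormula.holds_lift {A : ArtExt Sg} {M N : DBModel Sg} {Idx : A.ASrt → Type}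
    (ε : M.Emb N) (φ : StateFormula A) (s : AState A M Idx) :
    φ.Holds (AState.lift ε s) ↔ φ.Holds s := by
  refine exists_congr fun e => ?_
  unfold AForm.Holds
  have : (AVar.eval (AState.lift ε s) e fun _ (v : Empty) => v.elim) =
      fun S v => ε.map S (AVar.eval s e (fun _ (v : Empty) => v.elim) S v) := by
    funext S v
    rcases v with v | _
    · exact v.elim
    · rfl
  rw [this]
  exact QF.holds_emb ε _ (fun _ => Iff.rfl) φ.body

theorem RAS.init_lift {𝒮 : RAS Sg} {M N : DBModel Sg} {Idx : 𝒮.A.ASrt → Type} (ε : M.Emb N)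
    {s : AState 𝒮.A M Idx} (h : 𝒮.Init s) : 𝒮.Init (AState.lift ε s) := by
  intro a
  have := h a
  generalize 𝒮.init a = v at this
  cases v with
  | const c => exact fun y => (congrArg _ (this y)).trans (ε.map_const _ c)
  | ids =>
    refine ⟨(ε.inj _).comp this.1, fun y hy => this.2 y (ε.inj _ ?_)⟩
    exact hy.trans (ε.map_const _ _).symm

/-- The formulae visited by the algorithm are the successive preimages of the first one, and none
of them intersects the initial states. -/
def RAS.Visited (𝒮 : RAS Sg) : List (StateFormula 𝒮.A) → StateFormula 𝒮.A → Prop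
  | [], _ => True
  | χ :: B, φ => IsQE (fun s => 𝒮.Pre χ s) φ ∧ ¬ TSat 𝒮.A (fun s => 𝒮.Init s ∧ χ.Holds s) ∧
      RAS.Visited 𝒮 B χ

theorem RAS.Visited.pre_mem {𝒮 : RAS Sg} {M : DBModel Sg} (hM : M.IsTStar)
    {Idx : 𝒮.A.ASrt → Type} (hI : ∀ σ, Nonempty (Idx σ)) {B : List (StateFormula 𝒮.A)}
    {φ : StateFormula 𝒮.A} (h : 𝒮.Visited B φ) {s s' : AState 𝒮.A M Idx} (hs : 𝒮.Next s s')
    (hs' : ∃ χ ∈ B, χ.Holds s') : φ.Holds s ∨ ∃ χ ∈ B, χ.Holds s := by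
  induction B generalizing φ with
  | nil => simp at hs'
  | cons χ B ih =>
    obtain ⟨hqe, -, hB⟩ := h
    obtain ⟨ξ, hξ, hs'⟩ := hs'
    rcases List.mem_cons.1 hξ with rfl | hξ
    · exact .inl ((hqe M Idx hM hI s).2 ⟨s', hs, hs'⟩)
    · rcases ih hB ⟨ξ, hξ, hs'⟩ with h | ⟨ζ, hζ, h⟩
      · exact .inr ⟨χ, by simp, h⟩
      · exact .inr ⟨ζ, by simp [hζ], h⟩

theorem RAS.Visited.not_init {𝒮 : RAS Sg} {B : List (StateFormula 𝒮.A)}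
    {φ : StateFormula 𝒮.A} (h : 𝒮.Visited B φ) {χ : StateFormula 𝒮.A} (hχ : χ ∈ B) :
    ¬ TSat 𝒮.A (fun s => 𝒮.Init s ∧ χ.Holds s) := by
  induction B generalizing φ with
  | nil => simp at hχ
  | cons ξ B ih =>
    rcases List.mem_cons.1 hχ with rfl | hχ
    · exact h.2.1
    · exact ih h.2.2 hχ

theorem RAS.BReach.sound {𝒮 : RAS Sg} {B : List (StateFormula 𝒮.A)} {φ : StateFormula 𝒮.A}
    {b : Bool} (h : 𝒮.BReach B φ b) (hb : b = true) :
    ∃ (N : DBModel Sg) (Idx : 𝒮.A.ASrt → Type), N.IsTStar ∧ (∀ σ, Nonempty (Idx σ)) ∧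
      ∃ s₀ s : AState 𝒮.A N Idx, 𝒮.Init s₀ ∧ Relation.ReflTransGen 𝒮.Next s₀ s ∧ φ.Holds s := by
  induction h with
  | answerNo => cases hb
  | answerYes B φ nofix hit =>
    obtain ⟨M, Idx, hI, s, hs, hφ⟩ := hit
    obtain ⟨N, hN, ⟨ε⟩⟩ := M.exists_isTStar
    exact ⟨N, Idx, hN, hI, AState.lift ε s, AState.lift ε s, RAS.init_lift ε hs, .refl,
      (StateFormula.holds_lift ε φ s).2 hφ⟩
  | step B φ ψ b nofix nohit qe rest ih =>
    obtain ⟨N, Idx, hN, hI, s₀, s, h₀, hs, hψ⟩ := ih hb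
    obtain ⟨s', hss', hφ⟩ := (qe N Idx hN hI s).1 hψ
    exact ⟨N, Idx, hN, hI, s₀, s', h₀, hs.tail hss', hφ⟩

theorem RAS.BReach.complete {𝒮 : RAS Sg} {B : List (StateFormula 𝒮.A)} {φ : StateFormula 𝒮.A}
    {b : Bool} (h : 𝒮.BReach B φ b) (hB : 𝒮.Visited B φ) {N : DBModel Sg}
    {Idx : 𝒮.A.ASrt → Type} (hN : N.IsTStar) (hI : ∀ σ, Nonempty (Idx σ))
    {s₀ s : AState 𝒮.A N Idx} (h₀ : 𝒮.Init s₀) (hs : Relation.ReflTransGen 𝒮.Next s₀ s)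
    (hφ : φ.Holds s ∨ ∃ χ ∈ B, χ.Holds s) : b = true := by
  induction h with
  | answerYes => rfl
  | answerNo B φ fix =>
    exfalso
    have hfix : ∀ s' : AState 𝒮.A N Idx, (φ.Holds s' ∨ ∃ χ ∈ B, χ.Holds s') →
        ∃ χ ∈ B, χ.Holds s' := by
      rintro s' (h | h)
      · by_contra hc
        push Not at hc
        exact fix ⟨N, Idx, hI, s', h, hc⟩
      · exact h
    obtain ⟨χ, hχ, h⟩ : ∃ χ ∈ B, χ.Holds s₀ := by
      clear h₀
      induction hs using Relation.ReflTransGen.head_induction_on with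
      | refl => exact hfix _ hφ
      | head hab _ ih =>
        exact hfix _ (hB.pre_mem hN hI hab ih)
    exact hB.not_init hχ ⟨N, Idx, hI, s₀, h₀, h⟩
  | step B φ ψ b nofix nohit qe rest ih =>
    refine ih ⟨qe, nohit, hB⟩ (.inr ?_)
    rcases hφ with h | ⟨χ, hχ, h⟩
    · exact ⟨φ, by simp, h⟩
    · exact ⟨χ, by simp [hχ], h⟩

end Backward

theorem QF.holds_and {Sg : DBSig} {V : Sg.Srt → Type} {At : Type} {M : DBModel Sg}
    {ν : (S : Sg.Srt) → V S → M.carrier S} {h : At → Prop} {φ ψ : QF Sg V At} :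
    (QF.and φ ψ).Holds M ν h ↔ φ.Holds M ν h ∧ ψ.Holds M ν h := by
  simp [QF.and, QF.Holds, Fin.forall_fin_two]

theorem QF.holds_top {Sg : DBSig} {V : Sg.Srt → Type} {At : Type} {M : DBModel Sg}
    {ν : (S : Sg.Srt) → V S → M.carrier S} {h : At → Prop} :
    (QF.top : QF Sg V At).Holds M ν h := fun i => i.elim0

theorem ATerm.eval_shift {Sg : DBSig} {A : ArtExt Sg} {IV : A.ASrt → Type} {DV : Sg.Srt → Type}
    {N : DBModel Sg} {Idx : A.ASrt → Type} (s : AState A N Idx) {σ : A.ASrt}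
    (ev : (σ : A.ASrt) → IV σ → Idx σ) (d : (S : Sg.Srt) → DV S → N.carrier S) (j : Idx σ)
    {S : Sg.Srt} (t : ATerm A IV DV S) :
    STerm.eval N (AVar.eval s (Snoc.elim j ev) d) (ATerm.shift σ t) =
      STerm.eval N (AVar.eval s ev d) t := by
  induction t with
  | var v => cases v <;> rfl
  | const c => rfl
  | app f t ih => exact congrArg (N.fn f) ih

/-! ## Elements of models and entries of arrays -/

section Access

variable {D : DataSchema} (N : DBModel D.sig)

/-- The elements of a basic sort. -/
def Elem (S : RSrt D) : Type := N.carrier S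

def dataConst (S : D.Ty) (c : D.dom S) (h : c ∈ D.named S) : Elem N (.data S) :=
  N.const (RSrt.data S) ⟨c, h⟩

def undefElem (S : D.Ty) : Elem N (.data S) := dataConst N S (D.undef S) (D.undef_named S)

def lifeConst (st : LState) : Elem N .life := N.const RSrt.life st

def flagConst (b : Bool) : Elem N .flag := N.const RSrt.flag b

def catFn (R : D.Cat) (k : Fin (D.catArity R)) (x : Elem N (.data (D.idTy R))) :
    Elem N (.data (D.catTy R k)) := N.fn ⟨R, k⟩ x

theorem lifeConst_injective : Function.Injective (lifeConst N) := N.distinct RSrt.life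

theorem flagConst_injective : Function.Injective (flagConst N) := N.distinct RSrt.flag

theorem flagConst_surjective : Function.Surjective (flagConst N) := N.closed RSrt.flag trivial

variable {N} {Idx : TSort D → Type} (s : AState D.art N Idx)

def selfAt (i : Idx .pi) : Elem N (.data D.ctype) := s TArr.self i

def cvAt (x : D.CVar) (i : Idx .pi) : Elem N (.data (D.cvTy x)) := s (TArr.cv x) i

def pendAt (a : Addr) (x : D.CVar) (i : Idx .pi) : Elem N (.data (D.cvTy x)) := s (TArr.pend a x) i

def lifeAt (b : Addr) (i : Idx .pi) : Elem N .life := s (TArr.life b) i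

def attrAt (R : D.Repo) (k : Fin (D.repoArity R)) (y : Idx (.slot R)) :
    Elem N (.data (D.repoTy R k)) := s (TArr.attr R k) y

def flagAt (R : D.Repo) (y : Idx (.slot R)) : Elem N .flag := s (TArr.flag R) y

end Access

/-! ## Correspondence between the values of an execution and the elements of a model -/

/-- A partial one-to-one correspondence between the objects of the types of a data schema and the
elements of a model of `T`, compatible with constants and with the catalog. -/
structure Corr {D : DataSchema} (I : CatInst D) (N : DBModel D.sig) where
  rel : (S : D.Ty) → D.dom S → Elem N (RSrt.data S) → Prop
  eq_iff : ∀ {S : D.Ty} {v v' : D.dom S} {n n' : Elem N (RSrt.data S)},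
    rel S v n → rel S v' n' → (v = v' ↔ n = n')
  const : ∀ (S : D.Ty) (c : D.dom S) (h : c ∈ D.named S), rel S c (dataConst N S c h)
  ref : ∀ {S : D.Ty} {v : D.dom S} {n : Elem N (RSrt.data S)}, rel S v n → I.Ref S v
  cat : ∀ (R : D.Cat) {v : D.dom (D.idTy R)} {n : Elem N (RSrt.data (D.idTy R))}
    {u : (k : Fin (D.catArity R)) → D.dom (D.catTy R k)}
    {m : (k : Fin (D.catArity R)) → Elem N (RSrt.data (D.catTy R k))},
    rel _ v n → (∀ k, rel _ (u k) (m k)) →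
    ((v, u) ∈ I.rel R ↔
      n ≠ undefElem N (D.idTy R) ∧ ∀ k, m k = catFn N R k n)

section Literals

variable {D : DataSchema} {I : CatInst D} {N : DBModel D.sig} (C : Corr I N)
  {IV : TSort D → Type} {DV : RSrt D → Type} {At : Type} {V : D.Ty → Type}

/-- The values of the variables correspond to the values of the terms they are translated to. -/
def Corr.ValRel (w : (S : RSrt D) → AVar D.art IV DV S → N.carrier S)
    (θ : (S : D.Ty) → V S → DTerm D IV DV S) (ν : (S : D.Ty) → V S → D.dom S) : Prop :=
  ∀ S v, C.rel S (ν S v) ((θ S v).eval N w)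

variable {C} {w : (S : RSrt D) → AVar D.art IV DV S → N.carrier S}
  {θ : (S : D.Ty) → V S → DTerm D IV DV S} {ν : (S : D.Ty) → V S → D.dom S}

theorem Tm.rel_tr (h : C.ValRel w θ ν) {S : D.Ty} (t : Tm D V S) :
    C.rel S (t.eval ν) ((t.tr θ).eval N w) := by
  cases t with
  | var v => exact h S v
  | const c hc => exact C.const S c hc

theorem Cond.holds_tr {θ : (S : D.Ty) → CV D S → DTerm D IV DV S}
    {ν : (S : D.Ty) → CV D S → D.dom S} (h : C.ValRel w θ ν) (hat : At → Prop) (φ : Cond D) :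
    QF.Holds N w hat (φ.tr θ) ↔ φ.Holds ν := by
  induction φ with
  | eq t u => exact (C.eq_iff (Tm.rel_tr h t) (Tm.rel_tr h u)).symm
  | not φ ih => exact not_congr ih
  | and φ ψ ih₁ ih₂ => exact QF.holds_and.trans (and_congr ih₁ ih₂)

theorem holds_trCat (h : C.ValRel w θ ν) (hat : At → Prop) (R : D.Cat) (t : Tm D V (D.idTy R))
    (u : (k : Fin (D.catArity R)) → Tm D V (D.catTy R k)) :
    QF.Holds N w hat (trCat R (t.tr θ) (fun k => (u k).tr θ)) ↔
      (t.eval ν, fun k => (u k).eval ν) ∈ I.rel R := by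
  rw [C.cat R (Tm.rel_tr h t) (fun k => Tm.rel_tr h (u k))]
  exact QF.holds_and

theorem CLit.holds_tr (h : C.ValRel w θ ν) (hat : At → Prop) (l : CLit D V) :
    QF.Holds N w hat (l.tr θ) ↔ l.Holds I ν := by
  cases l with
  | eq t u => exact (C.eq_iff (Tm.rel_tr h t) (Tm.rel_tr h u)).symm
  | ne t u => exact not_congr (C.eq_iff (Tm.rel_tr h t) (Tm.rel_tr h u)).symm
  | cat R t u => exact holds_trCat h hat R t u
  | ncat R t u => exact not_congr (holds_trCat h hat R t u)

end Literals

section States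

variable {D : DataSchema} {I : CatInst D} {N : DBModel D.sig} (C : Corr I N)
  {Idx : TSort D → Type} (s : AState D.art N Idx)
  {IV : TSort D → Type} {DV : RSrt D → Type} {At : Type} {V : D.Ty → Type}

/-- The arrays describe, for the process instance `i`, the case `id` with entry `c`. -/
structure CaseSim (i : Idx .pi) (id : D.dom D.ctype) (c : CaseState D) : Prop where
  self : C.rel _ id (selfAt s i)
  cv : ∀ x, C.rel _ (c.cv x) (cvAt s x i)
  pend : ∀ a x, C.rel _ (c.pend a x) (pendAt s a x i)
  life : ∀ b, lifeAt s b i = lifeConst N (c.life b)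

/-- The entries in `F` are those holding a tuple, and `τ` gives the tuples. -/
structure RelSim (R : D.Repo) (F : Finset (Idx (.slot R))) (τ : Idx (.slot R) → RTuple D R)
    (m : Multiset (RTuple D R)) : Prop where
  flag : ∀ y, flagAt s R y = flagConst N true ↔ y ∈ F
  attr : ∀ y ∈ F, ∀ k, C.rel _ (τ y k) (attrAt s R k y)
  eq : m = F.val.map τ

/-- The arrays describe the repository instance `r`. -/
def RepoSim (r : RepoInst D) : Prop := ∀ R, ∃ F τ, RelSim C s R F τ (r R)

variable {C s}

theorem holds_holdsAt {R : D.Repo} (ev : (σ : TSort D) → IV σ → Idx σ)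
    (d : (S : RSrt D) → DV S → N.carrier S) (hat : At → Prop) (e : IV (.slot R))
    (u : (k : Fin (D.repoArity R)) → DTerm D IV DV (D.repoTy R k)) :
    QF.Holds N (AVar.eval s ev d) hat (holdsAt e u) ↔
      flagAt s R (ev _ e) = flagConst N true ∧
        ∀ k, attrAt s R k (ev _ e) = (u k).eval N (AVar.eval s ev d) := QF.holds_and

theorem RelSim.holds_iff {R : D.Repo} {F : Finset (Idx (.slot R))}
    {τ : Idx (.slot R) → RTuple D R} {m : Multiset (RTuple D R)} (h : RelSim C s R F τ m)
    {u : RTuple D R} {n : (k : Fin (D.repoArity R)) → Elem N (RSrt.data (D.repoTy R k))}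
    (hu : ∀ k, C.rel _ (u k) (n k)) (y : Idx (.slot R)) :
    (flagAt s R y = flagConst N true ∧ ∀ k, attrAt s R k y = n k) ↔
      y ∈ F ∧ τ y = u := by
  rw [h.flag]
  refine and_congr_right fun hy => ?_
  rw [funext_iff]
  exact forall_congr' fun k => (C.eq_iff (h.attr y hy k) (hu k)).symm

theorem RelSim.mem_iff {R : D.Repo} {F : Finset (Idx (.slot R))}
    {τ : Idx (.slot R) → RTuple D R} {m : Multiset (RTuple D R)} (h : RelSim C s R F τ m)
    {u : RTuple D R} {n : (k : Fin (D.repoArity R)) → Elem N (RSrt.data (D.repoTy R k))}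
    (hu : ∀ k, C.rel _ (u k) (n k)) :
    u ∈ m ↔ ∃ y, flagAt s R y = flagConst N true ∧ ∀ k, attrAt s R k y = n k := by
  rw [h.eq, Multiset.mem_map]
  exact exists_congr fun y => (h.holds_iff hu y).symm

theorem holds_nrepo {θ : (S : D.Ty) → V S → DTerm D IV DV S}
    {ν : (S : D.Ty) → V S → D.dom S} {r : RepoInst D} (hr : RepoSim C s r)
    (ev : (σ : TSort D) → IV σ → Idx σ) (d : (S : RSrt D) → DV S → N.carrier S)
    (h : C.ValRel (AVar.eval s ev d) θ ν) (e : (R : D.Repo) → IV (.slot R)) (R : D.Repo)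
    (u : RTerms D V R) :
    GForm.Holds s ev d ((Lit.nrepo R u).tr θ e) ↔ (Lit.nrepo R u).Holds I r ν := by
  obtain ⟨F, τ, hF⟩ := hr R
  have key := hF.mem_iff (u := fun k => (u k).eval ν) (fun k => Tm.rel_tr h (u k))
  show (∀ j, ¬ _) ↔ ¬ _
  rw [key, not_exists]
  refine forall_congr' fun j => not_congr ?_
  exact (holds_holdsAt _ _ _ _ _).trans (and_congr_right fun _ => forall_congr' fun k =>
    iff_of_eq (congrArg (Eq _) (ATerm.eval_shift s ev d j _)))

theorem Lit.holds_of_tr {θ : (S : D.Ty) → V S → DTerm D IV DV S}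
    {ν : (S : D.Ty) → V S → D.dom S} {r : RepoInst D} (hr : RepoSim C s r)
    (ev : (σ : TSort D) → IV σ → Idx σ) (d : (S : RSrt D) → DV S → N.carrier S)
    (h : C.ValRel (AVar.eval s ev d) θ ν) (e : (R : D.Repo) → IV (.slot R)) (l : Lit D V)
    (hl : GForm.Holds s ev d (l.tr θ e)) : l.Holds I r ν := by
  cases l with
  | base l => exact (CLit.holds_tr h _ l).1 hl
  | repo R u =>
    obtain ⟨F, τ, hF⟩ := hr R
    exact (hF.mem_iff (fun k => Tm.rel_tr h (u k))).2 ⟨_, (holds_holdsAt _ _ _ _ _).1 hl⟩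
  | nrepo R u => exact (holds_nrepo hr ev d h e R u).1 hl

/-- The index variable of a literal that holds can be chosen such that the translation holds. -/
theorem Lit.exists_entry [hne : ∀ σ, Nonempty (Idx σ)] {ν : (S : D.Ty) → V S → D.dom S}
    {r : RepoInst D} (hr : RepoSim C s r) (l : Lit D V) (hl : l.Holds I r ν) :
    ∃ y : (R : D.Repo) → Idx (.slot R), ∀ (IV : TSort D → Type) (DV : RSrt D → Type)
      (θ : (S : D.Ty) → V S → DTerm D IV DV S) (ev : (σ : TSort D) → IV σ → Idx σ)
      (d : (S : RSrt D) → DV S → N.carrier S) (_ : C.ValRel (AVar.eval s ev d) θ ν)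
      (e : (R : D.Repo) → IV (.slot R)) (_ : ∀ R, ev _ (e R) = y R),
      GForm.Holds s ev d (l.tr θ e) := by
  classical
  cases l with
  | base l =>
    exact ⟨fun R => (hne _).some, fun IV DV θ ev d h e _ => (CLit.holds_tr h _ l).2 hl⟩
  | nrepo R u =>
    exact ⟨fun R => (hne _).some, fun IV DV θ ev d h e _ => (holds_nrepo hr ev d h e R u).2 hl⟩
  | repo R u =>
    obtain ⟨F, τ, hF⟩ := hr R
    have hl' : (fun k => (u k).eval ν) ∈ r R := hl
    rw [hF.eq, Multiset.mem_map] at hl'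
    obtain ⟨y, hy, hyu⟩ := hl'
    refine ⟨Function.update (fun R => (hne _).some) R y, fun IV DV θ ev d h e he => ?_⟩
    refine (holds_holdsAt _ _ _ _ _).2 ?_
    have heR := he R
    rw [Function.update_self] at heR
    rw [heR]
    exact (hF.holds_iff (fun k => Tm.rel_tr h (u k)) y).2 ⟨hy, hyu⟩

/-- The values of the normal variables correspond to those of the data variables. -/
def Corr.NormRel (C : Corr I N) {Γ : Ctx D.Ty} (d : (S : RSrt D) → (dataCtx Γ).Var S → N.carrier S)
    (ν : (S : D.Ty) → Γ.Var S → D.dom S) : Prop :=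
  ∀ k, C.rel _ (ν _ (.mk k)) (d _ (Ctx.Var.mk (Γ := dataCtx Γ) k))

variable {Γ : Ctx D.Ty} {d : (S : RSrt D) → (dataCtx Γ).Var S → N.carrier S}
  {ν : (S : D.Ty) → Γ.Var S → D.dom S}

theorem Corr.NormRel.valRel (h : C.NormRel d ν) (ev : (σ : TSort D) → IV σ → Idx σ) :
    C.ValRel (AVar.eval s ev d) trNorm ν := by
  rintro _ ⟨k⟩
  exact h k

theorem Corr.NormRel.ref (h : C.NormRel d ν) (S : D.Ty) (v : Γ.Var S) : I.Ref S (ν S v) := by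
  cases v with
  | mk k => exact C.ref (h k)

theorem CaseSim.valRel {i : IV .pi} {ev : (σ : TSort D) → IV σ → Idx σ} {id : D.dom D.ctype}
    {c : CaseState D} (h : CaseSim C s (ev _ i) id c) (d : (S : RSrt D) → DV S → N.carrier S) :
    C.ValRel (AVar.eval s ev d) (trCV i) (c.val id) := by
  rintro _ (_ | x)
  · exact h.self
  · exact h.cv x

theorem Corr.ValRel.sumElim {W : D.Ty → Type} {w : (S : RSrt D) → AVar D.art IV DV S → N.carrier S}
    {θ : (S : D.Ty) → V S → DTerm D IV DV S} {ν : (S : D.Ty) → V S → D.dom S}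
    {θ' : (S : D.Ty) → W S → DTerm D IV DV S} {ν' : (S : D.Ty) → W S → D.dom S}
    (h : C.ValRel w θ ν) (h' : C.ValRel w θ' ν') :
    C.ValRel w (fun S => Sum.elim (θ S) (θ' S)) (fun S => Sum.elim (ν S) (ν' S)) := by
  rintro S (v | v)
  · exact h S v
  · exact h' S v

theorem Corr.exists_norm (C : Corr I N)
    (hd : ∀ S (v : (dataCtx Γ).Var (RSrt.data S)), ∃ u, C.rel S u (d _ v)) :
    ∃ ν : (S : D.Ty) → Γ.Var S → D.dom S, C.NormRel d ν := by
  choose f hf using hd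
  exact ⟨fun S v => match v with | .mk k => f _ (Ctx.Var.mk (Γ := dataCtx Γ) k),
    fun k => hf _ _⟩

theorem Corr.exists_data (C : Corr I N) {Γ : Ctx D.Ty} {ν : (S : D.Ty) → Γ.Var S → D.dom S}
    (h : ∀ S v, ∃ n, C.rel S (ν S v) n) :
    ∃ d : (S : RSrt D) → (dataCtx Γ).Var S → N.carrier S, C.NormRel d ν := by
  choose f hf using h
  exact ⟨fun S v => match v with | .mk k => f _ (Ctx.Var.mk (Γ := Γ) k), fun k => hf _ _⟩

theorem Guard.answer_of_tr (g : Guard D Γ) {r : RepoInst D} (hr : RepoSim C s r)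
    (ev : (σ : TSort D) → TIV D g.Pos σ → Idx σ) (hd : C.NormRel d ν) {id : D.dom D.ctype}
    {c : CaseState D} (hc : CaseSim C s (ev _ (vPi D g.Pos)) id c)
    (h : GForm.Holds s ev d (Guard.tr g)) : g.Answer I r (c.val id) ν := by
  obtain ⟨i, hi⟩ := h
  exact ⟨hd.ref, i, fun j =>
    Lit.holds_of_tr hr ev d ((hd.valRel ev).sumElim (hc.valRel d)) _ _ (hi j)⟩

theorem Guard.exists_entries [hne : ∀ σ, Nonempty (Idx σ)] (g : Guard D Γ) {r : RepoInst D}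
    (hr : RepoSim C s r) (hd : C.NormRel d ν) {κ : (S : D.Ty) → CV D S → D.dom S}
    (h : g.Answer I r κ ν) :
    ∃ y : (R : D.Repo) → g.Pos → Idx (.slot R),
      ∀ ev : (σ : TSort D) → TIV D g.Pos σ → Idx σ, (∀ R p, ev _ (vLit D p R) = y R p) →
        C.ValRel (AVar.eval s ev d) (trCV (vPi D g.Pos)) κ → GForm.Holds s ev d (Guard.tr g) := by
  obtain ⟨-, i, hi⟩ := h
  have := fun j => Lit.exists_entry hr _ (hi j)
  choose y hy using this
  classical
  refine ⟨fun R p => if hp : p.1 = i then y (hp ▸ p.2) R else (hne _).some,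
    fun ev hev hκ => ⟨i, fun j => hy j _ _ _ ev d ((hd.valRel ev).sumElim hκ) _ fun R => ?_⟩⟩
  rw [hev]
  simp

end States

/-! ## Simulation of the steps -/

section CaseTerms

variable {Sg : DBSig} {A : ArtExt Sg} {IV : A.ASrt → Type} {DV : Sg.Srt → Type} {S : Sg.Srt}
  {M : DBModel Sg} {Idx : A.ASrt → Type} {s : AState A M Idx} {e : (σ : A.ASrt) → IV σ → Idx σ}
  {d : (S : Sg.Srt) → DV S → M.carrier S} {κ : AForm A IV DV} {t u : CaseTerm A IV DV S}

theorem CaseTerm.eval_ite_pos (h : AForm.Holds s e d κ) :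
    (CaseTerm.ite κ t u).eval s e d = t.eval s e d := if_pos h

theorem CaseTerm.eval_ite_neg (h : ¬ AForm.Holds s e d κ) :
    (CaseTerm.ite κ t u).eval s e d = u.eval s e d := if_neg h

end CaseTerms

section Effects

variable {D : DataSchema} {I : CatInst D} {N : DBModel D.sig} {C : Corr I N}
  {Idx : TSort D → Type} {s s' : AState D.art N Idx} {P : Type} [Finite P] {Γ : Ctx D.Ty}
  {ev : (σ : TSort D) → TIV D P σ → Idx σ} {d : (S : RSrt D) → (dataCtx Γ).Var S → N.carrier S}
  {ν : (S : D.Ty) → Γ.Var S → D.dom S}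

theorem eval_setCV_of_ne (σ : SetRule D Γ) (x : D.CVar) {j : Idx .pi}
    (hj : j ≠ ev _ (vPi D P)) :
    (setCV σ x).eval s (Snoc.elim j ev) d = cvAt s x j := by
  unfold setCV SetRule.tr
  generalize σ x = o
  cases o with
  | none => rfl
  | some t => exact CaseTerm.eval_ite_neg hj

theorem rel_setCV (hd : C.NormRel d ν) (σ : SetRule D Γ) (x : D.CVar)
    {old : (x : D.CVar) → D.dom (D.cvTy x)}
    (hold : C.rel _ (old x) (cvAt s x (ev _ (vPi D P)))) :
    C.rel _ (σ.apply ν old x) ((setCV σ x).eval s (Snoc.elim (ev _ (vPi D P)) ev) d) := by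
  unfold setCV SetRule.tr SetRule.apply
  generalize σ x = o
  cases o with
  | none => exact hold
  | some t =>
    have h : C.rel _ (t.eval ν) ((t.tr trNorm).eval N
        (AVar.eval s (Snoc.elim (σ := TSort.pi) (ev _ (vPi D P)) ev) d)) :=
      Tm.rel_tr (hd.valRel _) t
    have h' := CaseTerm.eval_ite_pos (s := s)
      (e := Snoc.elim (σ := TSort.pi) (ev _ (vPi D P)) ev) (d := d)
      (κ := idxEq (σ := TSort.pi) .new (.old (vPi D P))) (t := .term (t.tr trNorm))
      (u := keep D P Γ (.cv x)) rfl
    exact h'.symm ▸ h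

theorem RelSim.congr {R : D.Repo} {F : Finset (Idx (.slot R))} {τ : Idx (.slot R) → RTuple D R}
    {m : Multiset (RTuple D R)} (h : RelSim C s R F τ m) (hf : ∀ y, flagAt s' R y = flagAt s R y)
    (ha : ∀ k y, attrAt s' R k y = attrAt s R k y) : RelSim C s' R F τ m :=
  ⟨fun y => by rw [hf, h.flag], fun y hy k => by rw [ha]; exact h.attr y hy k, h.eq⟩

open Classical in
theorem RelSim.insert {R : D.Repo} {G : Finset (Idx (.slot R))} {τ : Idx (.slot R) → RTuple D R}
    {u : RTuple D R} {y₀ : Idx (.slot R)} (hy₀ : y₀ ∉ G)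
    (hf : ∀ y, flagAt s R y = flagConst N true ↔ y = y₀ ∨ y ∈ G)
    (h₀ : ∀ k, C.rel _ (u k) (attrAt s R k y₀))
    (hG : ∀ y ∈ G, ∀ k, C.rel _ (τ y k) (attrAt s R k y)) :
    RelSim C s R (insert y₀ G) (Function.update τ y₀ u) (u ::ₘ G.val.map τ) := by
  have hne : ∀ y ∈ G, Function.update τ y₀ u y = τ y := fun y hy =>
    Function.update_of_ne (by rintro rfl; exact hy₀ hy) _ _
  refine ⟨fun y => by rw [hf, Finset.mem_insert], fun y hy k => ?_, ?_⟩
  · rcases Finset.mem_insert.1 hy with rfl | hy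
    · rw [Function.update_self]; exact h₀ k
    · rw [hne y hy]; exact hG y hy k
  · rw [Finset.insert_val_of_notMem hy₀, Multiset.map_cons, Function.update_self]
    exact congrArg _ (Multiset.map_congr rfl fun y hy => (hne y hy).symm)

open Classical in
theorem RelSim.erase {R : D.Repo} {F : Finset (Idx (.slot R))} {τ : Idx (.slot R) → RTuple D R}
    {m : Multiset (RTuple D R)} (h : RelSim C s R F τ m) {y₀ : Idx (.slot R)} (hy₀ : y₀ ∈ F)
    (hf₀ : flagAt s' R y₀ = flagConst N false)
    (hf : ∀ y ≠ y₀, flagAt s' R y = flagAt s R y)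
    (ha : ∀ k, ∀ y ≠ y₀, attrAt s' R k y = attrAt s R k y) :
    RelSim C s' R (F.erase y₀) τ (m.erase (τ y₀)) := by
  refine ⟨fun y => ?_, fun y hy k => ?_, ?_⟩
  · rw [Finset.mem_erase]
    by_cases hy : y = y₀
    · subst hy
      rw [hf₀, (flagConst_injective N).eq_iff]
      simp
    · rw [hf y hy, h.flag]
      simp [hy]
  · rw [Finset.mem_erase] at hy
    rw [ha k y hy.1]
    exact h.attr y hy.2 k
  · rw [h.eq, Finset.erase_val, ← Multiset.map_erase_of_mem _ _ (Finset.mem_def.1 hy₀)]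

theorem holds_agrees (hd : C.NormRel d ν) {R : D.Repo} {F : Finset (Idx (.slot R))}
    {τ : Idx (.slot R) → RTuple D R} {m : Multiset (RTuple D R)} (h : RelSim C s R F τ m)
    (K : Finset (Fin (D.repoArity R))) (u : RTerms D Γ.Var R) (y : Idx (.slot R)) :
    AForm.Holds s (Snoc.elim y ev) d (agrees K u) ↔
      y ∈ F ∧ ∀ k ∈ K, τ y k = (u k).eval ν := by
  refine QF.holds_and.trans ?_
  rw [← h.flag]
  refine and_congr_right fun hy => forall_congr' fun k => ?_
  have hk := C.eq_iff (h.attr y ((h.flag y).1 hy) k) (Tm.rel_tr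
    (hd.valRel (s := s) (Snoc.elim (σ := TSort.slot R) (V := TIV D P) y ev)) (u k))
  by_cases hK : k ∈ K
  · simp only [hK, if_true, true_imp_iff]
    exact hk.symm
  · simp only [hK, if_false, false_imp_iff, iff_true]
    exact QF.holds_top

theorem rel_CUpd (hd : C.NormRel d ν) {id : D.dom D.ctype} {c : CaseState D}
    (hc : CaseSim C s (ev _ (vPi D P)) id c) {R : D.Repo} {y : Idx (.slot R)} {t : RTuple D R}
    (ht : ∀ k, C.rel _ (t k) (attrAt s R k y)) (k : Fin (D.repoArity R)) (η : CUpd D Γ R) :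
    C.rel _ (η.apply I ν (c.val id) t k)
      ((CUpd.tr (P := P) k η).eval s (Snoc.elim y ev) d) := by
  have htv : C.ValRel (AVar.eval s (Snoc.elim (σ := TSort.slot R) (V := TIV D P) y ev) d)
      (trTVar .new) (TVar.val t) := by
    rintro _ ⟨k⟩
    exact ht k
  have hn : C.ValRel (AVar.eval s (Snoc.elim (σ := TSort.slot R) (V := TIV D P) y ev) d)
      trNorm ν := hd.valRel _
  have hcv : C.ValRel (AVar.eval s (Snoc.elim (σ := TSort.slot R) (V := TIV D P) y ev) d)
      (trCV (Snoc.old (vPi D P))) (c.val id) :=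
    CaseSim.valRel (i := Snoc.old (vPi D P)) hc d
  induction η with
  | leaf u => exact Tm.rel_tr (hn.sumElim htv) (u k)
  | ite ψ η₁ η₂ ih₁ ih₂ =>
    have hψ : AForm.Holds s (Snoc.elim (σ := TSort.slot R) (V := TIV D P) y ev) d
        (DNF.tr (IV := Snoc (.slot R) (TIV D P)) ψ fun _ _ l => l.tr (fun S =>
          Sum.elim (Sum.elim (trNorm S) (trCV (.old (vPi D P)) S)) (trTVar .new S))) ↔
        ψ.Holds (CLit.Holds I (fun S => Sum.elim (Sum.elim (ν S) (c.val id S)) (TVar.val t S))) :=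
      exists_congr fun i => forall_congr' fun j => CLit.holds_tr ((hn.sumElim hcv).sumElim htv) _ _
    by_cases h : ψ.Holds
        (CLit.Holds I (fun S => Sum.elim (Sum.elim (ν S) (c.val id S)) (TVar.val t S)))
    · have e₁ : (CUpd.ite ψ η₁ η₂).apply I ν (c.val id) t = η₁.apply I ν (c.val id) t := if_pos h
      rw [e₁]
      exact (CaseTerm.eval_ite_pos (t := CUpd.tr (P := P) k η₁) (u := CUpd.tr k η₂)
        (hψ.2 h)).symm ▸ ih₁
    · have e₁ : (CUpd.ite ψ η₁ η₂).apply I ν (c.val id) t = η₂.apply I ν (c.val id) t := if_neg h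
      rw [e₁]
      exact (CaseTerm.eval_ite_neg (t := CUpd.tr (P := P) k η₁) (u := CUpd.tr k η₂)
        (fun h' => h (hψ.1 h'))).symm ▸ ih₂

/-- The relations that an effect rule does not touch. -/
theorem RepoSim.update {r : RepoInst D} (hr : RepoSim C s r) {R' : D.Repo}
    {m : Multiset (RTuple D R')} [DecidableEq D.Repo] (hR' : ∃ F τ, RelSim C s' R' F τ m)
    (hf : ∀ R ≠ R', ∀ y, flagAt s' R y = flagAt s R y)
    (ha : ∀ R ≠ R', ∀ k y, attrAt s' R k y = attrAt s R k y) :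
    RepoSim C s' (Function.update r R' m) := by
  intro R
  by_cases h : R = R'
  · subst h
    rw [Function.update_self]
    exact hR'
  · rw [Function.update_of_ne h]
    obtain ⟨F, τ, hF⟩ := hr R
    exact ⟨F, τ, hF.congr (hf R h) (ha R h)⟩

theorem RelSim.mem_of_holdsAt (hd : C.NormRel d ν) {R : D.Repo} {F : Finset (Idx (.slot R))}
    {τ : Idx (.slot R) → RTuple D R} {m : Multiset (RTuple D R)} (h : RelSim C s R F τ m)
    {u : RTerms D Γ.Var R} (hat : GAtom D.art (TIV D P) (dataCtx Γ).Var → Prop) :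
    QF.Holds N (AVar.eval s ev d) hat (holdsAt (vEff D P R) (fun k => (u k).tr trNorm)) ↔
      ev _ (vEff D P R) ∈ F ∧ τ (ev _ (vEff D P R)) = fun k => (u k).eval ν :=
  (holds_holdsAt _ _ _ _ _).trans (h.holds_iff (fun k => Tm.rel_tr (hd.valRel ev) (u k)) _)

open Classical in
theorem insert_sim (sem : InsertionSemantics D) (hd : C.NormRel d ν) {R : D.Repo}
    {u : RTerms D Γ.Var R} {F : Finset (Idx (.slot R))} {τ : Idx (.slot R) → RTuple D R}
    {m : Multiset (RTuple D R)} (h : RelSim C s R F τ m)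
    (hfree : flagAt s R (ev _ (vEff D P R)) = flagConst N false)
    (hf : ∀ y, flagAt s' R y = (insFlag sem u).eval s (Snoc.elim y ev) d)
    (ha : ∀ k y, attrAt s' R k y = (insAttr sem u k).eval s (Snoc.elim y ev) d) :
    ∃ F τ, RelSim C s' R F τ (sem.insert R (fun k => (u k).eval ν) m) := by
  have hy₀ : ev _ (vEff D P R) ∉ F := by
    rw [← h.flag, hfree, (flagConst_injective N).eq_iff]
    simp
  have hf₀ : flagAt s' R (ev _ (vEff D P R)) = flagConst N true :=
    (hf _).trans (CaseTerm.eval_ite_pos rfl)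
  have ha₀ : ∀ k, C.rel _ ((u k).eval ν) (attrAt s' R k (ev _ (vEff D P R))) := by
    intro k
    rw [(ha k _).trans (CaseTerm.eval_ite_pos rfl)]
    exact Tm.rel_tr (hd.valRel _) (u k)
  cases sem with
  | multiset =>
    have hf' : ∀ y ≠ ev _ (vEff D P R), flagAt s' R y = flagAt s R y :=
      fun y hy => (hf y).trans (CaseTerm.eval_ite_neg hy)
    have ha' : ∀ k, ∀ y ≠ ev _ (vEff D P R), attrAt s' R k y = attrAt s R k y :=
      fun k y hy => (ha k y).trans (CaseTerm.eval_ite_neg hy)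
    have key := RelSim.insert (C := C) (s := s') (G := F) (τ := τ) hy₀ (fun y => by
        by_cases hy : y = ev _ (vEff D P R)
        · subst hy; simp [hf₀]
        · rw [hf' y hy, h.flag]; simp [hy]) ha₀ (fun y hy k => by
        rw [ha' k y (by rintro rfl; exact hy₀ hy)]; exact h.attr y hy k)
    rw [← h.eq] at key
    exact ⟨_, _, key⟩
  | set K =>
    have hag : ∀ y, AForm.Holds s (Snoc.elim y ev) d (agrees (P := P) (K R) u) ↔
      y ∈ F ∧ ∀ k ∈ K R, τ y k = (u k).eval ν := holds_agrees hd h (K R) u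
    have hf₁ : ∀ y ≠ ev _ (vEff D P R), flagAt s' R y = CaseTerm.eval s (Snoc.elim y ev) d
        (.ite (agrees (K R) u) (flagTm (P := P) false) (keep D P Γ (.flag R))) :=
      fun y hy => (hf y).trans (CaseTerm.eval_ite_neg hy)
    have ha₁ : ∀ k, ∀ y ≠ ev _ (vEff D P R), attrAt s' R k y = CaseTerm.eval s (Snoc.elim y ev) d
        (.ite (agrees (K R) u) (.term (undefTm _)) (keep D P Γ (.attr R k))) :=
      fun k y hy => (ha k y).trans (CaseTerm.eval_ite_neg hy)
    have hf' : ∀ y ≠ ev _ (vEff D P R), ¬ (y ∈ F ∧ ∀ k ∈ K R, τ y k = (u k).eval ν) →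
        flagAt s' R y = flagAt s R y := fun y hy hn =>
      (hf₁ y hy).trans (CaseTerm.eval_ite_neg (mt (hag y).1 hn))
    have hf'' : ∀ y ≠ ev _ (vEff D P R), (y ∈ F ∧ ∀ k ∈ K R, τ y k = (u k).eval ν) →
        flagAt s' R y = flagConst N false := fun y hy hn =>
      (hf₁ y hy).trans (CaseTerm.eval_ite_pos ((hag y).2 hn))
    have ha' : ∀ k, ∀ y ≠ ev _ (vEff D P R), ¬ (y ∈ F ∧ ∀ k ∈ K R, τ y k = (u k).eval ν) →
        attrAt s' R k y = attrAt s R k y := fun k y hy hn =>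
      (ha₁ k y hy).trans (CaseTerm.eval_ite_neg (mt (hag y).1 hn))
    have key := RelSim.insert (C := C) (s := s')
      (G := F.filter (fun y => ¬ ∀ k ∈ K R, τ y k = (u k).eval ν)) (τ := τ)
      (fun h' => hy₀ (Finset.mem_filter.1 h').1) (fun y => by
        by_cases hy : y = ev _ (vEff D P R)
        · subst hy; simp [hf₀]
        · by_cases hn : y ∈ F ∧ ∀ k ∈ K R, τ y k = (u k).eval ν
          · rw [hf'' y hy hn, (flagConst_injective N).eq_iff, Finset.mem_filter]
            simp only [hy, false_or, Bool.false_eq_true, false_iff]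
            exact fun h => h.2 hn.2
          · rw [hf' y hy hn, h.flag, Finset.mem_filter]
            simp only [hy, false_or]
            exact ⟨fun hF => ⟨hF, fun h' => hn ⟨hF, h'⟩⟩, fun h => h.1⟩) ha₀ (fun y hy k => by
        obtain ⟨hF, hn⟩ := Finset.mem_filter.1 hy
        rw [ha' k y (by rintro rfl; exact hy₀ hF) (fun h => hn h.2)]
        exact h.attr y hF k)
    have hm : (InsertionSemantics.set K).insert R (fun k => (u k).eval ν) m =
        (fun k => (u k).eval ν) ::ₘ
          (F.filter (fun y => ¬ ∀ k ∈ K R, τ y k = (u k).eval ν)).val.map τ := by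
      show _ ::ₘ _ = _
      rw [h.eq, Multiset.filter_map, Finset.filter_val]
      rfl
    exact ⟨_, _, hm.symm ▸ key⟩

/-- The components of the state after a step that are determined by an effect rule. -/
structure EffectSim (C : Corr I N) (s s' : AState D.art N Idx) (i : Idx .pi)
    (v' : (x : D.CVar) → D.dom (D.cvTy x)) (r' : RepoInst D) : Prop where
  cv : ∀ x, C.rel _ (v' x) (cvAt s' x i)
  other : ∀ x, ∀ j ≠ i, cvAt s' x j = cvAt s x j
  repo : RepoSim C s' r'

open Classical in
theorem effect_sim (sem : InsertionSemantics D) (η : Effect D Γ) (hd : C.NormRel d ν)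
    {id : D.dom D.ctype} {c : CaseState D} (hc : CaseSim C s (ev _ (vPi D P)) id c)
    {r : RepoInst D} (hr : RepoSim C s r) (hg : GForm.Holds s ev d (η.trGuard (P := P)))
    (hcv : ∀ x j, cvAt s' x j = (η.tr sem (.cv x)).eval s (Snoc.elim j ev) d)
    (hf : ∀ R y, flagAt s' R y = (η.tr sem (.flag R)).eval s (Snoc.elim y ev) d)
    (ha : ∀ R k y, attrAt s' R k y = (η.tr sem (.attr R k)).eval s (Snoc.elim y ev) d) :
    ∃ v' r', η.Apply sem I ν (c.val id) c.cv r v' r' ∧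
      EffectSim C s s' (ev _ (vPi D P)) v' r' := by
  have hset : ∀ σ : SetRule D Γ,
      (∀ x j, cvAt s' x j = (setCV σ x).eval s (Snoc.elim j ev) d) →
      (∀ x, C.rel _ (σ.apply ν c.cv x) (cvAt s' x (ev _ (vPi D P)))) ∧
      ∀ x, ∀ j ≠ ev _ (vPi D P), cvAt s' x j = cvAt s x j := by
    refine fun σ h => ⟨fun x => ?_, fun x j hj => (h x j).trans (eval_setCV_of_ne σ x hj)⟩
    rw [h x]
    exact rel_setCV hd σ x (hc.cv x)
  cases η with
  | set σ =>
    obtain ⟨h₁, h₂⟩ := hset σ hcv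
    refine ⟨_, _, ⟨rfl, rfl⟩, h₁, h₂, fun R => ?_⟩
    obtain ⟨F, τ, h⟩ := hr R
    exact ⟨F, τ, h.congr (hf R) (ha R)⟩
  | insertSet R u σ =>
    obtain ⟨h₁, h₂⟩ := hset σ hcv
    obtain ⟨F, τ, h⟩ := hr R
    refine ⟨_, _, ⟨rfl, rfl⟩, h₁, h₂, hr.update ?_ (fun R' hR' y => ?_) (fun R' hR' k y => ?_)⟩
    · have e₁ : (Effect.insertSet R u σ).tr (P := P) sem (.flag R) = insFlag sem u := dif_pos rfl
      have e₂ : ∀ k, (Effect.insertSet R u σ).tr (P := P) sem (.attr R k) = insAttr sem u k :=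
        fun k => dif_pos rfl
      exact insert_sim sem hd h hg (fun y => (hf R y).trans (congrArg _ e₁))
        (fun k y => (ha R k y).trans (congrArg _ (e₂ k)))
    · have e₁ : (Effect.insertSet R u σ).tr (P := P) sem (.flag R') = keep D P Γ (.flag R') :=
        dif_neg hR'
      exact (hf R' y).trans (congrArg _ e₁)
    · have e₁ : (Effect.insertSet R u σ).tr (P := P) sem (.attr R' k) = keep D P Γ (.attr R' k) :=
        dif_neg hR'
      exact (ha R' k y).trans (congrArg _ e₁)
  | deleteSet R u σ =>
    obtain ⟨h₁, h₂⟩ := hset σ hcv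
    obtain ⟨F, τ, h⟩ := hr R
    obtain ⟨hy, hu⟩ := (h.mem_of_holdsAt hd _).1 hg
    refine ⟨_, _, ⟨?_, rfl, rfl⟩, h₁, h₂,
      hr.update ?_ (fun R' hR' y => ?_) (fun R' hR' k y => ?_)⟩
    · rw [h.eq, Multiset.mem_map]
      exact ⟨_, hy, hu⟩
    · have e₁ : (Effect.deleteSet R u σ).tr (P := P) sem (.flag R) =
          .ite (idxEq (σ := TSort.slot R) .new (.old (vEff D P R)))
            (flagTm false) (keep D P Γ (.flag R)) := if_pos rfl
      have e₂ : ∀ k, (Effect.deleteSet R u σ).tr (P := P) sem (.attr R k) =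
          .ite (idxEq (σ := TSort.slot R) .new (.old (vEff D P R)))
            (.term (undefTm _)) (keep D P Γ (.attr R k)) := fun k => if_pos rfl
      have hf' := fun y => (hf R y).trans (congrArg _ e₁)
      have ha' := fun k y => (ha R k y).trans (congrArg _ (e₂ k))
      rw [← hu]
      exact ⟨_, _, h.erase hy ((hf' _).trans (CaseTerm.eval_ite_pos rfl))
        (fun y hy => (hf' y).trans (CaseTerm.eval_ite_neg hy))
        (fun k y hy => (ha' k y).trans (CaseTerm.eval_ite_neg hy))⟩
    · have e₁ : (Effect.deleteSet R u σ).tr (P := P) sem (.flag R') = keep D P Γ (.flag R') :=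
        if_neg hR'
      exact (hf R' y).trans (congrArg _ e₁)
    · have e₁ : (Effect.deleteSet R u σ).tr (P := P) sem (.attr R' k) = keep D P Γ (.attr R' k) :=
        if_neg hR'
      exact (ha R' k y).trans (congrArg _ e₁)
  | update R η =>
    obtain ⟨F, τ, h⟩ := hr R
    refine ⟨_, _, ⟨rfl, rfl⟩, fun x => ?_, fun x j _ => hcv x j,
      hr.update ?_ (fun R' hR' y => ?_) (fun R' hR' k y => ?_)⟩
    · rw [hcv x]
      exact hc.cv x
    · have e₂ : ∀ k, (Effect.update R η).tr (P := P) sem (.attr R k) =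
          .ite (flagIs .new true) (CUpd.tr k η) (keep D P Γ (.attr R k)) := fun k => dif_pos rfl
      refine ⟨F, fun y => η.apply I ν (c.val id) (τ y), fun y => ?_, fun y hy k => ?_, ?_⟩
      · rw [hf R y]
        exact h.flag y
      · have := rel_CUpd (P := P) hd hc (h.attr y hy) k η
        rw [((ha R k y).trans (congrArg _ (e₂ k))).trans
          (CaseTerm.eval_ite_pos ((h.flag y).2 hy))]
        exact this
      · rw [h.eq, Multiset.map_map]
        rfl
    · exact hf R' y
    · have e₁ : (Effect.update R η).tr (P := P) sem (.attr R' k) = keep D P Γ (.attr R' k) :=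
        dif_neg hR'
      exact (ha R' k y).trans (congrArg _ e₁)

theorem Effect.Apply.unique {sem : InsertionSemantics D} {κ : (S : D.Ty) → CV D S → D.dom S}
    {v v₁ v₂ : (x : D.CVar) → D.dom (D.cvTy x)} {r r₁ r₂ : RepoInst D} {η : Effect D Γ}
    (h₁ : η.Apply sem I ν κ v r v₁ r₁) (h₂ : η.Apply sem I ν κ v r v₂ r₂) :
    v₁ = v₂ ∧ r₁ = r₂ := by
  cases η with
  | deleteSet => exact ⟨h₁.2.1.trans h₂.2.1.symm, h₁.2.2.trans h₂.2.2.symm⟩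
  | _ => exact ⟨h₁.1.trans h₂.1.symm, h₁.2.trans h₂.2.symm⟩

/-- The entry affected by an effect rule that is applicable can be chosen such that the additional
guard holds. -/
theorem Effect.exists_entry [hinf : ∀ R, Infinite (Idx (.slot R))] {sem : InsertionSemantics D}
    {κ : (S : D.Ty) → CV D S → D.dom S} {v v' : (x : D.CVar) → D.dom (D.cvTy x)}
    {r r' : RepoInst D} {η : Effect D Γ} (h : η.Apply sem I ν κ v r v' r') (hr : RepoSim C s r)
    (hd : C.NormRel d ν) :
    ∃ y : (R : D.Repo) → Idx (.slot R), ∀ ev : (σ : TSort D) → TIV D P σ → Idx σ,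
      (∀ R, ev _ (vEff D P R) = y R) → GForm.Holds s ev d (η.trGuard (P := P)) := by
  classical
  have hne : ∀ R, Nonempty (Idx (.slot R)) := fun R => inferInstance
  cases η with
  | set σ => exact ⟨fun R => (hne R).some, fun _ _ => QF.holds_top⟩
  | update R η => exact ⟨fun R => (hne R).some, fun _ _ => QF.holds_top⟩
  | insertSet R u σ =>
    obtain ⟨F, τ, hF⟩ := hr R
    obtain ⟨y, hy⟩ := Infinite.exists_notMem_finset F
    refine ⟨Function.update (fun R => (hne R).some) R y, fun ev hev => ?_⟩
    show flagAt s R (ev _ (vEff D P R)) = flagConst N false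
    rw [hev, Function.update_self]
    obtain ⟨b, hb⟩ := flagConst_surjective N (flagAt s R y)
    cases b with
    | false => exact hb.symm
    | true => exact absurd ((hF.flag y).1 hb.symm) hy
  | deleteSet R u σ =>
    obtain ⟨F, τ, hF⟩ := hr R
    have hu := h.1
    rw [hF.eq, Multiset.mem_map] at hu
    obtain ⟨y, hy, hyu⟩ := hu
    refine ⟨Function.update (fun R => (hne R).some) R y, fun ev hev => ?_⟩
    refine (hF.mem_of_holdsAt hd _).2 ?_
    rw [hev, Function.update_self]
    exact ⟨hy, hyu⟩

end Effects

section Rules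

variable {D : DataSchema} {I : CatInst D} {N : DBModel D.sig} {C : Corr I N}
  {Idx : TSort D → Type} {s s' : AState D.art N Idx}

/-- The step from `s` to `s'` advances the process instance `i`, which describes the case `id`, to
the entry `c'`, and changes the repository to `r'`. -/
structure StepSim (C : Corr I N) (s s' : AState D.art N Idx) (i : Idx .pi) (id : D.dom D.ctype)
    (c' : CaseState D) (r' : RepoInst D) : Prop where
  self : ∀ j, selfAt s' j = selfAt s j
  cv : ∀ x, ∀ j ≠ i, cvAt s' x j = cvAt s x j
  pend : ∀ a x, ∀ j ≠ i, pendAt s' a x j = pendAt s a x j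
  life : ∀ b, ∀ j ≠ i, lifeAt s' b j = lifeAt s b j
  case : CaseSim C s' i id c'
  repo : RepoSim C s' r'

/-- The lifecycle states after a rule. -/
def Rule.newLife (ρ : Rule D) (c : CaseState D) (b : Addr) : LState :=
  (ρ.post.lookup b).getD (c.life b)

section Control

variable {P : Type} [Finite P] {Γ : Ctx D.Ty} {ρ : Rule D}
  {ev : (σ : TSort D) → TIV D P σ → Idx σ} {d : (S : RSrt D) → (dataCtx Γ).Var S → N.carrier S}
  {g : DGuard D (TIV D P) (dataCtx Γ).Var} {u : (a : TArr D) → TCase D P Γ a}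

theorem mkTrans_guard {id : D.dom D.ctype} {c : CaseState D}
    (hc : CaseSim C s (ev _ (vPi D P)) id c) :
    GForm.Holds s ev d (mkTrans ρ g u).guard ↔
      (∀ p ∈ ρ.pre, c.life p.1 = p.2) ∧ GForm.Holds s ev d g := by
  refine QF.holds_and.trans (and_congr_left fun _ => ?_)
  rw [List.forall_mem_iff_getElem]
  constructor
  · intro h k hk
    exact lifeConst_injective N ((hc.life _).symm.trans (h ⟨k, hk⟩))
  · intro h k
    exact (hc.life _).trans (congrArg (lifeConst N) (h k.1 k.2))

theorem lifeAt_mkTrans_of_ne {b : Addr} {j : Idx .pi} (hj : j ≠ ev _ (vPi D P)) :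
    ((mkTrans ρ g u).upd (.life b)).eval s (Snoc.elim j ev) d = lifeAt s b j := by
  have : (mkTrans ρ g u).upd (.life b) = match ρ.post.lookup b with
      | none => keep D P Γ (.life b)
      | some st => .ite (idxEq (σ := TSort.pi) .new (.old (vPi D P)))
            (.term (.const (Sg := D.sig) (S := RSrt.life) st)) (keep D P Γ (.life b)) := rfl
  refine (congrArg (CaseTerm.eval s (Snoc.elim j ev) d) this).trans ?_
  generalize ρ.post.lookup b = o
  cases o with
  | none => rfl
  | some st => exact CaseTerm.eval_ite_neg hj

theorem lifeAt_mkTrans {id : D.dom D.ctype} {c : CaseState D}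
    (hc : CaseSim C s (ev _ (vPi D P)) id c) (b : Addr) :
    ((mkTrans ρ g u).upd (.life b)).eval s (Snoc.elim (ev _ (vPi D P)) ev) d =
      lifeConst N (ρ.newLife c b) := by
  have : (mkTrans ρ g u).upd (.life b) = match ρ.post.lookup b with
      | none => keep D P Γ (.life b)
      | some st => .ite (idxEq (σ := TSort.pi) .new (.old (vPi D P)))
            (.term (.const (Sg := D.sig) (S := RSrt.life) st)) (keep D P Γ (.life b)) := rfl
  refine (congrArg (CaseTerm.eval s (Snoc.elim (ev _ (vPi D P)) ev) d) this).trans ?_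
  unfold Rule.newLife
  generalize ρ.post.lookup b = o
  cases o with
  | none => exact hc.life b
  | some st => exact CaseTerm.eval_ite_pos rfl

/-- The state `s'` arises from `s` by the update of the transition. -/
def UpdBy (s s' : AState D.art N Idx) (τ : Transition D.art)
    (ev : (σ : TSort D) → τ.E.Var σ → Idx σ) (d : (S : RSrt D) → τ.Γ.Var S → N.carrier S) : Prop :=
  ∀ a y, s' a y = (τ.upd a).eval s (Snoc.elim y ev) d

theorem stepSim_of_keep {id : D.dom D.ctype} {c : CaseState D}
    (hc : CaseSim C s (ev _ (vPi D P)) id c) {r : RepoInst D} (hr : RepoSim C s r)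
    (hs' : UpdBy s s' (mkTrans ρ g (keep D P Γ)) ev d) :
    StepSim C s s' (ev _ (vPi D P)) id ⟨c.cv, ρ.newLife c, c.pend⟩ r where
  self j := hs' .self j
  cv x j _ := hs' (.cv x) j
  pend a x j _ := hs' (.pend a x) j
  life b j hj := (hs' (.life b) j).trans (lifeAt_mkTrans_of_ne hj)
  case :=
    { self := by
        have h : selfAt s' (ev _ (vPi D P)) = selfAt s (ev _ (vPi D P)) := hs' .self _
        rw [h]; exact hc.self
      cv := fun x => by
        have h : cvAt s' x (ev _ (vPi D P)) = cvAt s x (ev _ (vPi D P)) := hs' (.cv x) _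
        rw [h]; exact hc.cv x
      pend := fun a x => by
        have h : pendAt s' a x (ev _ (vPi D P)) = pendAt s a x (ev _ (vPi D P)) := hs' (.pend a x) _
        rw [h]; exact hc.pend a x
      life := fun b => (hs' (.life b) _).trans (lifeAt_mkTrans hc b) }
  repo R := by
    obtain ⟨F, τ, h⟩ := hr R
    exact ⟨F, τ, h.congr (fun y => hs' (.flag R) y) (fun k y => hs' (.attr R k) y)⟩

theorem stepSim_exec (sem : InsertionSemantics D) (η : Effect D Γ)
    {ν : (S : D.Ty) → Γ.Var S → D.dom S} (hd : C.NormRel d ν) {id : D.dom D.ctype}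
    {c : CaseState D} (hc : CaseSim C s (ev _ (vPi D P)) id c) {r : RepoInst D}
    (hr : RepoSim C s r) (hg : GForm.Holds s ev d (η.trGuard (P := P)))
    (hs' : UpdBy s s' (mkTrans ρ g (η.tr sem)) ev d) :
    ∃ v' r', η.Apply sem I ν (c.val id) c.cv r v' r' ∧
      StepSim C s s' (ev _ (vPi D P)) id ⟨v', ρ.newLife c, c.pend⟩ r' := by
  obtain ⟨v', r', h, hsim⟩ := effect_sim sem η hd hc hr hg (fun x j => hs' (.cv x) j)
    (fun R y => hs' (.flag R) y) (fun R k y => hs' (.attr R k) y)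
  refine ⟨v', r', h, fun j => hs' .self j, hsim.other, fun a x j _ => hs' (.pend a x) j,
    fun b j hj => (hs' (.life b) j).trans (lifeAt_mkTrans_of_ne hj),
    ⟨?_, hsim.cv, fun a x => ?_, fun b => (hs' (.life b) _).trans (lifeAt_mkTrans hc b)⟩,
    hsim.repo⟩
  · have h : selfAt s' (ev _ (vPi D P)) = selfAt s (ev _ (vPi D P)) := hs' .self _
    rw [h]; exact hc.self
  · have h : pendAt s' a x (ev _ (vPi D P)) = pendAt s a x (ev _ (vPi D P)) := hs' (.pend a x) _
    rw [h]; exact hc.pend a x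

end Control

/-- The update of the stored values when a nonatomic task starts. -/
noncomputable def startUpd (a : Addr) (α : SetSpec D) : (b : TArr D) → TCase D α.pre.Pos α.Γ b
  | .pend b x =>
      match if b = a then α.set.tr (P := α.pre.Pos) x else none with
      | none => keep D _ _ (.pend b x)
      | some t => .ite (idxEq (σ := TSort.pi) .new (.old (vPi D α.pre.Pos))) (.term t)
          (keep D _ _ (.pend b x))
  | b => keep D _ _ b

/-- The update of the case variables when a nonatomic task finishes. -/
def finishUpd (a : Addr) (α : SetSpec D) : (b : TArr D) → TCase D Empty (emptyCtx D) b
  | .cv x =>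
      if (α.set x).isSome then
        .ite (idxEq (σ := TSort.pi) .new (.old (vPi D Empty)))
          (.term (.var (.read (A := D.art) (TArr.pend a x) .new)))
          (keep D Empty _ (.cv x))
      else keep D Empty _ (.cv x)
  | b => keep D Empty _ b

theorem stepSim_start {ρ : Rule D} {a : Addr} {α : SetSpec D}
    {ev : (σ : TSort D) → TIV D α.pre.Pos σ → Idx σ}
    {d : (S : RSrt D) → (dataCtx α.Γ).Var S → N.carrier S}
    {g : DGuard D (TIV D α.pre.Pos) (dataCtx α.Γ).Var}
    {ν : (S : D.Ty) → α.Γ.Var S → D.dom S} (hd : C.NormRel d ν) {id : D.dom D.ctype}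
    {c : CaseState D} (hc : CaseSim C s (ev _ (vPi D _)) id c) {r : RepoInst D}
    (hr : RepoSim C s r) (hs' : UpdBy s s' (mkTrans ρ g (startUpd a α)) ev d) :
    StepSim C s s' (ev _ (vPi D _)) id
      ⟨c.cv, ρ.newLife c, Function.update c.pend a (α.set.apply ν (c.pend a))⟩ r := by
  have hpne : ∀ b x, ∀ j ≠ ev _ (vPi D _), pendAt s' b x j = pendAt s b x j := by
    intro b x j hj
    refine (hs' (.pend b x) j).trans ?_
    have : (mkTrans ρ g (startUpd a α)).upd (.pend b x) =
      match if b = a then α.set.tr (P := α.pre.Pos) x else none with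
      | none => keep D _ _ (.pend b x)
      | some t => .ite (idxEq (σ := TSort.pi) .new (.old (vPi D α.pre.Pos))) (.term t)
          (keep D _ _ (.pend b x)) := rfl
    refine (congrArg (CaseTerm.eval s (Snoc.elim j ev) d) this).trans ?_
    generalize (if b = a then α.set.tr (P := α.pre.Pos) x else none) = o
    cases o with
    | none => rfl
    | some t => exact CaseTerm.eval_ite_neg hj
  have hpa : ∀ x, C.rel _ (α.set.apply ν (c.pend a) x) (pendAt s' a x (ev _ (vPi D _))) := by
    intro x
    have e₁ : pendAt s' a x (ev _ (vPi D _)) =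
        CaseTerm.eval s (Snoc.elim (ev _ (vPi D _)) ev) d
          (match α.set.tr (P := α.pre.Pos) x with
          | none => keep D α.pre.Pos α.Γ (.pend a x)
          | some t => .ite (idxEq (σ := TSort.pi) .new (.old (vPi D α.pre.Pos))) (.term t)
            (keep D α.pre.Pos α.Γ (.pend a x))) := by
      refine (hs' (.pend a x) _).trans ?_
      have : (mkTrans ρ g (startUpd a α)).upd (.pend a x) =
        match if a = a then α.set.tr (P := α.pre.Pos) x else none with
        | none => keep D _ _ (.pend a x)
        | some t => .ite (idxEq (σ := TSort.pi) .new (.old (vPi D α.pre.Pos))) (.term t)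
          (keep D _ _ (.pend a x)) := rfl
      rw [if_pos rfl] at this
      exact congrArg (CaseTerm.eval s (Snoc.elim _ ev) d) this
    rw [e₁]
    unfold SetRule.tr SetRule.apply
    generalize α.set x = o
    cases o with
    | none => exact hc.pend a x
    | some t =>
      have h : C.rel _ (t.eval ν) ((t.tr trNorm).eval N
          (AVar.eval s (Snoc.elim (σ := TSort.pi) (ev _ (vPi D _)) ev) d)) :=
        Tm.rel_tr (hd.valRel _) t
      have h' := CaseTerm.eval_ite_pos (s := s)
        (e := Snoc.elim (σ := TSort.pi) (ev _ (vPi D _)) ev) (d := d)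
        (κ := idxEq (σ := TSort.pi) .new (.old (vPi D _))) (t := .term (t.tr trNorm))
        (u := keep D _ _ (.pend a x)) rfl
      exact h'.symm ▸ h
  have hpb : ∀ b ≠ a, ∀ x j, pendAt s' b x j = pendAt s b x j := by
    intro b hb x j
    refine (hs' (.pend b x) j).trans ?_
    have : (mkTrans ρ g (startUpd a α)).upd (.pend b x) =
      match if b = a then α.set.tr (P := α.pre.Pos) x else none with
      | none => keep D _ _ (.pend b x)
      | some t => .ite (idxEq (σ := TSort.pi) .new (.old (vPi D α.pre.Pos))) (.term t)
          (keep D _ _ (.pend b x)) := rfl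
    rw [if_neg hb] at this
    exact congrArg (CaseTerm.eval s (Snoc.elim j ev) d) this
  refine ⟨fun j => hs' .self j, fun x j _ => hs' (.cv x) j, hpne,
    fun b j hj => (hs' (.life b) j).trans (lifeAt_mkTrans_of_ne hj),
    ⟨?_, fun x => ?_, fun b x => ?_, fun b => (hs' (.life b) _).trans (lifeAt_mkTrans hc b)⟩,
    fun R => ?_⟩
  · have h : selfAt s' (ev _ (vPi D _)) = selfAt s (ev _ (vPi D _)) := hs' .self _
    rw [h]; exact hc.self
  · have h : cvAt s' x (ev _ (vPi D _)) = cvAt s x (ev _ (vPi D _)) := hs' (.cv x) _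
    rw [h]; exact hc.cv x
  · by_cases hb : b = a
    · subst hb
      simp only [Function.update_self]
      exact hpa x
    · simp only [Function.update_of_ne hb]
      rw [hpb b hb x]
      exact hc.pend b x
  · obtain ⟨F, τ, h⟩ := hr R
    exact ⟨F, τ, h.congr (fun y => hs' (.flag R) y) (fun k y => hs' (.attr R k) y)⟩

theorem stepSim_finish {ρ : Rule D} {a : Addr} {α : SetSpec D}
    {ev : (σ : TSort D) → TIV D Empty σ → Idx σ}
    {d : (S : RSrt D) → (dataCtx (emptyCtx D)).Var S → N.carrier S}
    {g : DGuard D (TIV D Empty) (dataCtx (emptyCtx D)).Var} {id : D.dom D.ctype}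
    {c : CaseState D} (hc : CaseSim C s (ev _ (vPi D _)) id c) {r : RepoInst D}
    (hr : RepoSim C s r) (hs' : UpdBy s s' (mkTrans ρ g (finishUpd a α)) ev d) :
    StepSim C s s' (ev _ (vPi D _)) id
      ⟨fun x => if (α.set x).isSome then c.pend a x else c.cv x, ρ.newLife c, c.pend⟩ r := by
  have hcv : ∀ x j, cvAt s' x j = CaseTerm.eval s (Snoc.elim j ev) d (if (α.set x).isSome then
        .ite (idxEq (σ := TSort.pi) .new (.old (vPi D Empty)))
          (.term (.var (.read (A := D.art) (TArr.pend a x) .new)))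
          (keep D Empty _ (.cv x))
      else keep D Empty _ (.cv x)) := fun x j => hs' (.cv x) j
  refine ⟨fun j => hs' .self j, fun x j hj => ?_, fun b x j _ => hs' (.pend b x) j,
    fun b j hj => (hs' (.life b) j).trans (lifeAt_mkTrans_of_ne hj),
    ⟨?_, fun x => ?_, fun b x => ?_, fun b => (hs' (.life b) _).trans (lifeAt_mkTrans hc b)⟩,
    fun R => ?_⟩
  · refine (hcv x j).trans ?_
    generalize (α.set x).isSome = o
    cases o with
    | false => rfl
    | true => exact CaseTerm.eval_ite_neg hj
  · have h : selfAt s' (ev _ (vPi D _)) = selfAt s (ev _ (vPi D _)) := hs' .self _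
    rw [h]; exact hc.self
  · rw [hcv x]
    show C.rel _ (if (α.set x).isSome then c.pend a x else c.cv x) _
    generalize (α.set x).isSome = o
    cases o with
    | false => exact hc.cv x
    | true =>
      have h' : CaseTerm.eval s (Snoc.elim (σ := TSort.pi) (ev _ (vPi D Empty)) ev) d
          (.ite (idxEq (σ := TSort.pi) .new (.old (vPi D Empty)))
            (.term (.var (.read (A := D.art) (TArr.pend a x) .new)))
            (keep D Empty (emptyCtx D) (.cv x))) = pendAt s a x (ev _ (vPi D Empty)) :=
        CaseTerm.eval_ite_pos rfl
      exact h'.symm ▸ hc.pend a x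
  · have h : pendAt s' b x (ev _ (vPi D _)) = pendAt s b x (ev _ (vPi D _)) := hs' (.pend b x) _
    rw [h]; exact hc.pend b x
  · obtain ⟨F, τ, h⟩ := hr R
    exact ⟨F, τ, h.congr (fun y => hs' (.flag R) y) (fun k y => hs' (.attr R k) y)⟩

/-- Every transition of the translated system with values in the correspondence is a progression
step. -/
theorem Rule.progress_of_rel (sem : InsertionSemantics D) (ρ : Rule D)
    (ev : (σ : TSort D) → (Rule.tr sem ρ).E.Var σ → Idx σ)
    (d : (S : RSrt D) → (Rule.tr sem ρ).Γ.Var S → N.carrier S)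
    (hg : GForm.Holds s ev d (Rule.tr sem ρ).guard) (hs' : UpdBy s s' (Rule.tr sem ρ) ev d)
    (hd : ∀ S (v : (Rule.tr sem ρ).Γ.Var (RSrt.data S)), ∃ u, C.rel S u (d _ v)) :
    ∃ v : (Rule.tr sem ρ).E.Var TSort.pi, ∀ id c r, CaseSim C s (ev _ v) id c → RepoSim C s r →
      ∃ c' r', (∀ p ∈ ρ.pre, c.life p.1 = p.2) ∧ ρ.act.Apply sem I id c r c' r' ∧
        (∀ b, c'.life b = (ρ.post.lookup b).getD (c.life b)) ∧ StepSim C s s' (ev _ v) id c' r' := by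
  obtain ⟨pre, act, post⟩ := ρ
  cases act with
  | skip =>
    refine ⟨vPi D Empty, fun id c r hc hr => ?_⟩
    obtain ⟨h₁, -⟩ := (mkTrans_guard hc).1 hg
    refine ⟨_, _, h₁, ?_, ?_, stepSim_of_keep hc hr hs'⟩
    exacts [⟨rfl, rfl, rfl⟩, fun _ => rfl]
  | test φ =>
    refine ⟨vPi D Empty, fun id c r hc hr => ?_⟩
    obtain ⟨h₁, h₂⟩ := (mkTrans_guard hc).1 hg
    refine ⟨_, _, h₁, ?_, ?_, stepSim_of_keep hc hr hs'⟩
    exacts [⟨(Cond.holds_tr (hc.valRel d) _ φ).1 h₂, rfl, rfl, rfl⟩, fun _ => rfl]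
  | exec α =>
    refine ⟨vPi D α.pre.Pos, fun id c r hc hr => ?_⟩
    obtain ⟨ν, hν⟩ := C.exists_norm (Γ := α.Γ) hd
    obtain ⟨h₁, h₂⟩ := (mkTrans_guard hc).1 hg
    obtain ⟨h₂, h₃⟩ := QF.holds_and.1 h₂
    obtain ⟨v', r', h, hsim⟩ := stepSim_exec sem α.eff hν hc hr h₃ hs'
    refine ⟨_, r', h₁, ?_, ?_, hsim⟩
    exacts [⟨ν, Guard.answer_of_tr α.pre hr ev hν hc h₂, h, rfl⟩, fun _ => rfl]
  | start a α =>
    refine ⟨vPi D α.pre.Pos, fun id c r hc hr => ?_⟩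
    obtain ⟨ν, hν⟩ := C.exists_norm (Γ := α.Γ) hd
    obtain ⟨h₁, h₂⟩ := (mkTrans_guard hc).1 hg
    refine ⟨_, r, h₁, ?_, ?_, stepSim_start (a := a) hν hc hr hs'⟩
    exacts [⟨ν, Guard.answer_of_tr α.pre hr ev hν hc h₂, rfl, rfl, rfl⟩, fun _ => rfl]
  | finish a α =>
    refine ⟨vPi D Empty, fun id c r hc hr => ?_⟩
    obtain ⟨h₁, -⟩ := (mkTrans_guard hc).1 hg
    refine ⟨_, _, h₁, ?_, ?_, stepSim_finish (a := a) (α := α) hc hr hs'⟩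
    exacts [⟨fun _ => rfl, rfl, rfl⟩, fun _ => rfl]

def idxNameVal {P : Type} (i : Idx .pi) (y : (R : D.Repo) → Idx (.slot R))
    (z : (R : D.Repo) → P → Idx (.slot R)) : (k : TIdx D P) → Idx k.sort
  | .pi => i
  | .eff R => y R
  | .lit R p => z R p

/-- The assignment to the index variables of a translated rule with given values. -/
def idxVal {P : Type} [Finite P] (i : Idx .pi) (y : (R : D.Repo) → Idx (.slot R))
    (z : (R : D.Repo) → P → Idx (.slot R)) : (σ : TSort D) → TIV D P σ → Idx σ
  | _, .mk k => idxNameVal i y z k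

/-- Every progression step is a transition of the translated system. -/
theorem Rule.rel_of_progress [hne : ∀ σ, Nonempty (Idx σ)] [hinf : ∀ R, Infinite (Idx (.slot R))]
    (sem : InsertionSemantics D) (ρ : Rule D) (hC : ∀ S v, I.Ref S v → ∃ n, C.rel S v n)
    {i : Idx .pi} {id : D.dom D.ctype} {c c' : CaseState D} {r r' : RepoInst D}
    (hc : CaseSim C s i id c) (hr : RepoSim C s r) (hpre : ∀ p ∈ ρ.pre, c.life p.1 = p.2)
    (hact : ρ.act.Apply sem I id c r c' r')
    (hpost : ∀ b, c'.life b = (ρ.post.lookup b).getD (c.life b)) :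
    ∃ s', (Rule.tr sem ρ).Rel s s' ∧ StepSim C s s' i id c' r' := by
  obtain ⟨cv', life', pend'⟩ := c'
  obtain rfl : life' = ρ.newLife c := funext hpost
  obtain ⟨pre, act, post⟩ := ρ
  obtain ⟨d₀, hd₀⟩ := C.exists_data (Γ := emptyCtx D) (ν := fun _ v => nomatch v)
    (fun _ v => nomatch v)
  have y₀ : (R : D.Repo) → Idx (.slot R) := fun R => (hne _).some
  cases act with
  | skip =>
    obtain ⟨rfl, rfl, rfl⟩ := hact
    have hc' : CaseSim C s (idxVal i y₀ (fun _ p => p.elim) _ (vPi D Empty)) id c := hc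
    exact ⟨_, ⟨_, d₀, (mkTrans_guard hc').2 ⟨hpre, QF.holds_top⟩, fun _ _ => rfl⟩,
      stepSim_of_keep hc' hr (fun _ _ => rfl)⟩
  | test φ =>
    obtain ⟨hφ, rfl, rfl, rfl⟩ := hact
    have hc' : CaseSim C s (idxVal i y₀ (fun _ p => p.elim) _ (vPi D Empty)) id c := hc
    exact ⟨_, ⟨_, d₀, (mkTrans_guard hc').2 ⟨hpre, (Cond.holds_tr (hc'.valRel d₀) _ φ).2 hφ⟩,
      fun _ _ => rfl⟩, stepSim_of_keep hc' hr (fun _ _ => rfl)⟩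
  | exec α =>
    obtain ⟨ν, hans, heff, rfl⟩ := hact
    obtain ⟨d, hd⟩ := C.exists_data (fun S v => hC S _ (hans.1 S v))
    obtain ⟨z, hz⟩ := Guard.exists_entries α.pre hr hd hans
    obtain ⟨y, hy⟩ := Effect.exists_entry (P := α.pre.Pos) heff hr hd
    have hc' : CaseSim C s (idxVal i y z _ (vPi D α.pre.Pos)) id c := hc
    have hg := hy (idxVal i y z) (fun _ => rfl)
    have hg' := hz (idxVal i y z) (fun _ _ => rfl) (hc'.valRel d)
    obtain ⟨v', r'', h, hsim⟩ := stepSim_exec (ρ := ⟨pre, .exec α, post⟩)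
      (g := .and (Guard.tr α.pre) α.eff.trGuard) sem α.eff hd hc' hr hg (fun _ _ => rfl)
    obtain ⟨rfl, rfl⟩ := heff.unique h
    exact ⟨_, ⟨_, d, (mkTrans_guard hc').2 ⟨hpre, QF.holds_and.2 ⟨hg', hg⟩⟩, fun _ _ => rfl⟩, hsim⟩
  | start a α =>
    obtain ⟨ν, hans, rfl, rfl, rfl⟩ := hact
    obtain ⟨d, hd⟩ := C.exists_data (fun S v => hC S _ (hans.1 S v))
    obtain ⟨z, hz⟩ := Guard.exists_entries α.pre hr hd hans
    have hc' : CaseSim C s (idxVal i y₀ z _ (vPi D α.pre.Pos)) id c := hc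
    have hg' := hz (idxVal i y₀ z) (fun _ _ => rfl) (hc'.valRel d)
    exact ⟨_, ⟨_, d, (mkTrans_guard hc').2 ⟨hpre, hg'⟩, fun _ _ => rfl⟩,
      stepSim_start hd hc' hr (fun _ _ => rfl)⟩
  | finish a α =>
    obtain ⟨hcv, rfl, rfl⟩ := hact
    obtain rfl : cv' = _ := funext hcv
    have hc' : CaseSim C s (idxVal i y₀ (fun _ p => p.elim) _ (vPi D Empty)) id c := hc
    exact ⟨_, ⟨_, d₀, (mkTrans_guard hc').2 ⟨hpre, QF.holds_top⟩, fun _ _ => rfl⟩,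
      stepSim_finish hc' hr (fun _ _ => rfl)⟩

end Rules

/-! ## Simulation of properties -/

section Properties

variable {D : DataSchema} {I : CatInst D} {N : DBModel D.sig} {C : Corr I N}
  {Idx : TSort D → Type} {s s' : AState D.art N Idx}

theorem StepSim.caseSim_of_ne {i j : Idx .pi} {id id' : D.dom D.ctype} {c c' : CaseState D}
    {r' : RepoInst D} (h : StepSim C s s' i id c' r') (hj : j ≠ i) (hc : CaseSim C s j id' c) :
    CaseSim C s' j id' c where
  self := by rw [h.self]; exact hc.self
  cv x := by rw [h.cv x j hj]; exact hc.cv x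
  pend a x := by rw [h.pend a x j hj]; exact hc.pend a x
  life b := by rw [h.life b j hj]; exact hc.life b

variable {IV : TSort D → Type} {DV : RSrt D → Type} {V : D.Ty → Type}

theorem LTm.eval_tr (ev : (σ : TSort D) → IV σ → Idx σ) (d : (S : RSrt D) → DV S → N.carrier S)
    {i : IV .pi} {id : D.dom D.ctype} {c : CaseState D} (hc : CaseSim C s (ev _ i) id c) (t : LTm) :
    (t.tr i).eval N (AVar.eval s ev d) = lifeConst N (t.eval c.life) := by
  cases t with
  | life b => exact hc.life b
  | const st => rfl

theorem LTm.eq_tr (ev : (σ : TSort D) → IV σ → Idx σ) (d : (S : RSrt D) → DV S → N.carrier S)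
    {i : IV .pi} {id : D.dom D.ctype} {c : CaseState D} (hc : CaseSim C s (ev _ i) id c)
    (t u : LTm) :
    (t.tr i).eval N (AVar.eval s ev d) = (u.tr i).eval N (AVar.eval s ev d) ↔
      t.eval c.life = u.eval c.life := by
  rw [LTm.eval_tr ev d hc, LTm.eval_tr ev d hc]
  exact (lifeConst_injective N).eq_iff

theorem PLit.holds_of_tr {θ : (S : D.Ty) → V S → DTerm D IV DV S}
    {ν : (S : D.Ty) → V S → D.dom S} {r : RepoInst D} (hr : RepoSim C s r)
    (ev : (σ : TSort D) → IV σ → Idx σ) (d : (S : RSrt D) → DV S → N.carrier S)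
    (h : C.ValRel (AVar.eval s ev d) θ ν) {i : IV .pi} {id : D.dom D.ctype} {c : CaseState D}
    (hc : CaseSim C s (ev _ i) id c) (e : (R : D.Repo) → IV (.slot R)) (l : PLit D V)
    (hl : GForm.Holds s ev d (l.tr θ i e)) : l.Holds I r c.life ν := by
  cases l with
  | lit l => exact Lit.holds_of_tr hr ev d h e l hl
  | lifeEq t u => exact (LTm.eq_tr ev d hc t u).1 hl
  | lifeNe t u => exact mt (LTm.eq_tr ev d hc t u).2 hl

theorem PLit.exists_entry [hne : ∀ σ, Nonempty (Idx σ)] {ν : (S : D.Ty) → V S → D.dom S}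
    {r : RepoInst D} (hr : RepoSim C s r) {c : CaseState D} (l : PLit D V)
    (hl : l.Holds I r c.life ν) :
    ∃ y : (R : D.Repo) → Idx (.slot R), ∀ (IV : TSort D → Type) (DV : RSrt D → Type)
      (θ : (S : D.Ty) → V S → DTerm D IV DV S) (ev : (σ : TSort D) → IV σ → Idx σ)
      (d : (S : RSrt D) → DV S → N.carrier S) (_ : C.ValRel (AVar.eval s ev d) θ ν)
      (i : IV .pi) (id : D.dom D.ctype) (_ : CaseSim C s (ev _ i) id c)
      (e : (R : D.Repo) → IV (.slot R)) (_ : ∀ R, ev _ (e R) = y R),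
      GForm.Holds s ev d (l.tr θ i e) := by
  cases l with
  | lit l =>
    obtain ⟨y, hy⟩ := Lit.exists_entry hr l hl
    exact ⟨y, fun IV DV θ ev d h i id _ e he => hy IV DV θ ev d h e he⟩
  | lifeEq t u =>
    exact ⟨fun R => (hne _).some, fun IV DV θ ev d h i id hc e he => (LTm.eq_tr ev d hc t u).2 hl⟩
  | lifeNe t u =>
    exact ⟨fun R => (hne _).some,
      fun IV DV θ ev d h i id hc e he => mt (LTm.eq_tr ev d hc t u).1 hl⟩

end Properties

section PropertyTranslation

variable {M : DAB} {I : CatInst M.D} {N : DBModel M.D.sig} {C : Corr I N}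
  {Idx : TSort M.D → Type} {s : AState M.D.art N Idx}

theorem QF.holds_ite_top {Sg : DBSig} {V : Sg.Srt → Type} {At : Type} {M : DBModel Sg}
    {ν : (S : Sg.Srt) → V S → M.carrier S} {h : At → Prop} {p : Prop} [Decidable p]
    {ψ : QF Sg V At} : (if p then .top else ψ).Holds M ν h ↔ (¬ p → ψ.Holds M ν h) := by
  by_cases hp : p
  · simp only [hp, if_true, not_true, false_imp_iff, iff_true]
    exact QF.holds_top
  · simp [hp]

theorem Property.distinct_tr (υ : Property M) (ev : (σ : TSort M.D) → υ.idxCtx.Var σ → Idx σ)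
    (d : (S : RSrt M.D) → (dataCtx υ.Γ).Var S → N.carrier S) :
    GForm.Holds s ev d (.all fun i => .all fun j => if i = j then .top else
      .neg (.atom (.idx (A := M.D.art) TSort.pi (υ.vPi i) (υ.vPi j)))) ↔
    Function.Injective fun i => ev _ (υ.vPi i) := by
  constructor
  · intro h i j hij
    by_contra hne
    exact QF.holds_ite_top.1 (h i j) hne hij
  · exact fun h i j => QF.holds_ite_top.2 fun hij h' => hij (h h')

theorem Property.sat_of_tr (υ : Property M) (ev : (σ : TSort M.D) → υ.idxCtx.Var σ → Idx σ)
    (d : (S : RSrt M.D) → (dataCtx υ.Γ).Var S → N.carrier S)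
    (h : GForm.Holds s ev d υ.tr.body)
    (hd : ∀ S (v : (dataCtx υ.Γ).Var (RSrt.data S)), ∃ u, C.rel S u (d _ v))
    {t : Snapshot M.D} (hr : RepoSim C s t.repo) (hself : Function.Injective (selfAt s))
    (hc : ∀ k, ∃ id c, t.cases id = some c ∧ CaseSim C s (ev _ (υ.vPi k)) id c) : υ.Sat I t := by
  obtain ⟨ν, hν⟩ := C.exists_norm (Γ := υ.Γ) hd
  choose id c htc hc using hc
  obtain ⟨h₁, h₂⟩ := QF.holds_and.1 h
  refine ⟨id, c, ν, fun i j hij => ?_, htc, hν.ref, fun k => ?_⟩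
  · exact (υ.distinct_tr ev d).1 h₁ (hself ((C.eq_iff (hc i).self (hc j).self).1 hij))
  · obtain ⟨i, hi⟩ := h₂ k
    exact ⟨i, fun j => PLit.holds_of_tr hr ev d ((hν.valRel ev).sumElim ((hc k).valRel d)) (hc k) _
      _ (hi j)⟩

def propNameVal {υ : Property M} (i : Fin υ.n → Idx .pi)
    (z : (R : M.D.Repo) → (i : Fin υ.n) → (υ.guard i).Pos → Idx (.slot R)) :
    (k : PIdx υ) → Idx k.sort
  | .pi k => i k
  | .lit R k p => z R k p

/-- The assignment to the index variables of a translated property with given values. -/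
def propVal {υ : Property M} (i : Fin υ.n → Idx .pi)
    (z : (R : M.D.Repo) → (i : Fin υ.n) → (υ.guard i).Pos → Idx (.slot R)) :
    (σ : TSort M.D) → υ.idxCtx.Var σ → Idx σ
  | _, .mk k => propNameVal i z k

theorem Property.tr_of_sat [hne : ∀ σ, Nonempty (Idx σ)] (υ : Property M)
    (hC : ∀ S v, I.Ref S v → ∃ n, C.rel S v n) {t : Snapshot M.D} (hr : RepoSim C s t.repo)
    (hc : ∀ id c, t.cases id = some c → ∃ i, CaseSim C s i id c) (h : υ.Sat I t) :
    υ.tr.Holds s := by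
  obtain ⟨id, c, ν, hid, htc, href, hg⟩ := h
  have := fun k => hc _ _ (htc k)
  choose i hi using this
  obtain ⟨d, hd⟩ := C.exists_data (fun S v => hC S _ (href S v))
  have hz : ∀ k, ∃ (l : Fin (υ.guard k).n) (y : (R : M.D.Repo) → (υ.guard k).Pos → Idx (.slot R)),
      ∀ ev : (σ : TSort M.D) → υ.idxCtx.Var σ → Idx σ,
        (∀ R p, ev _ (υ.vLit k p R) = y R p) → ev _ (υ.vPi k) = i k →
        ∀ j, GForm.Holds s ev d (((υ.guard k).lit l j).tr
          (fun S => Sum.elim (trNorm S) (trCV (υ.vPi k) S)) (υ.vPi k)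
          (fun R => υ.vLit k ⟨l, j⟩ R)) := by
    intro k
    obtain ⟨l, hl⟩ := hg k
    have := fun j => PLit.exists_entry hr _ (hl j)
    choose y hy using this
    classical
    refine ⟨l, fun R p => if hp : p.1 = l then y (hp ▸ p.2) R else (hne _).some,
      fun ev hev hik j => ?_⟩
    have hck : CaseSim C s (ev _ (υ.vPi k)) (id k) (c k) := hik.symm ▸ hi k
    refine hy j _ _ _ ev d ((hd.valRel ev).sumElim (hck.valRel d)) _ (id k) hck _ fun R => ?_
    rw [hev]
    simp
  choose l y hy using hz
  refine ⟨propVal i (fun R k p => y k R p), d, QF.holds_and.2 ⟨?_, fun k => ⟨l k, ?_⟩⟩⟩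
  · refine (υ.distinct_tr _ d).2 fun a b hab => hid ?_
    have hab : i a = i b := hab
    refine (C.eq_iff (hi a).self (hi b).self).2 ?_
    rw [hab]
  · exact hy k _ (fun _ _ => rfl) rfl

end PropertyTranslation

/-! ## Executions as runs of the translated system -/

section CatalogModel

variable {D : DataSchema} (I : CatInst D)

variable {I} in
theorem CatInst.ref_undef (S : D.Ty) : I.Ref S (D.undef S) := .inl rfl

variable {I} in
theorem CatInst.ref_named {S : D.Ty} {c : D.dom S} (hc : c ∈ D.named S) : I.Ref S c := by
  by_cases h : c = D.undef S
  · exact .inl h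
  · refine .inr fun R hR => ?_
    subst hR
    exact I.named R c hc h

variable {I} in
theorem CatInst.ref_attr {R : D.Cat} {t} (ht : t ∈ I.rel R) (k : Fin (D.catArity R)) :
    I.Ref _ (t.2 k) := .inr fun R' h => I.fk R t ht k R' h

variable {I} in
theorem CatInst.Ref.exists_tuple {R : D.Cat} {v : D.dom (D.idTy R)} (h : I.Ref _ v)
    (hv : v ≠ D.undef _) : ∃ t ∈ I.rel R, t.1 = v :=
  (h.resolve_left hv) R rfl

variable {I} in
theorem CatInst.ref_ctype (v : D.dom D.ctype) : I.Ref _ v :=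
  .inr fun R h => absurd h (D.ctype_cat R)

open Classical in
noncomputable def CatInst.lookup (R : D.Cat) (k : Fin (D.catArity R)) (v : D.dom (D.idTy R)) :
    D.dom (D.catTy R k) :=
  if h : ∃ t ∈ I.rel R, t.1 = v then h.choose.2 k else D.undef _

theorem CatInst.lookup_of_mem {R : D.Cat} (k : Fin (D.catArity R)) {t} (ht : t ∈ I.rel R) :
    I.lookup R k t.1 = t.2 k := by
  have h : ∃ t' ∈ I.rel R, t'.1 = t.1 := ⟨t, ht, rfl⟩
  rw [CatInst.lookup, dif_pos h, I.pk R _ h.choose_spec.1 _ ht h.choose_spec.2]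

theorem CatInst.lookup_undef {R : D.Cat} (k : Fin (D.catArity R)) :
    I.lookup R k (D.undef _) = D.undef _ := by
  rw [CatInst.lookup, dif_neg]
  rintro ⟨t, ht, h⟩
  exact I.pk_def R t ht h

theorem CatInst.ref_lookup {R : D.Cat} (k : Fin (D.catArity R)) {v : D.dom (D.idTy R)}
    (hv : I.Ref _ v) : I.Ref _ (I.lookup R k v) := by
  by_cases h : v = D.undef _
  · rw [h, I.lookup_undef]
    exact CatInst.ref_undef _
  · obtain ⟨t, ht, rfl⟩ := hv.exists_tuple h
    rw [I.lookup_of_mem k ht]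
    exact CatInst.ref_attr ht k

theorem CatInst.lookup_eq_undef {R : D.Cat} (k : Fin (D.catArity R)) {v : D.dom (D.idTy R)}
    (hv : I.Ref _ v) : v = D.undef _ ↔ I.lookup R k v = D.undef _ := by
  refine ⟨fun h => by rw [h, I.lookup_undef], fun h => ?_⟩
  by_contra hne
  obtain ⟨t, ht, rfl⟩ := hv.exists_tuple hne
  rw [I.lookup_of_mem k ht] at h
  exact I.attr_def R t ht k h

def CatInst.Carrier : RSrt D → Type
  | .data S => {v : D.dom S // I.Ref S v}
  | .life => LState
  | .flag => Bool

def CatInst.Carrier.val {I : CatInst D} {S : D.Ty} (x : I.Carrier (.data S)) : D.dom S :=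
  Subtype.val x

theorem CatInst.Carrier.ext_iff {I : CatInst D} {S : D.Ty} {x y : I.Carrier (.data S)} :
    x = y ↔ x.val = y.val := Subtype.ext_iff

def CatInst.modelConst : (S : RSrt D) → D.sig.Const S → I.Carrier S
  | .data _, c => ⟨c.1, CatInst.ref_named c.2⟩
  | .life, c => c
  | .flag, c => c

/-- The model of `T` given by a catalog instance. -/
noncomputable def CatInst.model : DBModel D.sig where
  carrier := I.Carrier
  const := I.modelConst
  fn f x := ⟨I.lookup f.1 f.2 x.1, I.ref_lookup f.2 x.2⟩
  null f x := by
    have key := I.lookup_eq_undef f.2 (Subtype.property x)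
    constructor
    · exact fun h => CatInst.Carrier.ext_iff.2 (key.1 (CatInst.Carrier.ext_iff.1 h))
    · exact fun h => CatInst.Carrier.ext_iff.2 (key.2 (CatInst.Carrier.ext_iff.1 h))
  distinct
    | .data _ => fun _ _ h => Subtype.ext (CatInst.Carrier.ext_iff.1 h)
    | .life => fun _ _ h => h
    | .flag => fun _ _ h => h
  closed
    | .data S => fun hS v => ⟨⟨CatInst.Carrier.val v, D.finite_named S hS _⟩, rfl⟩
    | .life => fun _ c => ⟨c, rfl⟩
    | .flag => fun _ c => ⟨c, rfl⟩

variable {I}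

def CatInst.toElem {N : DBModel D.sig} (ε : I.model.Emb N) {S : D.Ty} (v : D.dom S)
    (h : I.Ref S v) : Elem N (.data S) :=
  ε.map (RSrt.data S) ⟨v, h⟩

theorem CatInst.toElem_inj {N : DBModel D.sig} (ε : I.model.Emb N) {S : D.Ty} {v v' : D.dom S}
    {h : I.Ref S v} {h' : I.Ref S v'} : CatInst.toElem ε v h = CatInst.toElem ε v' h' ↔ v = v' :=
  (ε.inj (RSrt.data S)).eq_iff.trans Subtype.ext_iff

theorem CatInst.toElem_const {N : DBModel D.sig} (ε : I.model.Emb N) {S : D.Ty} {c : D.dom S}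
    (h : c ∈ D.named S) (h' : I.Ref S c) : CatInst.toElem ε c h' = dataConst N S c h :=
  ε.map_const (RSrt.data S) ⟨c, h⟩

theorem CatInst.toElem_lookup {N : DBModel D.sig} (ε : I.model.Emb N) {R : D.Cat}
    (k : Fin (D.catArity R)) {v : D.dom (D.idTy R)} (h : I.Ref _ v) :
    CatInst.toElem ε (I.lookup R k v) (I.ref_lookup k h) = catFn N R k (CatInst.toElem ε v h) :=
  ε.map_fn ⟨R, k⟩ ⟨v, h⟩

/-- The correspondence given by an extension of the model of a catalog instance. -/
def CatInst.corr {N : DBModel D.sig} (ε : I.model.Emb N) : Corr I N where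
  rel S v n := ∃ h : I.Ref S v, CatInst.toElem ε v h = n
  eq_iff := by
    rintro S v v' _ _ ⟨h, rfl⟩ ⟨h', rfl⟩
    exact (CatInst.toElem_inj ε).symm
  const S c h := ⟨CatInst.ref_named h, CatInst.toElem_const ε h _⟩
  ref h := h.1
  cat R v n u m hv hu := by
    obtain ⟨hv, rfl⟩ := hv
    choose hu hm using hu
    obtain rfl : _ = m := funext hm
    have hundef : CatInst.toElem ε v hv ≠ undefElem N (D.idTy R) ↔ v ≠ D.undef _ := by
      rw [undefElem, ← CatInst.toElem_const ε (D.undef_named _) (CatInst.ref_undef _), ne_eq,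
        CatInst.toElem_inj]
    rw [hundef]
    simp only [← CatInst.toElem_lookup, CatInst.toElem_inj]
    constructor
    · intro h
      exact ⟨I.pk_def R _ h, fun k => (I.lookup_of_mem k h).symm⟩
    · rintro ⟨hne, h⟩
      obtain ⟨t, ht, rfl⟩ := hv.exists_tuple hne
      obtain rfl : u = t.2 := funext fun k => (h k).trans (I.lookup_of_mem k ht)
      exact ht

end CatalogModel

section Forward

variable (M : DAB)

/-- Process instances are indexed by the case identifiers, and repository entries by numbers. -/
def ExecIdx : TSort M.D → Type
  | .pi => {id : M.D.dom M.D.ctype // id ≠ M.D.undef _}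
  | .slot _ => ℕ

instance ExecIdx.nonempty (σ : TSort M.D) : Nonempty (ExecIdx M σ) := by
  cases σ with
  | pi =>
    have := M.D.id_infinite _ M.D.ctype_id
    obtain ⟨id, h⟩ := exists_ne (M.D.undef M.D.ctype)
    exact ⟨⟨id, h⟩⟩
  | slot R => exact ⟨(0 : ℕ)⟩

instance ExecIdx.infinite (R : M.D.Repo) : Infinite (ExecIdx M (.slot R)) :=
  inferInstanceAs (Infinite ℕ)

variable {M} {I : CatInst M.D} {N : DBModel M.D.sig}

/-- The initial state with the case identifiers as index set. -/
def execInit (ε : I.model.Emb N) : AState M.D.art N (ExecIdx M)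
  | .self, i => ε.map (RSrt.data _) ⟨i.1, CatInst.ref_ctype i.1⟩
  | .cv x, _ => undefElem N (M.D.cvTy x)
  | .pend _ x, _ => undefElem N (M.D.cvTy x)
  | .life _, _ => lifeConst N .idle
  | .attr R k, _ => undefElem N (M.D.repoTy R k)
  | .flag _, _ => flagConst N false

theorem execInit_init (sem : InsertionSemantics M.D) (ε : I.model.Emb N) :
    (M.ras sem).Init (execInit ε) := by
  rintro (_ | x | ⟨a, x⟩ | b | ⟨R, k⟩ | R)
  · refine ⟨fun i j h => Subtype.ext ((CatInst.toElem_inj ε).1 h), fun i h => i.2 ?_⟩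
    refine (CatInst.toElem_inj ε (h := CatInst.ref_ctype i.1) (h' := CatInst.ref_undef _)).1 ?_
    exact h.trans (CatInst.toElem_const ε (M.D.undef_named _) _).symm
  all_goals exact fun _ => rfl

/-- The state describes the snapshot; cases not yet created appear as fresh ones. -/
structure ExecSim (ε : I.model.Emb N) (s : AState M.D.art N (ExecIdx M)) (t : Snapshot M.D) :
    Prop where
  case : ∀ i : {id : M.D.dom M.D.ctype // id ≠ M.D.undef _},
    CaseSim (CatInst.corr ε) s i i.1 ((t.cases i.1).getD (CaseState.fresh M.D))
  repo : RepoSim (CatInst.corr ε) s t.repo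
  def_id : ∀ id c, t.cases id = some c → id ≠ M.D.undef _

theorem ExecSim.init (ε : I.model.Emb N) : ExecSim ε (execInit ε) (Snapshot.initial M.D) where
  case i :=
    { self := ⟨CatInst.ref_ctype i.1, rfl⟩
      cv := fun x => (CatInst.corr ε).const _ _ (M.D.undef_named _)
      pend := fun a x => (CatInst.corr ε).const _ _ (M.D.undef_named _)
      life := fun b => rfl }
  repo R := by
    refine ⟨∅, fun _ _ => M.D.undef _, fun y => ?_, by simp, rfl⟩
    have h : flagAt (execInit ε) R y = flagConst N false := rfl
    rw [h, (flagConst_injective N).eq_iff]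
    simp
  def_id id c h := by cases h

theorem ExecSim.step {sem : InsertionSemantics M.D} {ε : I.model.Emb N}
    {s : AState M.D.art N (ExecIdx M)} {t t' : Snapshot M.D} (h : ExecSim ε s t)
    (ht : M.Step sem I t t') :
    ∃ s', Relation.ReflTransGen (M.ras sem).Next s s' ∧ ExecSim ε s' t' := by
  classical
  cases ht with
  | newCase id hid hfresh =>
    refine ⟨s, .refl, fun i => ?_, h.repo, fun id' c hc => ?_⟩
    · have := h.case i
      by_cases hi : i.1 = id
      · subst hi
        rw [hfresh] at this
        simpa using this
      · simpa [Function.update_of_ne hi] using this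
    · by_cases hi : id' = id
      · exact hi ▸ hid
      · simp only [Function.update_of_ne hi] at hc
        exact h.def_id _ _ hc
  | progress id c c' r' ρ hρ hc hpre hact hpost =>
    have hid := h.def_id id c hc
    have hsim := h.case ⟨id, hid⟩
    rw [hc] at hsim
    obtain ⟨s', hrel, hstep⟩ := Rule.rel_of_progress (C := CatInst.corr ε) sem ρ
      (fun S v hv => ⟨_, hv, rfl⟩) hsim h.repo hpre hact hpost
    refine ⟨s', .single ⟨_, List.mem_map_of_mem hρ, hrel⟩, fun i => ?_, hstep.repo,
      fun id' c hc => ?_⟩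
    · by_cases hi : i.1 = id
      · subst hi
        simpa using hstep.case
      · have := hstep.caseSim_of_ne (fun h' => hi (congrArg Subtype.val h')) (h.case i)
        simpa [Function.update_of_ne hi] using this
    · by_cases hi : id' = id
      · exact hi ▸ hid
      · simp only [Function.update_of_ne hi] at hc
        exact h.def_id _ _ hc

theorem DAB.Reachable.exists_run {sem : InsertionSemantics M.D} (ε : I.model.Emb N)
    {t : Snapshot M.D} (h : M.Reachable sem I t) :
    ∃ s, Relation.ReflTransGen (M.ras sem).Next (execInit ε) s ∧ ExecSim ε s t := by
  induction h with
  | initial => exact ⟨_, .refl, ExecSim.init ε⟩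
  | step t t' _ ht _ ih =>
    obtain ⟨s, hs, hsim⟩ := ih
    obtain ⟨s', hs', hsim'⟩ := hsim.step ht
    exact ⟨s', hs.trans hs', hsim'⟩

theorem BackReach.eq_true_of_reachable {sem : InsertionSemantics M.D} {υ : Property M} {b : Bool}
    (hb : BackReach M sem υ b) {t : Snapshot M.D} (ht : M.Reachable sem I t) (hυ : υ.Sat I t) :
    b = true := by
  obtain ⟨φ, hφ, hreach⟩ := hb
  obtain ⟨N, hN, ⟨ε⟩⟩ := I.model.exists_isTStar
  obtain ⟨s, hs, hsim⟩ := ht.exists_run ε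
  have hsat : υ.tr.Holds s := by
    refine υ.tr_of_sat (C := CatInst.corr ε) (fun S v hv => ⟨_, hv, rfl⟩) hsim.repo
      (fun id c hc => ⟨⟨id, hsim.def_id id c hc⟩, ?_⟩) hυ
    have := hsim.case ⟨id, hsim.def_id id c hc⟩
    rw [hc] at this
    exact this
  exact hreach.complete trivial hN (ExecIdx.nonempty M) (execInit_init sem ε) hs
    (.inl ((hφ N _ hN (ExecIdx.nonempty M) s).2 hsat))

end Forward

/-! ## Runs using finitely many indexes and data values -/

section FiniteRuns

variable {Sg : DBSig}

/-- The states reached from `s₀` by transitions whose index and data variables take values in `J`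
and `X`. -/
inductive RAS.RunIn (𝒮 : RAS Sg) {N : DBModel Sg} {Idx : 𝒮.A.ASrt → Type} (s₀ : AState 𝒮.A N Idx)
    (J : (σ : 𝒮.A.ASrt) → Set (Idx σ)) (X : (S : Sg.Srt) → Set (N.carrier S)) :
    AState 𝒮.A N Idx → Prop
  | init : RAS.RunIn 𝒮 s₀ J X s₀
  | step (s s' : AState 𝒮.A N Idx) (τ : Transition 𝒮.A) (hτ : τ ∈ 𝒮.trans)
      (e : (σ : 𝒮.A.ASrt) → τ.E.Var σ → Idx σ) (d : (S : Sg.Srt) → τ.Γ.Var S → N.carrier S)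
      (hs : RAS.RunIn 𝒮 s₀ J X s) (he : ∀ σ v, e σ v ∈ J σ) (hd : ∀ S v, d S v ∈ X S)
      (hg : GForm.Holds s e d τ.guard)
      (hs' : ∀ a y, s' a y = (τ.upd a).eval s (Snoc.elim y e) d) : RAS.RunIn 𝒮 s₀ J X s'

theorem RAS.RunIn.mono {𝒮 : RAS Sg} {N : DBModel Sg} {Idx : 𝒮.A.ASrt → Type}
    {s₀ s : AState 𝒮.A N Idx} {J J' : (σ : 𝒮.A.ASrt) → Set (Idx σ)}
    {X X' : (S : Sg.Srt) → Set (N.carrier S)} (h : 𝒮.RunIn s₀ J X s) (hJ : ∀ σ, J σ ⊆ J' σ)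
    (hX : ∀ S, X S ⊆ X' S) : 𝒮.RunIn s₀ J' X' s := by
  induction h with
  | init => exact .init
  | step s s' τ hτ e d hs he hd hg hs' ih =>
    exact .step s s' τ hτ e d ih (fun σ v => hJ σ (he σ v)) (fun S v => hX S (hd S v)) hg hs'

theorem Ctx.Var.finite {K : Type} (Γ : Ctx K) (S : K) : Finite (Γ.Var S) :=
  have := Γ.fin
  Finite.of_injective _ Ctx.Var.pos_injective

theorem RAS.exists_runIn {𝒮 : RAS Sg} {N : DBModel Sg} {Idx : 𝒮.A.ASrt → Type}
    {s₀ s : AState 𝒮.A N Idx} (h : Relation.ReflTransGen 𝒮.Next s₀ s) :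
    ∃ (J : (σ : 𝒮.A.ASrt) → Set (Idx σ)) (X : (S : Sg.Srt) → Set (N.carrier S)),
      (∀ σ, (J σ).Finite) ∧ (∀ S, (X S).Finite) ∧ 𝒮.RunIn s₀ J X s := by
  induction h with
  | refl => exact ⟨fun _ => ∅, fun _ => ∅, fun _ => Set.finite_empty, fun _ => Set.finite_empty, .init⟩
  | tail _ hst ih =>
    obtain ⟨J, X, hJ, hX, hrun⟩ := ih
    obtain ⟨τ, hτ, e, d, hg, hs'⟩ := hst
    have := Ctx.Var.finite τ.E
    have := Ctx.Var.finite τ.Γ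
    refine ⟨fun σ => J σ ∪ Set.range (e σ), fun S => X S ∪ Set.range (d S),
      fun σ => (hJ σ).union (Set.finite_range _), fun S => (hX S).union (Set.finite_range _), ?_⟩
    exact .step _ _ τ hτ e d
      (hrun.mono (fun _ => Set.subset_union_left) (fun _ => Set.subset_union_left))
      (fun σ v => .inr ⟨v, rfl⟩) (fun S v => .inr ⟨v, rfl⟩) hg hs'

theorem finite_sigma_slice {ι : Type} {α : ι → Type} {s : Set (Σ i, α i)} (h : s.Finite)
    (i : ι) : {x : α i | (⟨i, x⟩ : Σ i, α i) ∈ s}.Finite :=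
  Set.Finite.preimage sigma_mk_injective.injOn h

/-- Every finite part of a model of `T` extends to a finite part that is closed under functions
which satisfy the axioms of `T` and agree with those of the model on the given part. -/
theorem DBModel.exists_finite_part [Finite Sg.Fn] (N : DBModel Sg)
    (X : (S : Sg.Srt) → Set (N.carrier S)) (hX : ∀ S, (X S).Finite)
    (hundef : ∀ S, N.const S (Sg.undef S) ∈ X S) :
    ∃ (Y : (S : Sg.Srt) → Set (N.carrier S))
      (F : (f : Sg.Fn) → N.carrier (Sg.src f) → N.carrier (Sg.tgt f)),
      (∀ S, (Y S).Finite) ∧ (∀ S, X S ⊆ Y S) ∧ (∀ f, ∀ x ∈ X _, F f x = N.fn f x) ∧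
      (∀ f, ∀ x ∈ Y _, F f x ∈ Y _) ∧
      ∀ f, ∀ x ∈ Y _, x = N.const _ (Sg.undef _) ↔ F f x = N.const _ (Sg.undef _) := by
  classical
  have hdef : ∀ f, ∃ z, ∀ x, x ≠ N.const _ (Sg.undef (Sg.src f)) →
      N.fn f z ≠ N.const _ (Sg.undef _) := by
    intro f
    by_cases h : ∃ x, x ≠ N.const _ (Sg.undef (Sg.src f))
    · obtain ⟨x, hx⟩ := h
      exact ⟨x, fun _ _ => mt (N.null f x).2 hx⟩
    · exact ⟨N.const _ (Sg.undef _), fun x hx => absurd ⟨x, hx⟩ h⟩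
  choose z hz using hdef
  let W : Set (Σ S, N.carrier S) :=
    (⋃ f, (fun x => ⟨Sg.tgt f, N.fn f x⟩) '' X (Sg.src f)) ∪
      Set.range fun f => ⟨Sg.tgt f, N.fn f (z f)⟩
  have hW : W.Finite :=
    (Set.finite_iUnion fun f => (hX _).image _).union (Set.finite_range _)
  let Y : (S : Sg.Srt) → Set (N.carrier S) := fun S => X S ∪ {x | (⟨S, x⟩ : Σ S, N.carrier S) ∈ W}
  have hfn : ∀ f, ∀ x ∈ X (Sg.src f), N.fn f x ∈ Y (Sg.tgt f) := fun f x hx =>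
    .inr (.inl (Set.mem_iUnion.2 ⟨f, x, hx, rfl⟩))
  have hzY : ∀ f, N.fn f (z f) ∈ Y (Sg.tgt f) := fun f => .inr (.inr ⟨f, rfl⟩)
  refine ⟨Y, fun f x => if N.fn f x ∈ Y (Sg.tgt f) then N.fn f x else N.fn f (z f),
    fun S => (hX S).union (finite_sigma_slice hW S), fun S => Set.subset_union_left,
    fun f x hx => if_pos (hfn f x hx), fun f x _ => ?_, fun f x _ => ?_⟩
  · dsimp only
    split_ifs with h
    exacts [h, hzY f]
  · dsimp only
    split_ifs with h
    · exact N.null f x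
    · refine ⟨fun hx => absurd ?_ h, fun h' => ?_⟩
      · rw [(N.null f x).1 hx]
        exact .inl (hundef _)
      · by_contra hx
        exact hz f x hx h'

end FiniteRuns

/-! ## Runs of the translated system as executions -/

/-- A partial embedding into an infinite type extends to any finite set. -/
theorem exists_injOn_extension {α β : Type} (B : Finset β) {κ : B → α} (hκ : Function.Injective κ)
    (h : Infinite β ∨ Function.Surjective κ) {Y : Set α} (hY : Y.Finite) :
    ∃ g : α → β, (∀ c, g (κ c) = c) ∧ Set.InjOn g Y := by
  classical
  rcases h with h | h
  · have : Infinite {c : β // c ∉ B} := B.finite_toSet.infinite_compl.to_subtype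
    let ι := Infinite.natEmbedding {c : β // c ∉ B}
    obtain ⟨num, hnum⟩ := Set.countable_iff_exists_injOn.1 hY.countable
    let g : α → β := fun n => if h : ∃ c, κ c = n then h.choose.1 else (ι (num n)).1
    have hg : ∀ c, g (κ c) = c := by
      intro c
      have hc : ∃ c', κ c' = κ c := ⟨c, rfl⟩
      exact (dif_pos hc).trans (congrArg Subtype.val (hκ hc.choose_spec))
    have hg' : ∀ n, (¬ ∃ c, κ c = n) → g n = (ι (num n)).1 := fun n hn => dif_neg hn
    refine ⟨g, hg, fun n hn n' hn' hnn' => ?_⟩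
    by_cases h₁ : ∃ c, κ c = n <;> by_cases h₂ : ∃ c, κ c = n'
    · obtain ⟨c, rfl⟩ := h₁
      obtain ⟨c', rfl⟩ := h₂
      rw [hg, hg] at hnn'
      rw [Subtype.ext hnn']
    · obtain ⟨c, rfl⟩ := h₁
      rw [hg, hg' _ h₂] at hnn'
      exact absurd (hnn' ▸ c.2) (ι (num n')).2
    · obtain ⟨c, rfl⟩ := h₂
      rw [hg, hg' _ h₁] at hnn'
      exact absurd (hnn'.symm ▸ c.2) (ι (num n)).2
    · rw [hg' _ h₁, hg' _ h₂] at hnn'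
      exact hnum hn hn' (ι.injective (Subtype.ext hnn'))
  · refine ⟨fun n => (Function.surjInv h n).1, fun c => ?_, ?_⟩
    · exact congrArg Subtype.val (hκ (Function.surjInv_eq h _))
    · exact (Subtype.val_injective.comp (Function.injective_surjInv h)).injOn

/-- A finite part `Y` of a model of `T`, with functions `F` satisfying the axioms of `T` and
agreeing with those of the model on the part `X` of `Y`, and with names `g` for its elements. -/
structure Naming {D : DataSchema} (N : DBModel D.sig) where
  X : (S : D.Ty) → Set (Elem N (.data S))
  Y : (S : D.Ty) → Set (Elem N (.data S))
  F : (R : D.Cat) → (k : Fin (D.catArity R)) → Elem N (.data (D.idTy R)) →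
    Elem N (.data (D.catTy R k))
  g : (S : D.Ty) → Elem N (.data S) → D.dom S
  finite : ∀ S, (Y S).Finite
  subset : ∀ {S n}, n ∈ X S → n ∈ Y S
  const_mem : ∀ S c h, dataConst N S c h ∈ X S
  F_eq : ∀ {R} k {x}, x ∈ X (D.idTy R) → F R k x = catFn N R k x
  F_mem : ∀ {R} k {x}, x ∈ Y (D.idTy R) → F R k x ∈ Y _
  F_undef : ∀ {R} k {x}, x ∈ Y (D.idTy R) → (x = undefElem N _ ↔ F R k x = undefElem N _)
  g_const : ∀ S c h, g S (dataConst N S c h) = c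
  g_inj : ∀ {S x y}, x ∈ Y S → y ∈ Y S → (g S x = g S y ↔ x = y)

section Naming

variable {D : DataSchema} {N : DBModel D.sig}

theorem Naming.exists_of_finite (X₀ : (S : RSrt D) → Set (N.carrier S)) (hX₀ : ∀ S, (X₀ S).Finite) :
    ∃ G : Naming N, ∀ S, ∀ x ∈ X₀ (.data S), x ∈ G.X S := by
  have := D.catFin
  have hfn : Finite D.sig.Fn := inferInstanceAs (Finite (Σ R : D.Cat, Fin (D.catArity R)))
  have hconst : ∀ S : RSrt D, Finite (D.sig.Const S) := by
    rintro (S | _ | _)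
    · exact inferInstanceAs (Finite {c // c ∈ D.named S})
    · have : Finite LState := by
        refine Finite.of_surjective
          (![.idle, .enabled, .active, .active2, .compl, .error] : Fin 6 → LState) ?_
        rintro (_ | _ | _ | _ | _ | _)
        exacts [⟨0, rfl⟩, ⟨1, rfl⟩, ⟨2, rfl⟩, ⟨3, rfl⟩, ⟨4, rfl⟩, ⟨5, rfl⟩]
      exact this
    · exact inferInstanceAs (Finite Bool)
  obtain ⟨Y, F, hY, hXY, hF, hFY, hFu⟩ := N.exists_finite_part
    (fun S => X₀ S ∪ Set.range (N.const S)) (fun S => (hX₀ S).union (have := hconst S; Set.finite_range _))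
    (fun S => .inr ⟨_, rfl⟩)
  have hg : ∀ S : D.Ty, ∃ g : Elem N (.data S) → D.dom S,
      (∀ c : {c // c ∈ D.named S}, g (dataConst N S c.1 c.2) = c) ∧
        Set.InjOn g (Y (RSrt.data S)) := by
    intro S
    refine exists_injOn_extension (D.named S) (κ := fun c => dataConst N S c.1 c.2)
      (N.distinct (RSrt.data S)) ?_ (hY _)
    rcases finite_or_infinite (D.dom S) with h | h
    · exact .inr (N.closed (RSrt.data S) h)
    · exact .inl h
  choose g hgc hgi using hg
  exact ⟨{ X := fun S => X₀ (.data S) ∪ Set.range (N.const (RSrt.data S))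
           Y := fun S => Y (.data S)
           F := fun R k => F ⟨R, k⟩
           g := g
           finite := fun S => hY _
           subset := fun h => hXY _ h
           const_mem := fun S c h => .inr ⟨⟨c, h⟩, rfl⟩
           F_eq := fun k x hx => hF ⟨_, k⟩ x hx
           F_mem := fun k x hx => hFY ⟨_, k⟩ x hx
           F_undef := fun k x hx => hFu ⟨_, k⟩ x hx
           g_const := fun S c h => hgc S ⟨c, h⟩
           g_inj := fun hx hy => (hgi _).eq_iff hx hy }, fun S x hx => .inl hx⟩

variable (G : Naming N)

theorem Naming.undef_mem (S : D.Ty) : undefElem N S ∈ G.Y S := G.subset (G.const_mem _ _ _)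

theorem Naming.g_undef (S : D.Ty) : G.g S (undefElem N S) = D.undef S := G.g_const _ _ _

theorem Naming.g_eq_undef {S : D.Ty} {x : Elem N (.data S)} (hx : x ∈ G.Y S) :
    G.g S x = D.undef S ↔ x = undefElem N S := by
  rw [← G.g_undef, G.g_inj hx (G.undef_mem S)]

/-- The tuple with primary key `x`. -/
def Naming.tuple (R : D.Cat) (x : Elem N (.data (D.idTy R))) :
    D.dom (D.idTy R) × ((k : Fin (D.catArity R)) → D.dom (D.catTy R k)) :=
  (G.g _ x, fun k => G.g _ (G.F R k x))

theorem Naming.exists_tuple {S : D.Ty} {x : Elem N (.data S)} (hx : x ∈ G.Y S)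
    (hne : x ≠ undefElem N S) (R : D.Cat) (h : D.idTy R = S) :
    ∃ t ∈ G.tuple R '' {x | x ∈ G.Y _ ∧ x ≠ undefElem N _}, h ▸ t.1 = G.g S x := by
  subst h
  exact ⟨_, ⟨x, ⟨hx, hne⟩, rfl⟩, rfl⟩

/-- The catalog instance formed by the elements of the finite part. -/
def Naming.catInst : CatInst D where
  rel R := G.tuple R '' {x | x ∈ G.Y _ ∧ x ≠ undefElem N _}
  finite R := ((G.finite _).subset fun _ h => h.1).image _
  pk := by
    rintro R _ ⟨x, hx, rfl⟩ _ ⟨y, hy, rfl⟩ h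
    rw [(G.g_inj hx.1 hy.1).1 h]
  pk_def := by
    rintro R _ ⟨x, hx, rfl⟩
    exact mt (G.g_eq_undef hx.1).1 hx.2
  attr_def := by
    rintro R _ ⟨x, hx, rfl⟩ k
    exact mt (G.g_eq_undef (G.F_mem k hx.1)).1 (mt (G.F_undef k hx.1).2 hx.2)
  fk := by
    rintro R _ ⟨x, hx, rfl⟩ k R' h
    exact G.exists_tuple (G.F_mem k hx.1) (mt (G.F_undef k hx.1).2 hx.2) R' h
  named := by
    intro R c hc hne
    refine ⟨_, ⟨dataConst N _ c hc, ⟨G.subset (G.const_mem _ _ _), fun h => hne ?_⟩, rfl⟩,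
      G.g_const _ _ _⟩
    rw [← G.g_const _ c hc, h, G.g_undef]

/-- The correspondence between the elements of the finite part and their names. -/
def Naming.corr : Corr G.catInst N where
  rel S v n := n ∈ G.X S ∧ G.g S n = v
  eq_iff := by
    rintro S _ _ n n' ⟨hn, rfl⟩ ⟨hn', rfl⟩
    exact G.g_inj (G.subset hn) (G.subset hn')
  const S c h := ⟨G.const_mem S c h, G.g_const S c h⟩
  ref := by
    rintro S _ n ⟨hn, rfl⟩
    by_cases h : n = undefElem N S
    · exact .inl ((G.g_eq_undef (G.subset hn)).2 h)
    · exact .inr fun R hR => G.exists_tuple (G.subset hn) h R hR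
  cat := by
    rintro R _ n u m ⟨hn, rfl⟩ hu
    have hF : ∀ k, catFn N R k n ∈ G.Y _ := fun k => G.F_eq k hn ▸ G.F_mem k (G.subset hn)
    constructor
    · rintro ⟨x, ⟨hx, hne⟩, hxu⟩
      obtain ⟨h₁, h₂⟩ := Prod.ext_iff.1 hxu
      obtain rfl := (G.g_inj hx (G.subset hn)).1 h₁
      refine ⟨hne, fun k => ?_⟩
      have h₃ : G.g _ (G.F R k x) = u k := congrFun h₂ k
      rw [G.F_eq k hn, ← (hu k).2, G.g_inj (hF k) (G.subset (hu k).1)] at h₃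
      exact h₃.symm
    · rintro ⟨hne, h⟩
      refine ⟨n, ⟨G.subset hn, hne⟩, Prod.ext rfl (funext fun k => ?_)⟩
      show G.g _ (G.F R k n) = u k
      rw [G.F_eq k hn, ← h k, (hu k).2]

end Naming

section Backward

variable {M : DAB} {N : DBModel M.D.sig} {Idx : TSort M.D → Type}

open Classical in
/-- Any finite set of cases can be created. -/
theorem DAB.reachable_fresh (sem : InsertionSemantics M.D) (I : CatInst M.D)
    (K : Finset (M.D.dom M.D.ctype)) (hK : M.D.undef _ ∉ K) :
    M.Reachable sem I
      ⟨fun id => if id ∈ K then some (CaseState.fresh M.D) else none, fun _ => 0⟩ := by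
  induction K using Finset.induction_on with
  | empty => exact DAB.Reachable.initial
  | insert id K hid ih =>
    refine .step _ _ (ih fun h => hK (Finset.mem_insert_of_mem h)) ?_ ?_
    · have h := DAB.Step.newCase (M := M) (sem := sem) (I := I)
        ⟨fun id => if id ∈ K then some (CaseState.fresh M.D) else none, fun _ => 0⟩ id
        (by rintro rfl; exact hK (Finset.mem_insert_self _ _)) (if_neg hid)
      convert h using 2
      funext id'
      by_cases h' : id' = id
      · subst h'; simp
      · simp [h']
    · refine ⟨fun id' c hc x => ?_, fun R t ht => absurd ht (Multiset.notMem_zero t),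
        fun R t ht => absurd ht (Multiset.notMem_zero t)⟩
      simp only at hc
      split_ifs at hc
      cases hc
      exact CatInst.ref_undef _

/-- The snapshot `t` is described by the state `s`, for the process instances in `J`; all
named case identifiers have been created. -/
structure RunSim (G : Naming N) (J : Set (Idx .pi)) (s₀ s : AState M.D.art N Idx)
    (t : Snapshot M.D) : Prop where
  self : ∀ i, selfAt s i = selfAt s₀ i
  case : ∀ i ∈ J, ∃ id c, t.cases id = some c ∧ CaseSim G.corr s i id c
  repo : RepoSim G.corr s t.repo
  created : ∀ v n, G.corr.rel M.D.ctype v n → v ≠ M.D.undef _ → (t.cases v).isSome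
  valid : t.Valid G.catInst

theorem RepoSim.valid {I : CatInst M.D} {C : Corr I N} {s : AState M.D.art N Idx}
    {t : Snapshot M.D} (h : RepoSim C s t.repo)
    (hcv : ∀ id c, t.cases id = some c → ∀ x, I.Ref _ (c.cv x))
    (hcreated : ∀ v n, C.rel M.D.ctype v n → v ≠ M.D.undef _ → (t.cases v).isSome) : t.Valid I := by
  have hrel : ∀ R, ∀ u ∈ t.repo R, ∀ k, ∃ n, C.rel _ (u k) n := by
    intro R u hu k
    obtain ⟨F, τ, hF⟩ := h R
    rw [hF.eq, Multiset.mem_map] at hu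
    obtain ⟨y, hy, rfl⟩ := hu
    exact ⟨_, hF.attr y hy k⟩
  have key : ∀ (S : M.D.Ty) (v : M.D.dom S) (n : Elem N (.data S)), C.rel S v n →
      ∀ h : S = M.D.ctype, h ▸ v = M.D.undef M.D.ctype ∨ (t.cases (h ▸ v)).isSome := by
    intro S v n hv h
    subst h
    by_cases hne : v = M.D.undef _
    · exact .inl hne
    · exact .inr (hcreated v n hv hne)
  refine ⟨hcv, fun R u hu k => ?_, fun R u hu k hk => ?_⟩
  · obtain ⟨n, hn⟩ := hrel R u hu k
    exact C.ref hn
  · obtain ⟨n, hn⟩ := hrel R u hu k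
    exact key _ _ n hn hk

theorem RunSim.init {sem : InsertionSemantics M.D} {G : Naming N} {J : Set (Idx .pi)}
    {s₀ : AState M.D.art N Idx} (h₀ : (M.ras sem).Init s₀)
    (hself : ∀ i ∈ J, selfAt s₀ i ∈ G.X M.D.ctype) :
    ∃ t, M.Reachable sem G.catInst t ∧ RunSim G J s₀ s₀ t := by
  classical
  let K : Set (M.D.dom M.D.ctype) := {v | (∃ n, G.corr.rel _ v n) ∧ v ≠ M.D.undef _}
  have hK : K.Finite := by
    refine ((G.finite M.D.ctype).image (G.g _)).subset ?_
    rintro v ⟨⟨n, hn, rfl⟩, -⟩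
    exact ⟨n, G.subset hn, rfl⟩
  have hmem : ∀ v n, G.corr.rel _ v n → v ≠ M.D.undef _ → v ∈ hK.toFinset :=
    fun v n hv hne => hK.mem_toFinset.2 ⟨⟨n, hv⟩, hne⟩
  have hrepo : RepoSim G.corr s₀ (fun _ => 0) := by
    refine fun R => ⟨∅, fun _ _ => M.D.undef _, fun y => ?_, by simp, rfl⟩
    have h : flagAt s₀ R y = flagConst N false := h₀ (.flag R) y
    rw [h, (flagConst_injective N).eq_iff]
    simp
  have hcreated : ∀ v n, G.corr.rel M.D.ctype v n → v ≠ M.D.undef _ →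
      (if v ∈ hK.toFinset then some (CaseState.fresh M.D) else none).isSome := fun v n hv hne => by
    rw [if_pos (hmem v n hv hne)]; rfl
  refine ⟨_, DAB.reachable_fresh sem G.catInst hK.toFinset (fun h => (hK.mem_toFinset.1 h).2 rfl),
    fun _ => rfl, fun i hi => ?_, hrepo, hcreated, RepoSim.valid hrepo ?_ hcreated⟩
  · have hi' : G.corr.rel _ (G.g _ (selfAt s₀ i)) (selfAt s₀ i) := ⟨hself i hi, rfl⟩
    have hne : selfAt s₀ i ≠ undefElem N _ := (h₀ .self).2 i
    refine ⟨_, CaseState.fresh M.D,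
      if_pos (hmem _ _ hi' (mt (G.g_eq_undef (G.subset hi'.1)).1 hne)), hi', fun x => ?_,
      fun a x => ?_, fun b => h₀ (.life b) i⟩
    · have h : cvAt s₀ x i = undefElem N _ := h₀ (.cv x) i
      rw [h]
      exact G.corr.const _ _ (M.D.undef_named _)
    · have h : pendAt s₀ a x i = undefElem N _ := h₀ (.pend a x) i
      rw [h]
      exact G.corr.const _ _ (M.D.undef_named _)
  · intro id c hc x
    simp only at hc
    split_ifs at hc
    cases hc
    exact CatInst.ref_undef _

theorem RunSim.step {sem : InsertionSemantics M.D} {G : Naming N} {J : Set (Idx .pi)}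
    {s₀ s s' : AState M.D.art N Idx} {t : Snapshot M.D} (h : RunSim G J s₀ s t)
    (h₀ : Function.Injective (selfAt s₀)) (ht : M.Reachable sem G.catInst t) {ρ : Rule M.D}
    (hρ : ρ ∈ M.rules) (e : (σ : TSort M.D) → (Rule.tr sem ρ).E.Var σ → Idx σ)
    (d : (S : RSrt M.D) → (Rule.tr sem ρ).Γ.Var S → N.carrier S) (he : ∀ v, e .pi v ∈ J)
    (hd : ∀ S v, d (.data S) v ∈ G.X S) (hg : GForm.Holds s e d (Rule.tr sem ρ).guard)
    (hs' : UpdBy s s' (Rule.tr sem ρ) e d) :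
    ∃ t', M.Reachable sem G.catInst t' ∧ RunSim G J s₀ s' t' := by
  classical
  obtain ⟨v, hv⟩ := Rule.progress_of_rel (C := G.corr) sem ρ e d hg hs'
    (fun S v => ⟨_, hd S v, rfl⟩)
  obtain ⟨id, c, hid, hc⟩ := h.case _ (he v)
  obtain ⟨c', r', hpre, hact, hpost, hsim⟩ := hv id c t.repo hc h.repo
  have hcreated : ∀ v n, G.corr.rel M.D.ctype v n → v ≠ M.D.undef _ →
      (Function.update t.cases id (some c') v).isSome := by
    intro v n hv hne
    by_cases hvid : v = id
    · subst hvid; simp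
    · rw [Function.update_of_ne hvid]
      exact h.created v n hv hne
  have hvalid : Snapshot.Valid G.catInst ⟨Function.update t.cases id (some c'), r'⟩ := by
    refine RepoSim.valid hsim.repo (fun id' c'' hc'' x => ?_) hcreated
    by_cases hvid : id' = id
    · subst hvid
      obtain rfl : c' = c'' := by simpa using hc''
      exact G.corr.ref (hsim.case.cv x)
    · simp only [Function.update_of_ne hvid] at hc''
      exact h.valid.1 id' c'' hc'' x
  refine ⟨_, .step t _ ht (.progress t id c c' r' ρ hρ hid hpre hact hpost) hvalid,
    fun i => (hsim.self i).trans (h.self i), fun i hi => ?_, hsim.repo, hcreated, hvalid⟩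
  by_cases hie : i = e _ v
  · subst hie
    exact ⟨id, c', by simp, hsim.case⟩
  · obtain ⟨id', c'', hid', hc''⟩ := h.case i hi
    refine ⟨id', c'', ?_, hsim.caseSim_of_ne hie hc''⟩
    have hne : id' ≠ id := by
      intro heq
      have := (G.corr.eq_iff hc''.self hc.self).1 heq
      rw [h.self, h.self] at this
      exact hie (h₀ this)
    simp only [Function.update_of_ne hne]
    exact hid'

theorem RAS.RunIn.exists_execution {sem : InsertionSemantics M.D} {G : Naming N}
    {Idx : (M.ras sem).A.ASrt → Type} {J : (σ : (M.ras sem).A.ASrt) → Set (Idx σ)}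
    {X : (S : M.D.sig.Srt) → Set (N.carrier S)} {s₀ s : AState (M.ras sem).A N Idx}
    (h₀ : (M.ras sem).Init s₀)
    (hself : ∀ i ∈ J TSort.pi, selfAt (D := M.D) s₀ i ∈ G.X M.D.ctype)
    (hX : ∀ S, ∀ x ∈ X (RSrt.data S), x ∈ G.X S) (h : (M.ras sem).RunIn s₀ J X s) :
    ∃ t, M.Reachable sem G.catInst t ∧ RunSim (M := M) G (J TSort.pi) s₀ s t := by
  induction h with
  | init => exact RunSim.init h₀ hself
  | step s s' τ hτ e d hs he hd hg hs' ih =>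
    obtain ⟨t, ht, hsim⟩ := ih
    obtain ⟨ρ, hρ, rfl⟩ := List.mem_map.1 hτ
    exact hsim.step (h₀ .self).1 ht hρ e d (fun v => he _ v) (fun S v => hX S _ (hd _ v)) hg hs'

theorem BackReach.exists_reachable {sem : InsertionSemantics M.D} {υ : Property M}
    (hb : BackReach M sem υ true) :
    ∃ (I : CatInst M.D) (t : Snapshot M.D), M.Reachable sem I t ∧ υ.Sat I t := by
  obtain ⟨φ, hφ, hreach⟩ := hb
  obtain ⟨N, Idx, hN, hI, s₀, s, h₀, hs, hsφ⟩ := hreach.sound rfl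
  obtain ⟨e, d, hυ⟩ := (hφ N Idx hN hI s).1 hsφ
  obtain ⟨J, X, hJ, hX, hrun⟩ := RAS.exists_runIn hs
  let J' : (σ : TSort M.D) → Set (Idx σ) := fun σ => J σ ∪ Set.range (e σ)
  let X' : (S : RSrt M.D) → Set (N.carrier S) := fun S => X S ∪ Set.range (d S)
  have hJ' : ∀ σ, (J' σ).Finite := fun σ =>
    (hJ σ).union (have := Ctx.Var.finite υ.tr.E σ; Set.finite_range _)
  have hX' : ∀ S, (X' S).Finite := fun S =>
    (hX S).union (have := Ctx.Var.finite υ.tr.Γ S; Set.finite_range _)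
  let W : Set (Σ S : RSrt M.D, N.carrier S) :=
    (fun i => ⟨RSrt.data M.D.ctype, selfAt (D := M.D) s₀ i⟩) '' J' .pi
  have hW : W.Finite := (hJ' .pi).image _
  obtain ⟨G, hG⟩ := Naming.exists_of_finite (N := N) (fun S => X' S ∪ {x | (⟨S, x⟩ : Σ S, _) ∈ W})
    (fun S => (hX' S).union (finite_sigma_slice hW S))
  obtain ⟨t, ht, hsim⟩ := RAS.RunIn.exists_execution (G := G) (J := J') (X := X') h₀
    (fun i hi => hG _ _ (.inr ⟨i, hi, rfl⟩)) (fun S x hx => hG S x (.inl hx))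
    (hrun.mono (fun _ => Set.subset_union_left) (fun _ => Set.subset_union_left))
  refine ⟨G.catInst, t, ht, υ.sat_of_tr (C := G.corr) e d hυ (fun S v => ?_) hsim.repo
    (fun i j hij => ?_) (fun k => hsim.case _ (.inr ⟨_, rfl⟩))⟩
  · exact ⟨_, hG S _ (.inl (.inr ⟨v, rfl⟩)), rfl⟩
  · rw [hsim.self, hsim.self] at hij
    exact (h₀ .self).1 hij

end Backward

end DABVerif

theorem backReach_sound_complete_case_identifier_agnostic
    (M : DABVerif.DAB) (hM : M.CaseIdentifierAgnostic)
    (sem : DABVerif.InsertionSemantics M.D) (υ : DABVerif.Property M) (b : Bool)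
    (hterm : DABVerif.BackReach M sem υ b) :
    b = true ↔
      ∃ (I : DABVerif.CatInst M.D) (s : DABVerif.Snapshot M.D),
        M.Reachable sem I s ∧ υ.Sat I s := by
  constructor
  · rintro rfl
    exact DABVerif.BackReach.exists_reachable hterm
  · rintro ⟨I, s, hs, hυ⟩
    exact DABVerif.BackReach.eq_true_of_reachable hterm hs hυ
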